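/- Let m ∈ (m_s, 1) and let u be a radial energy solution of the fast diffusion equation with exponent m and extinction time T > 0. Then for every integer k ≥ 1 there exist t̄ ∈ (0,T), r̄ > 0 and a constant C′ > 0 such that |∂ᵏ_r u(r,t)| ≥ C′ (1 − t/T)^{1/(1−m)} e^{−(N−1)r/m} for all r ≥ r̄ and all t ∈ [t̄, T). -/

import Mathlib

open MeasureTheory Set Filter Topology

/-- Membership in the radial energy space `H¹_rad` on hyperbolic space `ℍ^N`:
`v` is locally absolutely continuous on `(0,∞)` (expressed via the fundamental theorem
of calculus for its a.e. derivative) and both `v` and `v'` are square-integrable with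
respect to the weight `(sinh s)^(N-1)`. -/
def MemH1rad (N : ℕ) (v : ℝ → ℝ) : Prop :=
  (∀ a b : ℝ, 0 < a → a ≤ b → v b - v a = ∫ s in a..b, deriv v s) ∧
  MeasureTheory.IntegrableOn (fun s => (v s) ^ 2 * Real.sinh s ^ (N - 1)) (Set.Ioi 0) ∧
  MeasureTheory.IntegrableOn (fun s => (deriv v s) ^ 2 * Real.sinh s ^ (N - 1)) (Set.Ioi 0)

/-- The squared `H¹` norm `‖v‖_2² + ‖v'‖_2²` with weight `(sinh s)^(N-1)`. -/
noncomputable def H1normSq (N : ℕ) (v : ℝ → ℝ) : ℝ :=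
  (∫ s in Set.Ioi (0:ℝ), (v s) ^ 2 * Real.sinh s ^ (N - 1)) +
  (∫ s in Set.Ioi (0:ℝ), (deriv v s) ^ 2 * Real.sinh s ^ (N - 1))

/-- A radial energy solution of the fast diffusion equation `u_t = Δ(u^m)` on `ℍ^N`,
with exponent `m`, extinction time `T` (initial datum `u(·,0)`). -/
structure IsRadialEnergySolution (N : ℕ) (m T : ℝ) (u : ℝ → ℝ → ℝ) : Prop where
  continuousOn : ContinuousOn (fun p : ℝ × ℝ => u p.1 p.2) (Set.Ici 0 ×ˢ Set.Icc 0 T)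
  nonneg : ∀ r ∈ Set.Ici (0:ℝ), ∀ t ∈ Set.Icc (0:ℝ) T, 0 ≤ u r t
  smooth : ContDiffOn ℝ (⊤ : ℕ∞) (fun p : ℝ × ℝ => u p.1 p.2) (Set.Ici 0 ×ˢ Set.Ioo 0 T)
  pos : ∀ r ∈ Set.Ici (0:ℝ), ∀ t ∈ Set.Ioo (0:ℝ) T, 0 < u r t
  pde : ∀ r > (0:ℝ), ∀ t ∈ Set.Ioo (0:ℝ) T,
    deriv (fun τ => u r τ) t
      = deriv (deriv (fun ρ => u ρ t ^ m)) r
        + ((N : ℝ) - 1) * (Real.cosh r / Real.sinh r) * deriv (fun ρ => u ρ t ^ m) r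
  neumann : ∀ t ∈ Set.Ioo (0:ℝ) T, deriv (fun ρ => u ρ t ^ m) 0 = 0
  extinction : ∀ r ∈ Set.Ici (0:ℝ), u r T = 0
  energy : ∀ t ∈ Set.Ioo (0:ℝ) T, MemH1rad N (fun ρ => u ρ t ^ m)
  energy_bdd : ∀ ε ∈ Set.Ioo (0:ℝ) T, ∃ C : ℝ, ∀ t ∈ Set.Ico ε T,
    H1normSq N (fun ρ => u ρ t ^ m) ≤ C
  init_bdd : ∃ M : ℝ, ∀ r ∈ Set.Ici (0:ℝ), u r 0 ≤ M
  init_nonzero : ∃ r ∈ Set.Ici (0:ℝ), u r 0 ≠ 0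
  init_energy : MemH1rad N (fun ρ => u ρ 0 ^ m)

/-- The weight. -/
noncomputable def Sf (n : ℕ) (r : ℝ) : ℝ := Real.sinh r ^ n

lemma Sf_pos (n : ℕ) {r : ℝ} (hr : 0 < r) : 0 < Sf n r :=
  pow_pos (Real.sinh_pos_iff.2 hr) n

lemma Sf_nonneg (n : ℕ) {r : ℝ} (hr : 0 ≤ r) : 0 ≤ Sf n r :=
  pow_nonneg (Real.sinh_nonneg_iff.2 hr) n

lemma Sf_zero {n : ℕ} (hn : 1 ≤ n) : Sf n 0 = 0 := by
  simp [Sf]; omega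

lemma Sf_cont (n : ℕ) : Continuous (Sf n) := Real.continuous_sinh.pow n

lemma Sf_mono (n : ℕ) {r s : ℝ} (hr : 0 ≤ r) (h : r ≤ s) : Sf n r ≤ Sf n s :=
  pow_le_pow_left₀ (Real.sinh_nonneg_iff.2 hr) (Real.sinh_le_sinh.2 h) n

lemma one_le_Sf (n : ℕ) {r : ℝ} (hr : 1 ≤ r) : 1 ≤ Sf n r :=
  one_le_pow₀ (hr.trans (Real.self_le_sinh_iff.2 (by linarith)))

/-- The drift. -/
noncomputable def bf (n : ℕ) (r : ℝ) : ℝ := n * (Real.cosh r / Real.sinh r)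

lemma bf_ge (n : ℕ) {r : ℝ} (hr : 0 < r) : (n : ℝ) ≤ bf n r := by
  have h := Real.sinh_pos_iff.2 hr
  have : 1 ≤ Real.cosh r / Real.sinh r := by
    rw [le_div_iff₀ h]; linarith [Real.sinh_lt_cosh r]
  unfold bf
  nlinarith [(Nat.cast_nonneg n : (0:ℝ) ≤ n)]

lemma bf_ge_one {n : ℕ} (hn : 1 ≤ n) {r : ℝ} (hr : 0 < r) : 1 ≤ bf n r :=
  le_trans (by exact_mod_cast hn) (bf_ge n hr)

lemma bf_sub (n : ℕ) {r : ℝ} (hr : 1 ≤ r) : bf n r - n ≤ n * Real.exp (-r) := by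
  have h0 : 1 ≤ Real.sinh r := hr.trans (Real.self_le_sinh_iff.2 (by linarith))
  have : Real.cosh r / Real.sinh r - 1 ≤ Real.exp (-r) := by
    have : Real.cosh r / Real.sinh r - 1 = Real.exp (-r) / Real.sinh r := by
      rw [← Real.cosh_sub_sinh]; field_simp
    rw [this]
    exact div_le_self (Real.exp_pos _).le h0
  unfold bf
  nlinarith [(Nat.cast_nonneg n : (0:ℝ) ≤ n)]

lemma Sf_hasDeriv (n : ℕ) {r : ℝ} (hr : 0 < r) : HasDerivAt (Sf n) (bf n r * Sf n r) r := by
  have h := Real.sinh_pos_iff.2 hr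
  have := (Real.hasDerivAt_sinh r).pow n
  refine this.congr_deriv ?_
  rcases n with _ | n
  · simp [bf]
  · simp only [bf, Sf]; field_simp; simp [pow_succ]

lemma bf_hasDeriv {n : ℕ} (hn : 1 ≤ n) {r : ℝ} (hr : 0 < r) :
    HasDerivAt (bf n) (n - bf n r ^ 2 / n) r := by
  have h := Real.sinh_pos_iff.2 hr
  have hn' : (n : ℝ) ≠ 0 := by positivity
  have := ((Real.hasDerivAt_cosh r).div (Real.hasDerivAt_sinh r) h.ne').const_mul (n : ℝ)
  refine this.congr_deriv ?_
  simp only [bf]; field_simp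

lemma Sf_rpow_hasDeriv (n : ℕ) (β : ℝ) {r : ℝ} (hr : 0 < r) :
    HasDerivAt (fun r => Sf n r ^ β) (β * bf n r * Sf n r ^ β) r := by
  have := (Sf_hasDeriv n hr).rpow_const (p := β) (Or.inl (Sf_pos n hr).ne')
  refine this.congr_deriv ?_
  rw [Real.rpow_sub_one (Sf_pos n hr).ne']
  field_simp [(Sf_pos n hr).ne']

lemma Sf_rpow_cont (n : ℕ) (β : ℝ) : ContinuousOn (fun r => Sf n r ^ β) (Ioi 0) :=
  fun _ hr => (Sf_rpow_hasDeriv n β hr).continuousAt.continuousWithinAt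

/-- mean value type comparison -/
lemma mono_of_deriv {f f' : ℝ → ℝ} {a b : ℝ} (hab : a ≤ b)
    (hc : ContinuousOn f (Icc a b))
    (h : ∀ x ∈ Ioo a b, HasDerivAt f (f' x) x) (h0 : ∀ x ∈ Ioo a b, 0 ≤ f' x) : f a ≤ f b := by
  have := monotoneOn_of_deriv_nonneg (convex_Icc a b) hc
    (fun x hx => by rw [interior_Icc] at hx; exact (h x hx).differentiableAt.differentiableWithinAt)
    (fun x hx => by rw [interior_Icc] at hx; rw [(h x hx).deriv]; exact h0 x hx)
  exact this (left_mem_Icc.2 hab) (right_mem_Icc.2 hab) hab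

lemma le_of_deriv_le {f f' g g' : ℝ → ℝ} {a b : ℝ} (hab : a ≤ b)
    (hf : ContinuousOn f (Icc a b)) (hg : ContinuousOn g (Icc a b))
    (h : ∀ x ∈ Ioo a b, HasDerivAt f (f' x) x) (h' : ∀ x ∈ Ioo a b, HasDerivAt g (g' x) x)
    (h0 : ∀ x ∈ Ioo a b, f' x ≤ g' x) : f b - f a ≤ g b - g a := by
  have := mono_of_deriv (f := fun x => g x - f x) hab (hg.sub hf)
    (fun x hx => (h' x hx).sub (h x hx)) (fun x hx => by linarith [h0 x hx])
  linarith

lemma int_Sf_neg {n : ℕ} (hn : 1 ≤ n) {β : ℝ} (hβ : 0 < β) {r s : ℝ} (hr : 0 < r) (h : r ≤ s) :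
    ∫ x in r..s, Sf n x ^ (-β) ≤ β⁻¹ * Sf n r ^ (-β) := by
  have hc : ∀ β : ℝ, ContinuousOn (fun r => Sf n r ^ β) (uIcc r s) := fun β =>
    (Sf_rpow_cont n β).mono (by rw [uIcc_of_le h]; exact fun x hx => lt_of_lt_of_le hr hx.1)
  have h1 : ∀ x ∈ uIcc r s, HasDerivAt (fun r => -β⁻¹ * Sf n r ^ (-β)) (bf n x * Sf n x ^ (-β)) x := by
    intro x hx
    rw [uIcc_of_le h] at hx
    refine ((Sf_rpow_hasDeriv n (-β) (lt_of_lt_of_le hr hx.1)).const_mul (-β⁻¹)).congr_deriv ?_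
    field_simp
  have hbc : ContinuousOn (bf n) (uIcc r s) := fun x hx => by
    rw [uIcc_of_le h] at hx
    exact (bf_hasDeriv hn (lt_of_lt_of_le hr hx.1)).continuousAt.continuousWithinAt
  have h2 := intervalIntegral.integral_eq_sub_of_hasDerivAt h1
    (ContinuousOn.intervalIntegrable (hbc.mul (hc _)))
  have h3 : ∫ x in r..s, Sf n x ^ (-β) ≤ ∫ x in r..s, bf n x * Sf n x ^ (-β) := by
    apply intervalIntegral.integral_mono_on h (hc _).intervalIntegrable
      (hbc.mul (hc _)).intervalIntegrable
    intro x hx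
    have hx0 := lt_of_lt_of_le hr hx.1
    simp only [Pi.mul_apply]
    nlinarith [bf_ge_one hn hx0, Real.rpow_pos_of_pos (Sf_pos n hx0) (-β)]
  rw [h2] at h3
  have : 0 < β⁻¹ * Sf n s ^ (-β) := mul_pos (inv_pos.2 hβ)
    (Real.rpow_pos_of_pos (Sf_pos n (lt_of_lt_of_le hr h)) _)
  linarith

lemma int_Sf_pos {n : ℕ} (hn : 1 ≤ n) {β : ℝ} (hβ : 0 < β) {r s : ℝ} (hr : 0 < r) (h : r ≤ s) :
    ∫ x in r..s, Sf n x ^ β ≤ β⁻¹ * Sf n s ^ β := by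
  have hc : ∀ β : ℝ, ContinuousOn (fun r => Sf n r ^ β) (uIcc r s) := fun β =>
    (Sf_rpow_cont n β).mono (by rw [uIcc_of_le h]; exact fun x hx => lt_of_lt_of_le hr hx.1)
  have h1 : ∀ x ∈ uIcc r s, HasDerivAt (fun r => β⁻¹ * Sf n r ^ β) (bf n x * Sf n x ^ β) x := by
    intro x hx
    rw [uIcc_of_le h] at hx
    refine ((Sf_rpow_hasDeriv n β (lt_of_lt_of_le hr hx.1)).const_mul (β⁻¹)).congr_deriv ?_
    field_simp
  have hbc : ContinuousOn (bf n) (uIcc r s) := fun x hx => by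
    rw [uIcc_of_le h] at hx
    exact (bf_hasDeriv hn (lt_of_lt_of_le hr hx.1)).continuousAt.continuousWithinAt
  have h2 := intervalIntegral.integral_eq_sub_of_hasDerivAt h1
    (ContinuousOn.intervalIntegrable (hbc.mul (hc _)))
  have h3 : ∫ x in r..s, Sf n x ^ β ≤ ∫ x in r..s, bf n x * Sf n x ^ β := by
    apply intervalIntegral.integral_mono_on h (hc _).intervalIntegrable
      (hbc.mul (hc _)).intervalIntegrable
    intro x hx
    have hx0 := lt_of_lt_of_le hr hx.1
    simp only [Pi.mul_apply]
    nlinarith [bf_ge_one hn hx0, Real.rpow_pos_of_pos (Sf_pos n hx0) β]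
  rw [h2] at h3
  have : 0 < β⁻¹ * Sf n r ^ β := mul_pos (inv_pos.2 hβ)
    (Real.rpow_pos_of_pos (Sf_pos n hr) _)
  linarith

lemma Sf_tendsto {n : ℕ} (hn : 1 ≤ n) : Tendsto (Sf n) atTop atTop := by
  refine tendsto_atTop_mono' _ ?_ tendsto_id
  filter_upwards [eventually_ge_atTop 1] with r hr
  have h0 : r ≤ Real.sinh r := Real.self_le_sinh_iff.2 (by linarith)
  calc r ≤ Real.sinh r := h0
    _ ≤ Real.sinh r ^ n := le_self_pow₀ (hr.trans h0) (by omega)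

/-- The volume function. -/
noncomputable def Vf (n : ℕ) (r : ℝ) : ℝ := ∫ x in (0:ℝ)..r, Sf n x

lemma Vf_hasDeriv (n : ℕ) (r : ℝ) : HasDerivAt (Vf n) (Sf n r) r :=
  intervalIntegral.integral_hasDerivAt_right ((Sf_cont n).intervalIntegrable _ _)
    (Sf_cont n).stronglyMeasurable.stronglyMeasurableAtFilter (Sf_cont n).continuousAt

lemma Vf_zero (n : ℕ) : Vf n 0 = 0 := by simp [Vf]

lemma Vf_nonneg (n : ℕ) {r : ℝ} (hr : 0 ≤ r) : 0 ≤ Vf n r :=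
  intervalIntegral.integral_nonneg hr fun _ hx => Sf_nonneg n hx.1

lemma Vf_le (n : ℕ) {r : ℝ} (hr : 0 ≤ r) : Vf n r ≤ r * Sf n r := by
  have := intervalIntegral.integral_mono_on hr ((Sf_cont n).intervalIntegrable _ _)
    (continuous_const.intervalIntegrable (μ := volume) 0 r) (fun x hx => Sf_mono n hx.1 hx.2)
  simpa [Vf] using this

lemma Vf_le' {n : ℕ} (hn : 1 ≤ n) {r : ℝ} (hr : 0 ≤ r) : Vf n r ≤ Sf n r := by
  have := le_of_deriv_le (f := Vf n) (g := Sf n) hr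
    (fun x _ => (Vf_hasDeriv n x).continuousAt.continuousWithinAt) (Sf_cont n).continuousOn
    (fun x _ => Vf_hasDeriv n x) (fun x hx => Sf_hasDeriv n hx.1)
    (fun x hx => by nlinarith [bf_ge_one hn hx.1, Sf_pos n hx.1])
  rw [Vf_zero, Sf_zero hn] at this; linarith

lemma Sf_add (n : ℕ) {r d : ℝ} (hr : 0 ≤ r) (hd : 0 ≤ d) :
    Real.exp (n * d) * Sf n r ≤ Sf n (r + d) := by
  have : Real.exp d * Real.sinh r ≤ Real.sinh (r + d) := by
    rw [Real.sinh_add, ← Real.cosh_add_sinh]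
    nlinarith [mul_nonneg (Real.sinh_nonneg_iff.2 hd) (sub_nonneg.2 (Real.sinh_lt_cosh r).le)]
  rw [Real.exp_nat_mul, Sf, ← mul_pow]
  exact pow_le_pow_left₀ (mul_nonneg (Real.exp_pos _).le (Real.sinh_nonneg_iff.2 hr)) this n

lemma Sf_le_exp (n : ℕ) {r : ℝ} (hr : 0 ≤ r) : Sf n r ≤ Real.exp (n * r) := by
  rw [Real.exp_nat_mul]
  refine pow_le_pow_left₀ (Real.sinh_nonneg_iff.2 hr) ?_ n
  rw [← Real.cosh_add_sinh]; linarith [Real.cosh_pos r]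

/-- The decaying harmonic function. -/
lemma exists_Y {n : ℕ} (hn : 1 ≤ n) : ∃ Y : ℝ → ℝ, ∃ c > 0,
    (∀ r > 0, HasDerivAt Y (-(Sf n r)⁻¹) r) ∧ Tendsto Y atTop (𝓝 0) ∧
    (∀ r > 0, 0 < Y r) ∧ (∀ r > 0, Y r ≤ (Sf n r)⁻¹) ∧ (∀ r ≥ 1, c * (Sf n r)⁻¹ ≤ Y r) := by
  have hci : ContinuousOn (fun r => (Sf n r)⁻¹) (Ioi 0) :=
    (Sf_cont n).continuousOn.inv₀ fun x hx => (Sf_pos n hx).ne'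
  have hint : ∀ a b : ℝ, 0 < a → 0 < b → IntervalIntegrable (fun r => (Sf n r)⁻¹) volume a b := by
    intro a b ha hb
    apply (hci.mono _).intervalIntegrable
    intro x hx; exact lt_of_lt_of_le (lt_min ha hb) hx.1
  set G : ℝ → ℝ := fun r => ∫ x in (1:ℝ)..r, (Sf n x)⁻¹
  have hG : ∀ r > 0, HasDerivAt G ((Sf n r)⁻¹) r := fun r hr =>
    intervalIntegral.integral_hasDerivAt_right (hint 1 r one_pos hr)
      (hci.stronglyMeasurableAtFilter isOpen_Ioi r hr) (hci.continuousAt (Ioi_mem_nhds hr))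
  have hmono : ∀ r s, 0 < r → r ≤ s → G r ≤ G s := fun r s hr hrs =>
    mono_of_deriv hrs (fun x hx => (hG x (hr.trans_le hx.1)).continuousAt.continuousWithinAt)
      (fun x hx => hG x (hr.trans hx.1)) fun x hx => inv_nonneg.2 (Sf_nonneg n (hr.trans hx.1).le)
  have hbd : ∀ r ≥ 1, G r ≤ 1 := by
    intro r hr
    have := int_Sf_neg hn one_pos one_pos hr
    simp only [Real.rpow_neg_one] at this
    refine this.trans ?_
    simpa using inv_le_one_of_one_le₀ (one_le_Sf n le_rfl)
  have hlim : ∃ L, Tendsto G atTop (𝓝 L) := by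
    have h1 : Monotone (fun x => G (max x 1)) := fun x y hxy =>
      hmono _ _ (by positivity) (max_le_max_right _ hxy)
    have h2 : BddAbove (range (fun x => G (max x 1))) := ⟨1, by
      rintro _ ⟨x, rfl⟩; exact hbd _ (le_max_right _ _)⟩
    refine ⟨_, (tendsto_atTop_ciSup h1 h2).congr' ?_⟩
    filter_upwards [eventually_ge_atTop 1] with x hx
    simp [max_eq_left hx]
  obtain ⟨L, hL⟩ := hlim
  have hY : ∀ r > 0, HasDerivAt (fun r => L - G r) (-(Sf n r)⁻¹) r := fun r hr => by
    simpa using (hG r hr).const_sub L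
  have hY0 : Tendsto (fun r => L - G r) atTop (𝓝 0) := by simpa using hL.const_sub L
  have hS0 : Tendsto (fun r => (Sf n r)⁻¹) atTop (𝓝 0) := (Sf_tendsto hn).inv_tendsto_atTop
  have hSd : ∀ r > 0, HasDerivAt (fun r => (Sf n r)⁻¹) (-(bf n r * (Sf n r)⁻¹)) r := fun r hr => by
    refine ((Sf_hasDeriv n hr).inv (Sf_pos n hr).ne').congr_deriv ?_
    have := (Sf_pos n hr).ne'
    field_simp
  have key : ∀ h : ℝ → ℝ, ∀ h' : ℝ → ℝ, ∀ r > 0, (∀ x ≥ r, HasDerivAt h (h' x) x) →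
      (∀ x ≥ r, h' x ≤ 0) → Tendsto h atTop (𝓝 0) → 0 ≤ h r := by
    intro h h' r hr hd h0 ht
    refine le_of_tendsto ht ?_
    filter_upwards [eventually_ge_atTop r] with s hs
    have := mono_of_deriv (f := fun x => - h x) hs
      (fun x hx => (hd x hx.1).continuousAt.neg.continuousWithinAt)
      (fun x hx => (hd x hx.1.le).neg) (fun x hx => by linarith [h0 x hx.1.le])
    linarith
  have hc1 : 0 < bf n 1 := lt_of_lt_of_le one_pos (bf_ge_one hn one_pos)
  refine ⟨fun r => L - G r, (bf n 1)⁻¹, inv_pos.2 hc1, hY, hY0, ?_, ?_, ?_⟩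
  · intro r hr
    have h1 : ∀ r > 0, 0 ≤ L - G r := fun r hr => key _ (fun r => -(Sf n r)⁻¹) r hr
      (fun x hx => hY x (hr.trans_le hx))
      (fun x hx => neg_nonpos.2 (inv_nonneg.2 (Sf_nonneg n (hr.le.trans hx)))) hY0
    have h2 : ∫ x in r..(r+1), (Sf n x)⁻¹ = G (r+1) - G r := by
      apply intervalIntegral.integral_eq_sub_of_hasDerivAt
      · intro x hx; rw [uIcc_of_le (by linarith)] at hx; exact hG x (hr.trans_le hx.1)
      · exact hint _ _ hr (by linarith)
    have h3 : 0 < ∫ x in r..(r+1), (Sf n x)⁻¹ := by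
      apply intervalIntegral.intervalIntegral_pos_of_pos_on (hint _ _ hr (by linarith)) _ (by linarith)
      intro x hx; exact inv_pos.2 (Sf_pos n (hr.trans hx.1))
    have := h1 (r+1) (by linarith)
    linarith
  · intro r hr
    have := key (fun r => (Sf n r)⁻¹ - (L - G r)) (fun r => -(bf n r * (Sf n r)⁻¹) - -(Sf n r)⁻¹) r hr
      (fun x hx => (hSd x (hr.trans_le hx)).sub (hY x (hr.trans_le hx)))
      (fun x hx => by
        have h0 := hr.trans_le hx
        nlinarith [bf_ge_one hn h0, inv_pos.2 (Sf_pos n h0)]) (by simpa using hS0.sub hY0)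
    linarith
  · intro r hr
    have hr0 : (0:ℝ) < r := by linarith
    have hb : ∀ x ≥ r, bf n x ≤ bf n 1 := by
      intro x hx
      have := mono_of_deriv (f := fun x => - bf n x) (a := 1) (b := x) (by linarith)
        (fun x hx => (bf_hasDeriv hn (by linarith [hx.1])).continuousAt.neg.continuousWithinAt)
        (fun x hx => (bf_hasDeriv hn (by linarith [hx.1])).neg) (fun x hx => by
          have h := bf_ge n (r := x) (by linarith [hx.1])
          have hn' : (0:ℝ) < n := by positivity
          rw [neg_nonneg, sub_nonpos, le_div_iff₀ hn']
          nlinarith)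
      linarith
    have := key (fun r => bf n 1 * (L - G r) - (Sf n r)⁻¹)
      (fun r => bf n 1 * -(Sf n r)⁻¹ - -(bf n r * (Sf n r)⁻¹)) r hr0
      (fun x hx => ((hY x (hr0.trans_le hx)).const_mul _).sub (hSd x (hr0.trans_le hx)))
      (fun x hx => by
        have h0 := hr0.trans_le hx
        nlinarith [hb x hx, inv_pos.2 (Sf_pos n h0)]) (by simpa using (hY0.const_mul (bf n 1)).sub hS0)
    rw [inv_mul_le_iff₀ hc1]; linarith

lemma slice_r {g : ℝ → ℝ → ℝ} {A B : Set ℝ}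
    (hg : ContinuousOn (fun p : ℝ × ℝ => g p.1 p.2) (A ×ˢ B)) {t : ℝ} (ht : t ∈ B) :
    ContinuousOn (fun r => g r t) A :=
  hg.comp (f := fun r : ℝ => (r, t)) (by fun_prop) fun _ hr => ⟨hr, ht⟩

lemma slice_t {g : ℝ → ℝ → ℝ} {A B : Set ℝ}
    (hg : ContinuousOn (fun p : ℝ × ℝ => g p.1 p.2) (A ×ˢ B)) {r : ℝ} (hr : r ∈ A) :
    ContinuousOn (fun t => g r t) B :=
  hg.comp (f := fun t : ℝ => (r, t)) (by fun_prop) fun _ ht => ⟨hr, ht⟩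

lemma swap_cont {g : ℝ → ℝ → ℝ} {A B : Set ℝ}
    (hg : ContinuousOn (fun p : ℝ × ℝ => g p.1 p.2) (A ×ˢ B)) :
    ContinuousOn (fun p : ℝ × ℝ => g p.2 p.1) (B ×ˢ A) :=
  hg.comp (f := fun p : ℝ × ℝ => (p.2, p.1)) (by fun_prop) fun _ hp => ⟨hp.2, hp.1⟩

lemma exists_bd {g : ℝ → ℝ → ℝ} {A B : Set ℝ} (hA : IsCompact A) (hB : IsCompact B)
    (hg : ContinuousOn (fun p : ℝ × ℝ => g p.1 p.2) (A ×ˢ B)) :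
    ∃ C > 0, ∀ r ∈ A, ∀ t ∈ B, |g r t| ≤ C := by
  obtain ⟨C, hC⟩ := (hA.prod hB).exists_bound_of_continuousOn hg
  exact ⟨max C 1, by positivity, fun r hr t ht => (hC (r, t) ⟨hr, ht⟩).trans (le_max_left _ _)⟩

lemma dint {g gt : ℝ → ℝ → ℝ} {a b t1 t2 : ℝ} (hab : a ≤ b)
    (hg : ContinuousOn (fun p : ℝ × ℝ => g p.1 p.2) (Icc a b ×ˢ Ioo t1 t2))
    (hgt : ContinuousOn (fun p : ℝ × ℝ => gt p.1 p.2) (Icc a b ×ˢ Ioo t1 t2))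
    (hd : ∀ r ∈ Ioc a b, ∀ t ∈ Ioo t1 t2, HasDerivAt (fun τ => g r τ) (gt r t) t)
    {t : ℝ} (ht : t ∈ Ioo t1 t2) :
    HasDerivAt (fun τ => ∫ r in a..b, g r τ) (∫ r in a..b, gt r t) t := by
  obtain ⟨δ, hδ, hsub⟩ : ∃ δ > 0, Icc (t - δ) (t + δ) ⊆ Ioo t1 t2 := by
    refine ⟨min (t - t1) (t2 - t) / 2, by have := sub_pos.2 ht.1; have := sub_pos.2 ht.2; positivity, ?_⟩
    intro x hx
    have h1 := min_le_left (t - t1) (t2 - t)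
    have h2 := min_le_right (t - t1) (t2 - t)
    have := ht.1; have := ht.2; have := hx.1; have := hx.2
    constructor <;> linarith
  obtain ⟨C, hC0, hC⟩ := exists_bd (isCompact_Icc (a := a) (b := b))
    (isCompact_Icc (a := t - δ) (b := t + δ)) (hgt.mono (prod_mono le_rfl hsub))
  have key := intervalIntegral.hasDerivAt_integral_of_dominated_loc_of_deriv_le (μ := volume)
    (F := fun τ r => g r τ) (F' := fun τ r => gt r τ) (x₀ := t) (a := a) (b := b)
    (s := Ioo (t - δ) (t + δ)) (bound := fun _ => C)
    (Ioo_mem_nhds (by linarith) (by linarith))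
    (by
      filter_upwards [Ioo_mem_nhds ht.1 ht.2] with x hx
      have := slice_r hg hx
      rw [uIoc_of_le hab]
      exact (this.mono Ioc_subset_Icc_self).aestronglyMeasurable measurableSet_Ioc)
    (by
      apply ContinuousOn.intervalIntegrable
      rw [uIcc_of_le hab]; exact slice_r hg ht)
    (by
      rw [uIoc_of_le hab]
      exact ((slice_r hgt ht).mono Ioc_subset_Icc_self).aestronglyMeasurable measurableSet_Ioc)
    (by
      refine Eventually.of_forall fun r hr x hx => ?_
      rw [uIoc_of_le hab] at hr
      exact hC r (Ioc_subset_Icc_self hr) x (Ioo_subset_Icc_self hx))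
    (intervalIntegrable_const)
    (by
      refine Eventually.of_forall fun r hr x hx => ?_
      rw [uIoc_of_le hab] at hr
      exact hd r hr x (hsub (Ioo_subset_Icc_self hx)))
  exact key.2

lemma cint {g : ℝ → ℝ → ℝ} {a b : ℝ} {K : Set ℝ} (hK : IsCompact K) (hab : a ≤ b)
    (hg : ContinuousOn (fun p : ℝ × ℝ => g p.1 p.2) (Icc a b ×ˢ K)) :
    ContinuousOn (fun τ => ∫ r in a..b, g r τ) K := by
  obtain ⟨C, hC0, hC⟩ := exists_bd (isCompact_Icc (a := a) (b := b)) hK hg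
  intro t ht
  apply intervalIntegral.continuousWithinAt_of_dominated_interval (bound := fun _ => C)
  · filter_upwards [self_mem_nhdsWithin] with x hx
    rw [uIoc_of_le hab]
    exact ((slice_r hg hx).mono Ioc_subset_Icc_self).aestronglyMeasurable measurableSet_Ioc
  · filter_upwards [self_mem_nhdsWithin] with x hx
    refine Eventually.of_forall fun r hr => ?_
    rw [uIoc_of_le hab] at hr
    exact hC r (Ioc_subset_Icc_self hr) x hx
  · exact intervalIntegrable_const
  · refine Eventually.of_forall fun r hr => ?_
    rw [uIoc_of_le hab] at hr
    exact slice_t hg (Ioc_subset_Icc_self hr) t ht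

/-- joint continuity of the primitive -/
lemma cprim {g : ℝ → ℝ → ℝ} {B : Set ℝ} (hB : ∀ t ∈ B, ∃ K, IsCompact K ∧ K ⊆ B ∧ K ∈ 𝓝[B] t)
    (hg : ContinuousOn (fun p : ℝ × ℝ => g p.1 p.2) (Ici 0 ×ˢ B)) :
    ContinuousOn (fun p : ℝ × ℝ => ∫ x in (0:ℝ)..p.1, g x p.2) (Ici 0 ×ˢ B) := by
  have hint : ∀ t ∈ B, ∀ x ≥ 0, ∀ y ≥ 0, IntervalIntegrable (fun x => g x t) volume x y := by
    intro t ht x hx y hy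
    apply ContinuousOn.intervalIntegrable
    exact (slice_r hg ht).mono fun z hz => le_trans (le_min hx hy) hz.1
  rintro ⟨r, t⟩ ⟨hr, ht⟩
  simp only [mem_Ici] at hr ht
  obtain ⟨K, hK, hKB, hKt⟩ := hB t ht
  have hgK : ContinuousOn (fun p : ℝ × ℝ => g p.1 p.2) (Icc 0 (r+1) ×ˢ K) :=
    hg.mono (prod_mono Icc_subset_Ici_self hKB)
  obtain ⟨C, hC0, hC⟩ := exists_bd isCompact_Icc hK hgK
  have htK : t ∈ K := mem_of_mem_nhdsWithin ht hKt
  have h1 := (cint hK hr (hgK.mono (prod_mono (Icc_subset_Icc_right (by linarith)) le_rfl))) t htK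
  have h1' : ContinuousWithinAt (fun τ => ∫ x in (0:ℝ)..r, g x τ) B t :=
    h1.mono_of_mem_nhdsWithin hKt
  rw [ContinuousWithinAt, Metric.tendsto_nhds] at h1' ⊢
  intro ε hε
  have e1 := h1' (ε/2) (by positivity)
  rw [nhdsWithin_prod_eq]
  have e2 : ∀ᶠ s in 𝓝[Ici 0] r, |s - r| < min 1 (ε / (2 * C)) ∧ s ∈ Ici (0:ℝ) := by
    refine Filter.Eventually.and ?_ self_mem_nhdsWithin
    apply nhdsWithin_le_nhds
    have : Metric.ball r (min 1 (ε / (2 * C))) ∈ 𝓝 r := Metric.ball_mem_nhds _ (by positivity)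
    filter_upwards [this] with s hs
    simpa [Real.dist_eq] using hs
  filter_upwards [e2.prod_mk (e1.and hKt)] with p hp
  obtain ⟨⟨hp1, hp0⟩, hp2, hp3⟩ := hp
  have hp3 : p.2 ∈ K := hp3
  rw [Real.dist_eq] at hp2 ⊢
  have hsplit : ∫ x in (0:ℝ)..p.1, g x p.2 = (∫ x in (0:ℝ)..r, g x p.2) + ∫ x in r..p.1, g x p.2 :=
    (intervalIntegral.integral_add_adjacent_intervals (hint _ (hKB hp3) _ le_rfl _ hr)
      (hint _ (hKB hp3) _ hr _ hp0)).symm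
  have hb : |∫ x in r..p.1, g x p.2| ≤ C * |p.1 - r| := by
    rw [← Real.norm_eq_abs]
    apply intervalIntegral.norm_integral_le_of_norm_le_const
    intro x hx
    have h5 := abs_lt.1 (lt_of_lt_of_le hp1 (min_le_left _ _))
    refine hC x ?_ _ hp3
    rcases le_total r p.1 with h | h
    · rw [uIoc_of_le h] at hx; exact ⟨hr.trans hx.1.le, by linarith [hx.2]⟩
    · rw [uIoc_of_ge h] at hx; exact ⟨le_trans hp0 hx.1.le, by linarith [hx.2]⟩
  have h6 : C * |p.1 - r| < ε / 2 := by
    have := lt_of_lt_of_le hp1 (min_le_right _ _)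
    rw [lt_div_iff₀ (by positivity)] at this
    linarith
  rw [hsplit]
  calc _ = |((∫ x in (0:ℝ)..r, g x p.2) - ∫ x in (0:ℝ)..r, g x t) + ∫ x in r..p.1, g x p.2| := by
        congr 1; ring
    _ ≤ _ := abs_add_le _ _
    _ < ε := by linarith

/-- second derivative test at an interior maximum -/
lemma max_second {f f' : ℝ → ℝ} {x f'' : ℝ} (h : IsLocalMax f x)
    (h1 : ∀ᶠ y in 𝓝 x, HasDerivAt f (f' y) y) (h2 : HasDerivAt f' f'' x) :
    f' x = 0 ∧ f'' ≤ 0 := by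
  have hx := h1.self_of_nhds
  have h0 : f' x = 0 := by rw [← hx.deriv]; exact h.deriv_eq_zero
  refine ⟨h0, ?_⟩
  by_contra hpos
  push Not at hpos
  have hde : deriv f =ᶠ[𝓝 x] f' := h1.mono fun y hy => hy.deriv
  have hdd : deriv (deriv f) x = f'' := by rw [hde.deriv_eq]; exact h2.deriv
  have hmin := isLocalMin_of_deriv_deriv_pos (by rw [hdd]; exact hpos) (by rw [hx.deriv, h0])
    hx.continuousAt
  have hconst : f =ᶠ[𝓝 x] fun _ => f x := by
    filter_upwards [h, hmin] with y hy hy'; exact le_antisymm hy hy'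
  have : deriv f =ᶠ[𝓝 x] deriv (fun _ => f x) := hconst.deriv
  have h4 : deriv f =ᶠ[𝓝 x] fun _ => 0 := by simpa using this
  have h5 := h4.deriv_eq
  rw [hdd] at h5; simp at h5; linarith

/-- derivative at a right end maximum -/
lemma max_left {f : ℝ → ℝ} {a t f' : ℝ} (ha : a < t) (h : ∀ s ∈ Icc a t, f s ≤ f t)
    (hd : HasDerivAt f f' t) : 0 ≤ f' := by
  by_contra hneg
  push Not at hneg
  have := hd.hasDerivWithinAt (s := Iio t)
  have h2 := (hasDerivWithinAt_iff_tendsto_slope' (by simp)).1 this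
  have h3 := h2.eventually (gt_mem_nhds hneg)
  have h4 : ∀ᶠ s in 𝓝[<] t, s ∈ Ioo a t := Ioo_mem_nhdsLT ha
  obtain ⟨s, hs1, hs2⟩ := (h3.and h4).exists
  rw [slope_def_field] at hs1
  have := h s ⟨hs2.1.le, hs2.2.le⟩
  have h5 : 0 ≤ (f s - f t) / (s - t) := div_nonneg_of_nonpos (by linarith) (by linarith [hs2.2])
  linarith

/-- space derivative -/
noncomputable def Dr (f : ℝ → ℝ → ℝ) : ℝ → ℝ → ℝ := fun r t => deriv (fun ρ => f ρ t) r
/-- time derivative -/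
noncomputable def Dt (f : ℝ → ℝ → ℝ) : ℝ → ℝ → ℝ := fun r t => deriv (fun τ => f r τ) t

/-- smoothness in the open region -/
def Sm (T : ℝ) (f : ℝ → ℝ → ℝ) : Prop :=
  ContDiffOn ℝ (⊤ : ℕ∞) (fun p : ℝ × ℝ => f p.1 p.2) (Ioi 0 ×ˢ Ioo 0 T)

lemma isOpen_Om (T : ℝ) : IsOpen (Ioi (0:ℝ) ×ˢ Ioo 0 T) := isOpen_Ioi.prod isOpen_Ioo

section
variable {T : ℝ} {f g : ℝ → ℝ → ℝ}

lemma Sm.hasF (hf : Sm T f) {r t : ℝ} (hr : 0 < r) (ht : t ∈ Ioo 0 T) :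
    HasFDerivAt (fun p : ℝ × ℝ => f p.1 p.2) (fderiv ℝ (fun p : ℝ × ℝ => f p.1 p.2) (r, t)) (r, t) := by
  have h := hf.contDiffAt ((isOpen_Om T).mem_nhds (show (r, t) ∈ _ from ⟨hr, ht⟩))
  exact (h.differentiableAt (by simp)).hasFDerivAt

lemma hasF_r {F : ℝ × ℝ → ℝ} {L : ℝ × ℝ →L[ℝ] ℝ} {r t : ℝ} (h : HasFDerivAt F L (r, t)) :
    HasDerivAt (fun ρ => F (ρ, t)) (L (1, 0)) r := by
  have h1 : HasDerivAt (fun ρ : ℝ => (ρ, t)) ((1:ℝ), (0:ℝ)) r :=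
    (hasDerivAt_id r).prodMk (hasDerivAt_const r t)
  exact h.comp_hasDerivAt r h1

lemma hasF_t {F : ℝ × ℝ → ℝ} {L : ℝ × ℝ →L[ℝ] ℝ} {r t : ℝ} (h : HasFDerivAt F L (r, t)) :
    HasDerivAt (fun τ => F (r, τ)) (L (0, 1)) t := by
  have h1 : HasDerivAt (fun τ : ℝ => (r, τ)) ((0:ℝ), (1:ℝ)) t :=
    (hasDerivAt_const t r).prodMk (hasDerivAt_id t)
  exact h.comp_hasDerivAt t h1

lemma Sm.Dr_eq (hf : Sm T f) {r t : ℝ} (hr : 0 < r) (ht : t ∈ Ioo 0 T) :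
    Dr f r t = fderiv ℝ (fun p : ℝ × ℝ => f p.1 p.2) (r, t) (1, 0) :=
  (hasF_r (hf.hasF hr ht)).deriv

lemma Sm.Dt_eq (hf : Sm T f) {r t : ℝ} (hr : 0 < r) (ht : t ∈ Ioo 0 T) :
    Dt f r t = fderiv ℝ (fun p : ℝ × ℝ => f p.1 p.2) (r, t) (0, 1) :=
  (hasF_t (hf.hasF hr ht)).deriv

lemma Sm.hasDr (hf : Sm T f) {r t : ℝ} (hr : 0 < r) (ht : t ∈ Ioo 0 T) :
    HasDerivAt (fun ρ => f ρ t) (Dr f r t) r := by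
  rw [hf.Dr_eq hr ht]; exact hasF_r (hf.hasF hr ht)

lemma Sm.hasDt (hf : Sm T f) {r t : ℝ} (hr : 0 < r) (ht : t ∈ Ioo 0 T) :
    HasDerivAt (fun τ => f r τ) (Dt f r t) t := by
  rw [hf.Dt_eq hr ht]; exact hasF_t (hf.hasF hr ht)

lemma Sm.fd (hf : Sm T f) : ContDiffOn ℝ (⊤ : ℕ∞) (fderiv ℝ (fun p : ℝ × ℝ => f p.1 p.2))
    (Ioi 0 ×ˢ Ioo 0 T) :=
  ContDiffOn.fderiv_of_isOpen hf (isOpen_Om T) (by simp)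

lemma Sm.Dr (hf : Sm T f) : Sm T (Dr f) :=
  (hf.fd.clm_apply (contDiffOn_const (c := ((1:ℝ), (0:ℝ))))).congr fun _ hp => hf.Dr_eq hp.1 hp.2

lemma Sm.Dt (hf : Sm T f) : Sm T (Dt f) :=
  (hf.fd.clm_apply (contDiffOn_const (c := ((0:ℝ), (1:ℝ))))).congr fun _ hp => hf.Dt_eq hp.1 hp.2

lemma Sm.cont (hf : Sm T f) : ContinuousOn (fun p : ℝ × ℝ => f p.1 p.2) (Ioi 0 ×ˢ Ioo 0 T) :=
  ContDiffOn.continuousOn hf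

lemma Sm.comm (hf : Sm T f) {r t : ℝ} (hr : 0 < r) (ht : t ∈ Ioo 0 T) :
    _root_.Dt (_root_.Dr f) r t = _root_.Dr (_root_.Dt f) r t := by
  set F := fun p : ℝ × ℝ => f p.1 p.2
  have hp : (r, t) ∈ Ioi (0:ℝ) ×ˢ Ioo 0 T := ⟨hr, ht⟩
  have h2 : HasFDerivAt (fderiv ℝ F) (fderiv ℝ (fderiv ℝ F) (r, t)) (r, t) :=
    ((hf.fd.contDiffAt ((isOpen_Om T).mem_nhds hp)).differentiableAt (by simp)).hasFDerivAt
  have hsymm : IsSymmSndFDerivAt ℝ F (r, t) :=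
    (ContDiffOn.contDiffAt hf ((isOpen_Om T).mem_nhds hp)).isSymmSndFDerivAt (by
      rw [minSmoothness_of_isRCLikeNormedField]; exact WithTop.coe_le_coe.2 (le_top (a := (2:ℕ∞))))
  have e1 : HasFDerivAt (fun p => fderiv ℝ F p (1, 0))
      ((ContinuousLinearMap.apply ℝ ℝ ((1:ℝ), (0:ℝ))).comp (fderiv ℝ (fderiv ℝ F) (r, t))) (r, t) :=
    (ContinuousLinearMap.apply ℝ ℝ ((1:ℝ), (0:ℝ))).hasFDerivAt.comp (r, t) h2
  have e2 : HasFDerivAt (fun p => fderiv ℝ F p (0, 1))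
      ((ContinuousLinearMap.apply ℝ ℝ ((0:ℝ), (1:ℝ))).comp (fderiv ℝ (fderiv ℝ F) (r, t))) (r, t) :=
    (ContinuousLinearMap.apply ℝ ℝ ((0:ℝ), (1:ℝ))).hasFDerivAt.comp (r, t) h2
  have a1 : _root_.Dt (_root_.Dr f) r t = fderiv ℝ (fderiv ℝ F) (r, t) (0, 1) (1, 0) := by
    have : HasDerivAt (fun τ => _root_.Dr f r τ) _ t := (hasF_t e1).congr_of_eventuallyEq (by
      filter_upwards [Ioo_mem_nhds ht.1 ht.2] with τ hτ; exact hf.Dr_eq hr hτ)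
    exact this.deriv
  have a2 : _root_.Dr (_root_.Dt f) r t = fderiv ℝ (fderiv ℝ F) (r, t) (1, 0) (0, 1) := by
    have : HasDerivAt (fun ρ => _root_.Dt f ρ t) _ r := (hasF_r e2).congr_of_eventuallyEq (by
      filter_upwards [Ioi_mem_nhds hr] with ρ hρ; exact hf.Dt_eq hρ ht)
    exact this.deriv
  rw [a1, a2]; exact hsymm _ _

end

/-- A solution on a time interval, in a form convenient for us. -/
structure Sol (n : ℕ) (m a e : ℝ) (u wr ut : ℝ → ℝ → ℝ) : Prop where
  hn : 1 ≤ n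
  hm0 : 0 < m
  hm1 : m < 1
  upos : ∀ r, 0 ≤ r → ∀ t ∈ Ioo a e, 0 < u r t
  uc : ContinuousOn (fun p : ℝ × ℝ => u p.1 p.2) (Ici 0 ×ˢ Ioo a e)
  wrc : ContinuousOn (fun p : ℝ × ℝ => wr p.1 p.2) (Ici 0 ×ˢ Ioo a e)
  utc : ContinuousOn (fun p : ℝ × ℝ => ut p.1 p.2) (Ici 0 ×ˢ Ioo a e)
  dw : ∀ r, 0 < r → ∀ t ∈ Ioo a e, HasDerivAt (fun ρ => u ρ t ^ m) (wr r t) r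
  du : ∀ r, 0 ≤ r → ∀ t ∈ Ioo a e, HasDerivAt (fun τ => u r τ) (ut r t) t
  dF : ∀ r, 0 < r → ∀ t ∈ Ioo a e, HasDerivAt (fun ρ => Sf n ρ * wr ρ t) (Sf n r * ut r t) r
  dec : ∃ C > 0, ∀ r, 1 ≤ r → ∀ t ∈ Ioo a e, u r t ^ m ≤ C * Sf n r ^ (-(1/2):ℝ)

lemma dec_of_energy {n : ℕ} (v : ℝ → ℝ)
    (v' : ℝ → ℝ) (hv : ∀ r > 0, HasDerivAt v (v' r) r) (hv' : ContinuousOn v' (Ioi 0))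
    (hpos : ∀ r > 0, 0 ≤ v r)
    (h1 : IntegrableOn (fun s => v s ^ 2 * Sf n s) (Ioi 0))
    (h2 : IntegrableOn (fun s => v' s ^ 2 * Sf n s) (Ioi 0)) (C : ℝ) (hC : 0 ≤ C)
    (hE : (∫ s in Ioi (0:ℝ), v s ^ 2 * Sf n s) + (∫ s in Ioi (0:ℝ), v' s ^ 2 * Sf n s) ≤ C)
    (r : ℝ) (hr : 1 ≤ r) : v r ≤ Real.sqrt (2 * C) * Sf n r ^ (-(1/2):ℝ) := by
  have hr0 : 0 < r := by linarith
  have hsub : Icc r (r+1) ⊆ Ioi 0 := fun x hx => hr0.trans_le hx.1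
  have hvc : ContinuousOn v (Icc r (r+1)) := fun x hx => (hv x (hsub hx)).continuousAt.continuousWithinAt
  have hvc' := hv'.mono hsub
  obtain ⟨R, hR, hmin⟩ := isCompact_Icc.exists_isMinOn (nonempty_Icc.2 (by linarith : r ≤ r + 1)) (hvc.pow 2)
  have huI : uIcc r (r+1) = Icc r (r+1) := uIcc_of_le (by linarith)
  have ii1 : IntervalIntegrable (fun s => v s ^ 2) volume r (r+1) := by
    apply ContinuousOn.intervalIntegrable; rw [huI]; exact hvc.pow 2
  have ii2 : IntervalIntegrable (fun s => v' s ^ 2) volume r (r+1) := by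
    apply ContinuousOn.intervalIntegrable; rw [huI]; exact hvc'.pow 2
  have key : ∀ g : ℝ → ℝ, ContinuousOn g (Icc r (r+1)) → IntegrableOn (fun s => g s ^ 2 * Sf n s) (Ioi 0) →
      Sf n r * ∫ s in r..(r+1), g s ^ 2 ≤ ∫ s in Ioi (0:ℝ), g s ^ 2 * Sf n s := by
    intro g hgc hg
    have e1 : ∫ s in r..(r+1), g s ^ 2 * Sf n s ≤ ∫ s in Ioi (0:ℝ), g s ^ 2 * Sf n s := by
      rw [intervalIntegral.integral_of_le (by linarith)]
      refine setIntegral_mono_set hg ?_ (LE.le.eventuallyLE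
        (Ioc_subset_Icc_self.trans hsub))
      filter_upwards [ae_restrict_mem measurableSet_Ioi] with x hx
      exact mul_nonneg (sq_nonneg _) (Sf_nonneg n (le_of_lt hx))
    have e2 : Sf n r * ∫ s in r..(r+1), g s ^ 2 ≤ ∫ s in r..(r+1), g s ^ 2 * Sf n s := by
      rw [← intervalIntegral.integral_const_mul]
      apply intervalIntegral.integral_mono_on (by linarith)
      · apply ContinuousOn.intervalIntegrable; rw [huI]; exact continuousOn_const.mul (hgc.pow 2)
      · apply ContinuousOn.intervalIntegrable; rw [huI]
        exact (hgc.pow 2).mul (Sf_cont n).continuousOn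
      · intro x hx
        rw [mul_comm]; exact mul_le_mul_of_nonneg_left (Sf_mono n hr0.le hx.1) (sq_nonneg _)
    linarith
  have k1 := key v hvc h1
  have k2 := key v' hvc' h2
  have hSpos := Sf_pos n hr0
  have hq1 : v R ^ 2 ≤ ∫ s in r..(r+1), v s ^ 2 := by
    have := intervalIntegral.integral_mono_on (by linarith : r ≤ r+1)
      (intervalIntegrable_const (c := v R ^ 2)) ii1 (fun x hx => hmin hx)
    simpa using this
  have hq2 : v r ^ 2 - v R ^ 2 ≤ ∫ s in r..(r+1), (v s ^ 2 + v' s ^ 2) := by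
    have hss : uIcc r R ⊆ Icc r (r+1) := by rw [uIcc_of_le hR.1]; exact Icc_subset_Icc_right hR.2
    have i0 : IntervalIntegrable (fun s => 2 * v s * v' s) volume r R :=
      ContinuousOn.intervalIntegrable (((continuousOn_const.mul hvc).mul hvc').mono hss)
    have i1 : IntervalIntegrable (fun s => v s ^ 2 + v' s ^ 2) volume r R :=
      ContinuousOn.intervalIntegrable (((hvc.pow 2).add (hvc'.pow 2)).mono hss)
    have := intervalIntegral.integral_eq_sub_of_hasDerivAt (f := fun s => v s ^ 2)
      (f' := fun s => 2 * v s * v' s) (a := r) (b := R)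
      (fun x hx => by simpa using (hv x (hsub (hss hx))).fun_pow 2) i0
    have h3 : ∫ s in r..R, -(2 * v s * v' s) ≤ ∫ s in r..R, (v s ^ 2 + v' s ^ 2) := by
      apply intervalIntegral.integral_mono_on hR.1 i0.neg i1
      intro x _; simp only [Pi.neg_apply]; nlinarith [sq_nonneg (v x + v' x)]
    rw [intervalIntegral.integral_neg, this] at h3
    have h4 : ∫ s in r..R, (v s ^ 2 + v' s ^ 2) ≤ ∫ s in r..(r+1), (v s ^ 2 + v' s ^ 2) := by
      apply intervalIntegral.integral_mono_interval le_rfl hR.1 hR.2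
      · exact Eventually.of_forall fun x => by positivity
      · exact ii1.add ii2
    linarith
  rw [intervalIntegral.integral_add ii1 ii2] at hq2
  have h2nn : 0 ≤ ∫ s in r..(r+1), v' s ^ 2 := intervalIntegral.integral_nonneg (by linarith) fun _ _ => sq_nonneg _
  have hfin : v r ^ 2 * Sf n r ≤ 2 * C := by nlinarith
  have hsq : (Sf n r ^ (-(1/2):ℝ)) ^ 2 = (Sf n r)⁻¹ := by
    rw [← Real.rpow_natCast, ← Real.rpow_mul hSpos.le]; norm_num [Real.rpow_neg_one]
  apply le_of_sq_le_sq _ (by positivity)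
  rw [mul_pow, hsq, Real.sq_sqrt (by positivity), ← div_eq_mul_inv, le_div_iff₀ hSpos]
  exact hfin

section
variable {N : ℕ} {m T : ℝ} {u : ℝ → ℝ → ℝ}

lemma IsRadialEnergySolution.smU (hu : IsRadialEnergySolution N m T u) : Sm T u :=
  hu.smooth.mono (prod_mono Ioi_subset_Ici_self le_rfl)

lemma IsRadialEnergySolution.smW0 (hu : IsRadialEnergySolution N m T u) :
    ContDiffOn ℝ (⊤ : ℕ∞) (fun p : ℝ × ℝ => u p.1 p.2 ^ m) (Ici 0 ×ˢ Ioo 0 T) :=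
  hu.smooth.rpow_const_of_ne fun p hp => (hu.pos p.1 hp.1 p.2 hp.2).ne'

lemma IsRadialEnergySolution.smW (hu : IsRadialEnergySolution N m T u) :
    Sm T (fun r t => u r t ^ m) :=
  hu.smW0.mono (prod_mono Ioi_subset_Ici_self le_rfl)

lemma exists_sol (hN : 2 ≤ N) (hm0 : 0 < m) (hm1 : m < 1) (hu : IsRadialEnergySolution N m T u) :
    ∃ wr ut : ℝ → ℝ → ℝ, (∀ r > 0, ∀ t ∈ Ioo 0 T, wr r t = Dr (fun r t => u r t ^ m) r t) ∧
      (∀ r > 0, ∀ t ∈ Ioo 0 T, ut r t = Dt u r t) ∧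
      ∀ a ∈ Ioo 0 T, Sol (N - 1) m a T u wr ut := by
  set D : Set (ℝ × ℝ) := Ici 0 ×ˢ Ioo 0 T
  have hD : UniqueDiffOn ℝ D := (uniqueDiffOn_Ici 0).prod isOpen_Ioo.uniqueDiffOn
  set W := fun p : ℝ × ℝ => u p.1 p.2 ^ m
  set U := fun p : ℝ × ℝ => u p.1 p.2
  have hW := hu.smW0
  have hU := hu.smooth
  have hnb : ∀ r > 0, ∀ t ∈ Ioo 0 T, D ∈ 𝓝 (r, t) := fun r hr t ht =>
    prod_mem_nhds (Ici_mem_nhds hr) (Ioo_mem_nhds ht.1 ht.2)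
  have hwr : ∀ r > 0, ∀ t ∈ Ioo 0 T, fderivWithin ℝ W D (r, t) (1, 0) = Dr (fun r t => u r t ^ m) r t := by
    intro r hr t ht
    rw [hu.smW.Dr_eq hr ht, fderivWithin_of_mem_nhds (hnb r hr t ht)]
  have hut : ∀ r ≥ 0, ∀ t ∈ Ioo 0 T, HasDerivAt (fun τ => u r τ) (fderivWithin ℝ U D (r, t) (0, 1)) t := by
    intro r hr t ht
    have h1 := ((hU (r, t) ⟨hr, ht⟩).differentiableWithinAt (by simp)).hasFDerivWithinAt
    have h2 : HasDerivWithinAt (fun τ : ℝ => (r, τ)) ((0:ℝ), (1:ℝ)) (Ioo 0 T) t :=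
      ((hasDerivAt_const t r).prodMk (hasDerivAt_id t)).hasDerivWithinAt
    have h3 := h1.comp_hasDerivWithinAt t h2 (fun τ hτ => ⟨hr, hτ⟩)
    exact h3.hasDerivAt (Ioo_mem_nhds ht.1 ht.2)
  refine ⟨fun r t => fderivWithin ℝ W D (r, t) (1, 0), fun r t => fderivWithin ℝ U D (r, t) (0, 1),
    hwr, fun r hr t ht => (hut r hr.le t ht).deriv.symm, ?_⟩
  intro a ha
  have hsub : Ioo a T ⊆ Ioo 0 T := Ioo_subset_Ioo_left ha.1.le
  have hcast : ((N - 1 : ℕ) : ℝ) = (N : ℝ) - 1 := by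
    rw [Nat.cast_sub (by omega)]; simp
  refine ⟨by omega, hm0, hm1, fun r hr t ht => hu.pos r hr t (hsub ht),
    hu.continuousOn.mono (prod_mono le_rfl (hsub.trans Ioo_subset_Icc_self)), ?_, ?_, ?_,
    fun r hr t ht => hut r hr t (hsub ht), ?_, ?_⟩
  · have : ContinuousOn (fderivWithin ℝ W D) D := hW.continuousOn_fderivWithin hD (by simp)
    exact (this.clm_apply continuousOn_const).mono (prod_mono le_rfl hsub)
  · have : ContinuousOn (fderivWithin ℝ U D) D := hU.continuousOn_fderivWithin hD (by simp)
    exact (this.clm_apply continuousOn_const).mono (prod_mono le_rfl hsub)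
  · intro r hr t ht
    simp only [hwr r hr t (hsub ht)]
    exact hu.smW.hasDr hr (hsub ht)
  · intro r hr t ht
    have ht' := hsub ht
    have h1 := hu.smW.Dr.hasDr hr ht'
    have h2 : HasDerivAt (fun ρ => fderivWithin ℝ W D (ρ, t) (1, 0)) (Dr (Dr (fun r t => u r t ^ m)) r t) r :=
      h1.congr_of_eventuallyEq (by
        filter_upwards [Ioi_mem_nhds hr] with ρ hρ; exact hwr ρ hρ t ht')
    refine ((Sf_hasDeriv (N-1) hr).mul h2).congr_deriv ?_
    have hp := hu.pde r hr t ht'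
    rw [(hut r hr.le t ht').deriv] at hp
    have e : deriv (deriv (fun ρ => u ρ t ^ m)) r = Dr (Dr (fun r t => u r t ^ m)) r t := rfl
    have e' : deriv (fun ρ => u ρ t ^ m) r = Dr (fun r t => u r t ^ m) r t := rfl
    rw [hp, hwr r hr t ht', e, e', bf, hcast]; ring
  · obtain ⟨C, hC⟩ := hu.energy_bdd a ha
    refine ⟨Real.sqrt (2 * max C 1), by positivity, fun r hr t ht => ?_⟩
    have ht' := hsub ht
    have hen := hu.energy t ht'
    exact dec_of_energy (fun ρ => u ρ t ^ m) (deriv (fun ρ => u ρ t ^ m))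
      (fun r hr => hu.smW.hasDr hr ht') (slice_r hu.smW.Dr.cont ht')
      (fun r hr => (Real.rpow_pos_of_pos (hu.pos r hr.le t ht') m).le) hen.2.1 hen.2.2 _ (by positivity)
      ((hC t ⟨ht.1.le, ht.2⟩).trans (le_max_left _ _)) r hr
end

section
variable {n : ℕ} {m a' e : ℝ} {u wr ut : ℝ → ℝ → ℝ}

lemma Sol.wc (h : Sol n m a' e u wr ut) :
    ContinuousOn (fun p : ℝ × ℝ => u p.1 p.2 ^ m) (Ici 0 ×ˢ Ioo a' e) :=
  h.uc.rpow_const fun p hp => Or.inl (h.upos p.1 hp.1 p.2 hp.2).ne'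

lemma Sol.wpos (h : Sol n m a' e u wr ut) {r t : ℝ} (hr : 0 ≤ r) (ht : t ∈ Ioo a' e) : 0 < u r t ^ m :=
  Real.rpow_pos_of_pos (h.upos r hr t ht) m

lemma Sol.dwt (h : Sol n m a' e u wr ut) {r t : ℝ} (hr : 0 ≤ r) (ht : t ∈ Ioo a' e) :
    HasDerivAt (fun τ => u r τ ^ m) (m * u r t ^ (m-1) * ut r t) t := by
  refine ((h.du r hr t ht).rpow_const (p := m) (Or.inl (h.upos r hr t ht).ne')).congr_deriv (by ring)

/-- no spatial max where the difference of fluxes increases -/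
lemma Sol.nomax (h : Sol n m a' e u wr ut) {c r0 R t1 t2 : ℝ} (hr0 : 0 ≤ r0) (hR : r0 < R)
    (h1 : t1 ∈ Ioo a' e) (h2 : t2 ∈ Ioo a' e)
    (hmax : ∀ r ∈ Icc 0 R, c * u r t2 ^ m - u r t1 ^ m ≤ c * u r0 t2 ^ m - u r0 t1 ^ m) :
    c * ut r0 t2 - ut r0 t1 ≤ 0 := by
  by_contra hpos
  push Not at hpos
  have hcont : ContinuousOn (fun r => c * ut r t2 - ut r t1) (Ici 0) :=
    (continuousOn_const.mul (slice_r h.utc h2)).sub (slice_r h.utc h1)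
  have hev : ∀ᶠ r in 𝓝[Ici 0] r0, 0 < c * ut r t2 - ut r t1 :=
    (hcont r0 hr0).eventually (lt_mem_nhds hpos)
  obtain ⟨d, hd, hdp⟩ := Metric.mem_nhdsWithin_iff.1 hev
  set d' := min (d/2) (R - r0)
  have hd' : 0 < d' := by have := sub_pos.2 hR; positivity
  have hpr : ∀ r ∈ Icc r0 (r0 + d'), 0 < c * ut r t2 - ut r t1 := by
    intro r hr
    refine hdp ⟨?_, le_trans hr0 hr.1⟩
    rw [Metric.mem_ball, Real.dist_eq, abs_of_nonneg (by linarith [hr.1])]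
    have := min_le_left (d/2) (R - r0); linarith [hr.2]
  set P := fun r => Sf n r * (c * wr r t2 - wr r t1)
  have hPc : ContinuousOn P (Ici 0) := (Sf_cont n).continuousOn.mul
    ((continuousOn_const.mul (slice_r h.wrc h2)).sub (slice_r h.wrc h1))
  have hP0 : P r0 = 0 := by
    rcases hr0.eq_or_lt with h0 | h0
    · simp only [P, ← h0, Sf_zero h.hn, zero_mul]
    · have : IsLocalMax (fun r => c * u r t2 ^ m - u r t1 ^ m) r0 := by
        filter_upwards [Icc_mem_nhds h0 hR] with r hr using hmax r hr
      have h3 := this.hasDerivAt_eq_zero (((h.dw r0 h0 t2 h2).const_mul c).sub (h.dw r0 h0 t1 h1))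
      simp only [P, h3, mul_zero]
  have hPpos : ∀ r ∈ Ioc r0 (r0 + d'), 0 < P r := by
    intro r hr
    rw [← hP0]
    have hmono := strictMonoOn_of_deriv_pos (convex_Icc r0 r) (hPc.mono fun x hx => le_trans hr0 hx.1)
      (fun x hx => by
        rw [interior_Icc] at hx
        have hx0 : 0 < x := lt_of_le_of_lt hr0 hx.1
        have : HasDerivAt P (c * (Sf n x * ut x t2) - Sf n x * ut x t1) x := by
          refine (((h.dF x hx0 t2 h2).const_mul c).sub (h.dF x hx0 t1 h1)).congr_of_eventuallyEq ?_
          exact Eventually.of_forall fun y => by simp only [P, Pi.sub_apply]; ring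
        rw [this.deriv]
        have := mul_pos (Sf_pos n hx0) (hpr x ⟨hx.1.le, hx.2.le.trans hr.2⟩)
        linarith)
    exact hmono (left_mem_Icc.2 hr.1.le) (right_mem_Icc.2 hr.1.le) hr.1
  have hEc : ContinuousOn (fun r => c * u r t2 ^ m - u r t1 ^ m) (Ici 0) :=
    (continuousOn_const.mul (slice_r (g := fun r t => u r t ^ m) h.wc h2)).sub
      (slice_r (g := fun r t => u r t ^ m) h.wc h1)
  have hE := strictMonoOn_of_deriv_pos (f := fun r => c * u r t2 ^ m - u r t1 ^ m)
    (convex_Icc r0 (r0+d'))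
    (hEc.mono fun x hx => le_trans hr0 hx.1)
    (fun x hx => by
      rw [interior_Icc] at hx
      have hx0 : 0 < x := lt_of_le_of_lt hr0 hx.1
      have h3 : HasDerivAt (fun r => c * u r t2 ^ m - u r t1 ^ m) _ x :=
        ((h.dw x hx0 t2 h2).const_mul c).sub (h.dw x hx0 t1 h1)
      rw [h3.deriv]
      exact pos_of_mul_pos_right (hPpos x ⟨hx.1, hx.2.le⟩) (Sf_nonneg n hx0.le))
  have h5 := hE (left_mem_Icc.2 (by linarith)) (right_mem_Icc.2 (by linarith)) (by linarith : r0 < r0 + d')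
  have h6 := hmax (r0+d') ⟨by linarith, by have := min_le_right (d/2) (R - r0); linarith⟩
  simp only at h5
  linarith

lemma Sol.bc (h : Sol n m a' e u wr ut) {a r t1 t2 : ℝ} (ha : a' < a) (hr : 0 ≤ r) (h1 : a < t1) (h12 : t1 ≤ t2)
    (h2 : t2 < e) : (t1 - a) ^ (m/(1-m)) * (t2 - a) ^ (-(m/(1-m))) * u r t2 ^ m ≤ u r t1 ^ m := by
  by_contra hcon
  push Not at hcon
  have hm0 := h.hm0
  have hm1 : 0 < 1 - m := by linarith [h.hm1]
  set α := m/(1-m) with hα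
  have hα0 : 0 < α := div_pos hm0 hm1
  set G : ℝ → ℝ → ℝ → ℝ := fun r s1 s2 => (s1 - a) ^ α * (s2 - a) ^ (-α) * u r s2 ^ m - u r s1 ^ m
  set ε := G r t1 t2
  have hε : 0 < ε := sub_pos.2 hcon
  obtain ⟨C, hC0, hC⟩ := h.dec
  have hGle : ∀ r ≥ 0, ∀ s1 s2, a ≤ s1 → s1 ≤ s2 → a < s2 → s2 < e → G r s1 s2 ≤ u r s2 ^ m - u r s1 ^ m := by
    intro r hr s1 s2 hs1 hs hs2 hse
    have hw := h.wpos (r := r) (t := s2) hr ⟨by linarith, hse⟩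
    have : (s1 - a) ^ α * (s2 - a) ^ (-α) ≤ 1 := by
      rw [Real.rpow_neg (by linarith), ← div_eq_mul_inv, div_le_one (Real.rpow_pos_of_pos (by linarith) _)]
      exact Real.rpow_le_rpow (by linarith) (by linarith) hα0.le
    simp only [G]; nlinarith
  obtain ⟨R, hR1, hR⟩ : ∃ R ≥ 1, ∀ r ≥ R, C * Sf n r ^ (-(1/2):ℝ) < ε := by
    have : Tendsto (fun r => C * Sf n r ^ (-(1/2):ℝ)) atTop (𝓝 (C * 0)) :=
      ((tendsto_rpow_neg_atTop (by norm_num : (0:ℝ) < 1/2)).comp (Sf_tendsto h.hn)).const_mul C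
    rw [mul_zero] at this
    obtain ⟨R, hR⟩ := eventually_atTop.1 ((this.eventually (gt_mem_nhds hε)).and (eventually_ge_atTop 1))
    exact ⟨R, (hR R le_rfl).2, fun r hr => (hR r hr).1⟩
  have hGR : ∀ r ≥ R, ∀ s1 s2, a ≤ s1 → s1 ≤ s2 → a < s2 → s2 < e → G r s1 s2 < ε := by
    intro r hr s1 s2 hs1 hs hs2 hse
    have hr0 : 0 ≤ r := by linarith
    have := hGle r hr0 s1 s2 hs1 hs hs2 hse
    have := hC r (by linarith) s2 ⟨by linarith, hse⟩
    have := h.wpos (r := r) (t := s1) hr0 ⟨by linarith, by linarith⟩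
    linarith [hR r hr]
  have hIcc : Icc a t2 ⊆ Ioo a' e := fun x hx => ⟨ha.trans_le hx.1, hx.2.trans_lt h2⟩
  have huc := (isCompact_Icc (a := (0:ℝ)) (b := R)).prod (isCompact_Icc (a := a) (b := t2)) |>.uniformContinuousOn_of_continuous
    (h.wc.mono (prod_mono Icc_subset_Ici_self hIcc))
  rw [Metric.uniformContinuousOn_iff] at huc
  obtain ⟨η, hη, hun⟩ := huc ε hε
  have hnear : ∀ r ∈ Icc 0 R, ∀ s1 s2, a ≤ s1 → s1 ≤ s2 → a < s2 → s2 ≤ t2 → ε ≤ G r s1 s2 → s1 + η/2 < s2 := by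
    intro r hr s1 s2 hs1 hs hs2 hse hG
    by_contra hcl
    push Not at hcl
    have h3 := hun (r, s2) ⟨hr, hs2.le, hse⟩ (r, s1) ⟨hr, hs1, hs.trans hse⟩ (by
      rw [Prod.dist_eq, dist_self, Real.dist_eq, abs_of_nonneg (by linarith)]
      simp only [sup_lt_iff]; constructor <;> linarith)
    rw [Real.dist_eq] at h3
    have := hGle r hr.1 s1 s2 hs1 hs hs2 (by linarith)
    linarith [le_abs_self (u r s2 ^ m - u r s1 ^ m)]
  set K : Set (ℝ × ℝ × ℝ) := (Icc 0 R ×ˢ (Icc a t2 ×ˢ Icc a t2)) ∩ {p | p.2.1 + η/2 ≤ p.2.2}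
  have hK : IsCompact K := (isCompact_Icc.prod (isCompact_Icc.prod isCompact_Icc)).inter_right
    (isClosed_le (by fun_prop) (by fun_prop))
  have hrR : r < R := by
    by_contra hge; push Not at hge
    exact lt_irrefl _ (hGR r hge t1 t2 h1.le h12 (by linarith) h2)
  have hmem : (r, t1, t2) ∈ K := ⟨⟨⟨hr, hrR.le⟩, ⟨h1.le, h12⟩, ⟨by linarith, le_rfl⟩⟩,
    (hnear r ⟨hr, hrR.le⟩ t1 t2 h1.le h12 (by linarith) le_rfl le_rfl).le⟩
  have hGc : ContinuousOn (fun p : ℝ × ℝ × ℝ => G p.1 p.2.1 p.2.2) K := by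
    have c1 : ContinuousOn (fun p : ℝ × ℝ × ℝ => u p.1 p.2.2 ^ m) K :=
      h.wc.comp (f := fun p : ℝ × ℝ × ℝ => (p.1, p.2.2)) (by fun_prop) fun p hp => ⟨hp.1.1.1, hIcc hp.1.2.2⟩
    have c2 : ContinuousOn (fun p : ℝ × ℝ × ℝ => u p.1 p.2.1 ^ m) K :=
      h.wc.comp (f := fun p : ℝ × ℝ × ℝ => (p.1, p.2.1)) (by fun_prop) fun p hp => ⟨hp.1.1.1, hIcc hp.1.2.1⟩
    have c3 : ContinuousOn (fun p : ℝ × ℝ × ℝ => (p.2.1 - a) ^ α) K :=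
      ContinuousOn.rpow_const (by fun_prop) fun p _ => Or.inr hα0.le
    have c4 : ContinuousOn (fun p : ℝ × ℝ × ℝ => (p.2.2 - a) ^ (-α)) K :=
      ContinuousOn.rpow_const (by fun_prop) fun p hp => Or.inl (by
        have h3 : p.2.1 + η/2 ≤ p.2.2 := hp.2
        have h4 := hp.1.2.1.1
        exact ne_of_gt (by linarith))
    exact ((c3.mul c4).mul c1).sub c2
  obtain ⟨⟨r0, s1, s2⟩, hp, hmax⟩ := hK.exists_isMaxOn ⟨_, hmem⟩ hGc
  obtain ⟨⟨hr0, hs1, hs2⟩, hs12⟩ := hp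
  simp only [mem_ofPred_eq] at hs12 hr0 hs1 hs2
  have hbig : ε ≤ G r0 s1 s2 := hmax hmem
  have hs12' := hnear r0 hr0 s1 s2 hs1.1 (by linarith) (by linarith [hs1.1]) hs2.2 hbig
  have hr0R : r0 < R := by
    by_contra hge; push Not at hge
    exact absurd (hGR r0 hge s1 s2 hs1.1 (by linarith) (by linarith [hs1.1]) (by linarith [hs2.2])) (not_lt.2 hbig)
  have hs1a : a < s1 := by
    rcases hs1.1.eq_or_lt with h0 | h0
    · exfalso
      have : G r0 s1 s2 = - u r0 s1 ^ m := by simp only [G]; rw [← h0, sub_self, Real.zero_rpow hα0.ne']; ring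
      have := h.wpos hr0.1 (hIcc hs1)
      linarith
    · exact h0
  have hm_ : ∀ r ∈ Icc 0 R, ∀ x1 ∈ Icc a t2, ∀ x2 ∈ Icc a t2, x1 + η/2 ≤ x2 → G r x1 x2 ≤ G r0 s1 s2 :=
    fun r hr x1 hx1 x2 hx2 hx => hmax (show (r, x1, x2) ∈ K from ⟨⟨hr, hx1, hx2⟩, hx⟩)
  have hx1 : 0 < s1 - a := by linarith
  have hx2 : 0 < s2 - a := by linarith
  have hu1 := h.upos r0 hr0.1 s1 (hIcc hs1)
  have hu2 := h.upos r0 hr0.1 s2 (hIcc hs2)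
  -- time derivatives
  have d1 : 0 ≤ α * (s1 - a) ^ (α-1) * (s2 - a) ^ (-α) * u r0 s2 ^ m - m * u r0 s1 ^ (m-1) * ut r0 s1 := by
    refine max_left hs1a (f := fun x => G r0 x s2) (fun s hs => ?_) ?_
    · exact hm_ r0 hr0 s ⟨hs.1, hs.2.trans hs1.2⟩ s2 hs2 (by linarith [hs.2])
    · refine (((((hasDerivAt_id s1).sub_const a).rpow_const (p := α) (Or.inl hx1.ne')).mul_const
        ((s2 - a) ^ (-α))).mul_const (u r0 s2 ^ m)).sub (h.dwt hr0.1 (hIcc hs1)) |>.congr_deriv ?_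
      simp
  have d2 : 0 ≤ (s1 - a) ^ α * (-α * (s2 - a) ^ (-α-1) * u r0 s2 ^ m + (s2 - a) ^ (-α) * (m * u r0 s2 ^ (m-1) * ut r0 s2)) := by
    refine max_left hs12' (f := fun x => G r0 s1 x) (fun s hs => ?_) ?_
    · exact hm_ r0 hr0 s1 hs1 s ⟨by linarith [hs.1], hs.2.trans hs2.2⟩ hs.1
    · have e1 := (((((hasDerivAt_id s2).sub_const a).rpow_const (p := -α) (Or.inl hx2.ne')).mul
        (h.dwt hr0.1 (hIcc hs2))).const_mul ((s1-a)^α)).sub_const (u r0 s1 ^ m)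
      refine (e1.congr_of_eventuallyEq (Eventually.of_forall fun x => ?_)).congr_deriv ?_
      · simp [G]; try ring
      · simp; try ring
  have d3 := h.nomax hr0.1 hr0R (hIcc hs1) (hIcc hs2) (c := (s1 - a) ^ α * (s2 - a) ^ (-α))
    (fun r hr => hm_ r hr s1 hs1 s2 hs2 hs12)
  -- algebra
  set X1 := (s1 - a) ^ α
  set X2 := (s2 - a) ^ (-α)
  have hX1 : 0 < X1 := Real.rpow_pos_of_pos hx1 _
  have hX2 : 0 < X2 := Real.rpow_pos_of_pos hx2 _
  have e1 : (s1 - a) ^ (α - 1) = X1 / (s1 - a) := Real.rpow_sub_one hx1.ne' _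
  have e2 : (s2 - a) ^ (-α - 1) = X2 / (s2 - a) := Real.rpow_sub_one hx2.ne' _
  have e3 : u r0 s1 ^ (m-1) = u r0 s1 ^ m / u r0 s1 := Real.rpow_sub_one hu1.ne' _
  have e4 : u r0 s2 ^ (m-1) = u r0 s2 ^ m / u r0 s2 := Real.rpow_sub_one hu2.ne' _
  rw [e1, e3] at d1
  rw [e2, e4] at d2
  have hGlt : u r0 s1 ^ m < X1 * X2 * u r0 s2 ^ m := by
    have : 0 < G r0 s1 s2 := by linarith
    exact sub_pos.1 this
  have hw1 : 0 < u r0 s1 ^ m := Real.rpow_pos_of_pos hu1 m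
  have hw2 : 0 < u r0 s2 ^ m := Real.rpow_pos_of_pos hu2 m
  set w1 := u r0 s1 ^ m
  set w2 := u r0 s2 ^ m
  set v1 := u r0 s1
  set v2 := u r0 s2
  have hX : X1 * X2 = ((s1 - a)/(s2 - a)) ^ α := by
    rw [Real.div_rpow hx1.le hx2.le, div_eq_mul_inv, ← Real.rpow_neg hx2.le]
  have hpow : v1 / w1 < (s1 - a)/(s2 - a) * (v2 / w2) := by
    have := Real.rpow_lt_rpow hw1.le hGlt (div_pos hm1 hm0)
    rw [hX, Real.mul_rpow (by positivity) hw2.le, ← Real.rpow_mul (x := (s1-a)/(s2-a)) (by positivity)] at this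
    rw [show α * ((1-m)/m) = 1 by rw [hα]; field_simp, Real.rpow_one] at this
    have f : ∀ v : ℝ, 0 < v → (v ^ m) ^ ((1-m)/m) = v / v ^ m := by
      intro v hv
      rw [← Real.rpow_mul hv.le, show m * ((1-m)/m) = 1 - m by field_simp, Real.rpow_sub hv, Real.rpow_one]
    rwa [f _ hu1, f _ hu2] at this
  -- u1t ≤
  have g1 : m * ut r0 s1 ≤ α * X1 * X2 * w2 / (s1 - a) * (v1 / w1) := by
    have : α * X1 * X2 * w2 / (s1 - a) * (v1 / w1) - m * ut r0 s1 = 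
      (α * (X1 / (s1 - a)) * X2 * w2 - m * (w1 / v1) * ut r0 s1) * (v1 / w1) := by field_simp
    have := mul_nonneg d1 (div_pos hu1 hw1).le
    linarith
  have g2 : α * X1 * X2 * w2 / (s1 - a) * (v1 / w1) < α * X1 * X2 * w2 / (s1 - a) * ((s1 - a)/(s2 - a) * (v2 / w2)) :=
    mul_lt_mul_of_pos_left hpow (by positivity)
  have g3 : α * X1 * X2 * w2 / (s1 - a) * ((s1 - a)/(s2 - a) * (v2 / w2)) ≤ X1 * X2 * (m * ut r0 s2) := by
    have h5 := mul_nonneg d2 (div_pos hu2 hw2).le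
    have : X1 * X2 * (m * ut r0 s2) - α * X1 * X2 * w2 / (s1 - a) * ((s1 - a)/(s2 - a) * (v2 / w2)) =
      X1 * (-α * (X2 / (s2 - a)) * w2 + X2 * (m * (w2 / v2) * ut r0 s2)) * (v2 / w2) := by field_simp; ring
    linarith
  have : 0 < m * (X1 * X2 * ut r0 s2 - ut r0 s1) := by linarith
  exact absurd (pos_of_mul_pos_right this hm0.le) (not_lt.2 d3)

/-- Benilan-Crandall -/
lemma Sol.BC (h : Sol n m a' e u wr ut) {b : ℝ} (hb : a' < b) (hbe : b < e) : ∃ CB > 0, ∃ K > 0,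
    (∀ r ≥ 0, ∀ t ∈ Ico b e, ut r t ≤ CB * u r t) ∧
    (∀ r ≥ 0, ∀ s t, b ≤ s → s ≤ t → t < e → u r t ^ m ≤ K * u r s ^ m) := by
  set a := (a' + b)/2
  have ha : a' < a := by simp only [a]; linarith
  have hab : a < b := by simp only [a]; linarith
  have hm0 := h.hm0
  have hm1 : 0 < 1 - m := by linarith [h.hm1]
  set α := m/(1-m) with hα
  have hα0 : 0 < α := div_pos hm0 hm1
  refine ⟨α / m / (b - a), by have := sub_pos.2 hab; positivity, (b-a)^(-α) * (e - a)^α,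
    by have := sub_pos.2 hab; have := sub_pos.2 (hab.trans hbe); positivity, ?_, ?_⟩
  · intro r hr t ht
    have htI : t ∈ Ioo a' e := ⟨by linarith [ht.1], ht.2⟩
    have hta : 0 < t - a := by linarith [ht.1]
    have key : 0 ≤ α * (t - a) ^ (α-1) * (t - a) ^ (-α) * u r t ^ m - m * u r t ^ (m-1) * ut r t := by
      refine max_left (a := (a + t)/2) (t := t) (by linarith) (f := fun x => (x-a)^α * (t-a)^(-α) * u r t ^ m - u r x ^ m) (fun s hs => ?_) ?_
      · have := h.bc ha hr (t1 := s) (t2 := t) (by linarith [hs.1]) hs.2 ht.2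
        have e0 : (t - a)^α * (t-a)^(-α) = 1 := by rw [← Real.rpow_add hta]; simp
        simp only [e0]
        linarith
      · refine (((((hasDerivAt_id t).sub_const a).rpow_const (p := α) (Or.inl hta.ne')).mul_const
          ((t - a) ^ (-α))).mul_const (u r t ^ m)).sub (h.dwt hr htI) |>.congr_deriv ?_
        simp
    have hu := h.upos r hr t htI
    have hw := h.wpos hr htI
    rw [Real.rpow_sub_one hu.ne', Real.rpow_sub_one hta.ne', Real.rpow_neg hta.le] at key
    have hX : 0 < (t-a)^α := Real.rpow_pos_of_pos hta _
    have k2 : α * ((t - a) ^ α / (t - a)) * ((t - a) ^ α)⁻¹ * u r t ^ m - m * (u r t ^ m / u r t) * ut r t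
      = (u r t ^ m / u r t * m) * (α / m / (t-a) * u r t - ut r t) := by field_simp
    rw [k2] at key
    have k3 := nonneg_of_mul_nonneg_right key (by positivity)
    have k4 : α / m / (t-a) ≤ α / m / (b - a) :=
      div_le_div_of_nonneg_left (by positivity) (by linarith) (by linarith [ht.1])
    nlinarith
  · intro r hr s t hs hst ht
    have h1 := h.bc ha hr (t1 := s) (t2 := t) (by linarith) hst ht
    have hX : 0 < (t-a)^α := Real.rpow_pos_of_pos (by linarith) _
    have hY : 0 < (s-a)^α := Real.rpow_pos_of_pos (by linarith) _
    have hu := h.wpos hr (t := s) ⟨by linarith, by linarith⟩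
    rw [Real.rpow_neg (by linarith)] at h1
    have h2 : u r t ^ m ≤ ((s-a)^α)⁻¹ * (t-a)^α * u r s ^ m := by
      calc u r t ^ m = ((s-a)^α)⁻¹ * (t-a)^α * ((s - a) ^ α * ((t - a) ^ α)⁻¹ * u r t ^ m) := by field_simp
        _ ≤ _ := mul_le_mul_of_nonneg_left h1 (by positivity)
    refine h2.trans (mul_le_mul_of_nonneg_right ?_ hu.le)
    rw [Real.rpow_neg (by linarith)]
    have hB : 0 < (b-a)^α := Real.rpow_pos_of_pos (by linarith) _
    apply mul_le_mul _ _ hX.le (by positivity)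
    · exact inv_anti₀ hB (Real.rpow_le_rpow (by linarith) (by linarith) hα0.le)
    · exact Real.rpow_le_rpow (by linarith) (by linarith) hα0.le
end

structure Ctx (n : ℕ) (m a b T CB K : ℝ) (u wr ut : ℝ → ℝ → ℝ) : Prop where
  sol : Sol n m a T u wr ut
  hab : a < b
  hbT : b < T
  hCB : 0 < CB
  hK : 0 < K
  hms : (n:ℝ) - 1 < m * (n + 3)
  ucT : ContinuousOn (fun p : ℝ × ℝ => u p.1 p.2) (Ici 0 ×ˢ Icc b T)
  uT : ∀ r ≥ 0, u r T = 0
  bc1 : ∀ r ≥ 0, ∀ t ∈ Ico b T, ut r t ≤ CB * u r t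
  bc2 : ∀ r ≥ 0, ∀ s t, b ≤ s → s ≤ t → t < T → u r t ^ m ≤ K * u r s ^ m

/-- mass function -/
noncomputable def Mf (n : ℕ) (u : ℝ → ℝ → ℝ) (r t : ℝ) : ℝ := ∫ x in (0:ℝ)..r, u x t * Sf n x

lemma Ioo_nb {a e : ℝ} : ∀ t ∈ Ioo a e, ∃ K, IsCompact K ∧ K ⊆ Ioo a e ∧ K ∈ 𝓝[Ioo a e] t := by
  intro t ht
  obtain ⟨x, hx1, hx2⟩ := exists_between ht.1
  obtain ⟨y, hy1, hy2⟩ := exists_between ht.2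
  exact ⟨Icc x y, isCompact_Icc, fun z hz => ⟨hx1.trans_le hz.1, hz.2.trans_lt hy2⟩,
    mem_nhdsWithin_of_mem_nhds (Icc_mem_nhds hx2 hy1)⟩

lemma ftc {f f' : ℝ → ℝ} {a b : ℝ} (hab : a ≤ b) (hc : ContinuousOn f (Icc a b))
    (hd : ∀ x ∈ Ioo a b, HasDerivAt f (f' x) x) (hc' : ContinuousOn f' (Icc a b)) :
    ∫ x in a..b, f' x = f b - f a :=
  intervalIntegral.integral_eq_sub_of_hasDerivAt_of_le hab hc hd
    (ContinuousOn.intervalIntegrable (by rwa [uIcc_of_le hab]))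

section
variable {n : ℕ} {m a b T CB K : ℝ} {u wr ut : ℝ → ℝ → ℝ}

lemma Sol.uSc (h : Sol n m a T u wr ut) :
    ContinuousOn (fun p : ℝ × ℝ => u p.1 p.2 * Sf n p.1) (Ici 0 ×ˢ Ioo a T) :=
  h.uc.mul (((Sf_cont n).comp continuous_fst).continuousOn)

lemma Sol.uSc' (h : Sol n m a T u wr ut) {t : ℝ} (ht : t ∈ Ioo a T) :
    ContinuousOn (fun r => u r t * Sf n r) (Ici 0) :=
  slice_r (g := fun r t => u r t * Sf n r) h.uSc ht

lemma Sol.uSi (h : Sol n m a T u wr ut) {t x y : ℝ} (ht : t ∈ Ioo a T) (hx : 0 ≤ x) (hy : 0 ≤ y) :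
    IntervalIntegrable (fun r => u r t * Sf n r) volume x y :=
  ContinuousOn.intervalIntegrable ((h.uSc' ht).mono fun _ hz => le_trans (le_min hx hy) hz.1)

lemma Sol.Mc (h : Sol n m a T u wr ut) :
    ContinuousOn (fun p : ℝ × ℝ => Mf n u p.1 p.2) (Ici 0 ×ˢ Ioo a T) :=
  cprim (g := fun r t => u r t * Sf n r) Ioo_nb h.uSc

lemma Sol.Mdr (h : Sol n m a T u wr ut) {r t : ℝ} (hr : 0 < r) (ht : t ∈ Ioo a T) :
    HasDerivAt (fun r => Mf n u r t) (u r t * Sf n r) r := by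
  have hc := (h.uSc' ht).continuousAt (Ici_mem_nhds hr)
  refine intervalIntegral.integral_hasDerivAt_right (h.uSi ht le_rfl hr.le) ?_ hc
  exact ((h.uSc' ht).mono Ioi_subset_Ici_self).stronglyMeasurableAtFilter isOpen_Ioi r hr

lemma Sol.flux (h : Sol n m a T u wr ut) {r t : ℝ} (hr : 0 ≤ r) (ht : t ∈ Ioo a T) :
    ∫ x in (0:ℝ)..r, Sf n x * ut x t = Sf n r * wr r t := by
  have := ftc hr (f := fun x => Sf n x * wr x t) (f' := fun x => Sf n x * ut x t)
    ((Sf_cont n).continuousOn.mul ((slice_r h.wrc ht).mono Icc_subset_Ici_self))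
    (fun x hx => h.dF x hx.1 t ht)
    ((Sf_cont n).continuousOn.mul ((slice_r h.utc ht).mono Icc_subset_Ici_self))
  rw [this, Sf_zero h.hn]; ring

lemma Sol.Mdt (h : Sol n m a T u wr ut) {r t : ℝ} (hr : 0 ≤ r) (ht : t ∈ Ioo a T) :
    HasDerivAt (fun t => Mf n u r t) (Sf n r * wr r t) t := by
  rw [← h.flux hr ht]
  have hs : Icc 0 r ×ˢ Ioo a T ⊆ Ici 0 ×ˢ Ioo a T := prod_mono Icc_subset_Ici_self le_rfl
  refine dint (g := fun x t => u x t * Sf n x) (gt := fun x t => Sf n x * ut x t) hr (h.uSc.mono hs) ?_ ?_ ht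
  · exact ((((Sf_cont n).comp continuous_fst).continuousOn).mul h.utc).mono hs
  · intro x hx t ht
    exact ((h.du x hx.1.le t ht).mul_const (Sf n x)).congr_deriv (by ring)

lemma Sol.Mnn (h : Sol n m a T u wr ut) {r t : ℝ} (hr : 0 ≤ r) (ht : t ∈ Ioo a T) : 0 ≤ Mf n u r t :=
  intervalIntegral.integral_nonneg hr fun x hx =>
    mul_nonneg (h.upos x hx.1 t ht).le (Sf_nonneg n hx.1)

lemma Sol.Mmono (h : Sol n m a T u wr ut) {r s t : ℝ} (hr : 0 ≤ r) (hs : r ≤ s) (ht : t ∈ Ioo a T) :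
    Mf n u r t ≤ Mf n u s t :=
  mono_of_deriv hs ((slice_r h.Mc ht).mono fun _ hx => hr.trans hx.1)
    (fun _ hx => h.Mdr (lt_of_le_of_lt hr hx.1) ht)
    (fun x hx => mul_nonneg (h.upos x (hr.trans hx.1.le) t ht).le (Sf_nonneg n (hr.trans hx.1.le)))

lemma Sol.Mpos (h : Sol n m a T u wr ut) {r t : ℝ} (hr : 0 < r) (ht : t ∈ Ioo a T) : 0 < Mf n u r t := by
  refine intervalIntegral.intervalIntegral_pos_of_pos_on (h.uSi ht le_rfl hr.le) ?_ hr
  intro x hx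
  exact mul_pos (h.upos x hx.1.le t ht) (Sf_pos n hx.1)

lemma Ctx.sub (h : Ctx n m a b T CB K u wr ut) {t : ℝ} (ht : t ∈ Ioo b T) : t ∈ Ioo a T :=
  ⟨h.hab.trans ht.1, ht.2⟩

lemma Ctx.Fle (h : Ctx n m a b T CB K u wr ut) {r t : ℝ} (hr : 0 ≤ r) (ht : t ∈ Ioo b T) :
    Sf n r * wr r t ≤ CB * Mf n u r t := by
  have ht' := h.sub ht
  rw [← h.sol.flux hr ht', Mf, ← intervalIntegral.integral_const_mul]
  apply intervalIntegral.integral_mono_on hr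
  · exact ContinuousOn.intervalIntegrable ((Sf_cont n).continuousOn.mul ((slice_r h.sol.utc ht').mono
      (by rw [uIcc_of_le hr]; exact Icc_subset_Ici_self)))
  · exact (h.sol.uSi ht' le_rfl hr).const_mul CB
  · intro x hx
    have := h.bc1 x hx.1 t ⟨ht.1.le, ht.2⟩
    nlinarith [Sf_nonneg n hx.1]

/-- increments of the flux -/
lemma Ctx.Fle2 (h : Ctx n m a b T CB K u wr ut) {r s t : ℝ} (hr : 0 < r) (hs : r ≤ s) (ht : t ∈ Ioo b T) :
    Sf n s * wr s t - Sf n r * wr r t ≤ CB * Mf n u s t - CB * Mf n u r t := by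
  have ht' := h.sub ht
  refine le_of_deriv_le (f := fun x => Sf n x * wr x t) (g := fun x => CB * Mf n u x t) hs
    (f' := fun x => Sf n x * ut x t) (g' := fun x => CB * (u x t * Sf n x)) ?_ ?_ ?_ ?_ ?_
  · exact (Sf_cont n).continuousOn.mul ((slice_r h.sol.wrc ht').mono fun _ hx => hr.le.trans hx.1)
  · exact continuousOn_const.mul ((slice_r h.sol.Mc ht').mono fun _ hx => hr.le.trans hx.1)
  · exact fun x hx => h.sol.dF x (hr.trans hx.1) t ht'
  · exact fun x hx => (h.sol.Mdr (hr.trans hx.1) ht').const_mul CB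
  · intro x hx
    have := h.bc1 x (hr.trans hx.1).le t ⟨ht.1.le, ht.2⟩
    nlinarith [Sf_nonneg n (hr.trans hx.1).le]

lemma Ctx.ubd (h : Ctx n m a b T CB K u wr ut) : ∃ C > 0, ∀ t ∈ Ioo b T,
    (∀ r ∈ Icc (0:ℝ) 1, u r t ≤ C) ∧ (∀ r ≥ 1, u r t ^ m ≤ C * Sf n r ^ (-(1/2):ℝ)) ∧
    (∀ r ≥ 1, u r t ≤ C * Sf n r ^ (-(1/(2*m)):ℝ)) := by
  obtain ⟨C1, h1, hC1⟩ := exists_bd (isCompact_Icc (a := (0:ℝ)) (b := 1)) (isCompact_Icc (a := b) (b := T))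
    (h.ucT.mono (prod_mono Icc_subset_Ici_self le_rfl))
  obtain ⟨C2, h2, hC2⟩ := h.sol.dec
  have hm0 := h.sol.hm0
  have h3 : 0 < C2 ^ (1/m) := Real.rpow_pos_of_pos h2 _
  refine ⟨C1 + C2 + C2^(1/m), by positivity, fun t ht => ⟨fun r hr => ?_, fun r hr => ?_, fun r hr => ?_⟩⟩
  · have := hC1 r hr t (Ioo_subset_Icc_self ht)
    linarith [le_abs_self (u r t)]
  · have hS : 0 < Sf n r := Sf_pos n (by linarith)
    refine (hC2 r hr t (h.sub ht)).trans (mul_le_mul_of_nonneg_right (by linarith) (Real.rpow_nonneg hS.le _))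
  · have hS : 0 < Sf n r := Sf_pos n (by linarith)
    have hu := h.sol.upos r (by linarith) t (h.sub ht)
    have h4 := Real.rpow_le_rpow (Real.rpow_nonneg hu.le m) (hC2 r hr t (h.sub ht)) (z := 1/m) (by positivity)
    rw [← Real.rpow_mul hu.le, Real.mul_rpow h2.le (Real.rpow_nonneg hS.le _), ← Real.rpow_mul hS.le,
      show m * (1/m) = 1 by field_simp, Real.rpow_one, show -(1/2) * (1/m) = -(1/(2*m)) by field_simp] at h4
    refine h4.trans (mul_le_mul_of_nonneg_right (by linarith) (Real.rpow_nonneg hS.le _))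

/-- from pointwise decay to the mass -/
lemma Sol.Mle (h : Sol n m a T u wr ut) {C β r t : ℝ} (hC : 0 ≤ C) (hβ : 0 < β) (ht : t ∈ Ioo a T)
    (h0 : ∀ r ∈ Icc (0:ℝ) 1, u r t ≤ C) (h1 : ∀ r ≥ 1, u r t * Sf n r ≤ C * Sf n r ^ β) (hr : 1 ≤ r) :
    Mf n u r t ≤ C * (Vf n 1 + β⁻¹) * Sf n r ^ β := by
  have hsplit : Mf n u r t = (∫ x in (0:ℝ)..1, u x t * Sf n x) + ∫ x in (1:ℝ)..r, u x t * Sf n x :=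
    (intervalIntegral.integral_add_adjacent_intervals (h.uSi ht le_rfl zero_le_one)
      (h.uSi ht zero_le_one (by linarith))).symm
  have e1 : ∫ x in (0:ℝ)..1, u x t * Sf n x ≤ C * Vf n 1 := by
    rw [Vf, ← intervalIntegral.integral_const_mul]
    apply intervalIntegral.integral_mono_on zero_le_one (h.uSi ht le_rfl zero_le_one)
      (((Sf_cont n).intervalIntegrable _ _).const_mul C)
    intro x hx
    exact mul_le_mul_of_nonneg_right (h0 x hx) (Sf_nonneg n hx.1)
  have hsub : uIcc 1 r ⊆ Ioi 0 := by
    rw [uIcc_of_le hr]; intro x hx; exact lt_of_lt_of_le one_pos hx.1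
  have e2 : ∫ x in (1:ℝ)..r, u x t * Sf n x ≤ C * (β⁻¹ * Sf n r ^ β) := by
    refine le_trans ?_ (mul_le_mul_of_nonneg_left (int_Sf_pos h.hn hβ one_pos hr) hC)
    rw [← intervalIntegral.integral_const_mul]
    apply intervalIntegral.integral_mono_on hr (h.uSi ht zero_le_one (by linarith))
    · exact (ContinuousOn.intervalIntegrable ((Sf_rpow_cont n β).mono hsub)).const_mul C
    · intro x hx; exact h1 x hx.1
  have hS1 : 1 ≤ Sf n r ^ β := Real.one_le_rpow (one_le_Sf n hr) hβ.le
  have := mul_nonneg hC (Vf_nonneg n zero_le_one)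
  rw [hsplit]; nlinarith

lemma Ctx.Mbd (h : Ctx n m a b T CB K u wr ut) : ∃ ν : ℝ, 0 < ν ∧ ν < 1/2 ∧ ∃ C > 0, ∀ t ∈ Ioo b T,
    (∀ r ∈ Icc (0:ℝ) 1, Mf n u r t ≤ C * Vf n r) ∧ (∀ r ≥ 1, Mf n u r t ≤ C * Sf n r ^ (1/2 - ν)) := by
  obtain ⟨C, hC, hb⟩ := h.ubd
  have hm0 := h.sol.hm0
  have hm1 := h.sol.hm1
  have hμ : 0 < 1/m - 1 := by rw [sub_pos, lt_div_iff₀ hm0]; linarith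
  set ν := min (1/m-1) (1/2) / 2 with hν
  have hν1 : ν ≤ (1/m-1)/2 := by have := min_le_left (1/m-1) (1/2); linarith
  have hν2 : ν ≤ 1/4 := by have := min_le_right (1/m-1) (1/2); linarith
  have hV := Vf_nonneg n zero_le_one
  have hβ : 0 < 1/2 - ν := by linarith
  refine ⟨ν, by positivity, by linarith, C + C * (Vf n 1 + (1/2 - ν)⁻¹), by positivity, fun t ht => ⟨fun r hr => ?_, fun r hr => ?_⟩⟩
  · have : Mf n u r t ≤ C * Vf n r := by
      rw [Vf, ← intervalIntegral.integral_const_mul]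
      apply intervalIntegral.integral_mono_on hr.1 (h.sol.uSi (h.sub ht) le_rfl hr.1)
        (((Sf_cont n).intervalIntegrable _ _).const_mul C)
      intro x hx
      exact mul_le_mul_of_nonneg_right ((hb t ht).1 x ⟨hx.1, hx.2.trans hr.2⟩) (Sf_nonneg n hx.1)
    have h2 : 0 ≤ C * (Vf n 1 + (1/2 - ν)⁻¹) := by positivity
    nlinarith [Vf_nonneg n hr.1]
  · have h1 := h.sol.Mle hC.le hβ (h.sub ht) (hb t ht).1 (fun r hr => ?_) hr
    · have hS := Real.rpow_nonneg (Sf_nonneg n (by linarith : 0 ≤ r)) (1/2 - ν)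
      nlinarith
    · have hS : 0 < Sf n r := Sf_pos n (by linarith)
      calc u r t * Sf n r ≤ (C * Sf n r ^ (-(1/(2*m)):ℝ)) * Sf n r :=
            mul_le_mul_of_nonneg_right ((hb t ht).2.2 r hr) hS.le
        _ = C * Sf n r ^ (-(1/(2*m)) + 1) := by rw [Real.rpow_add_one hS.ne']; ring
        _ ≤ C * Sf n r ^ (1/2 - ν) := by
            refine mul_le_mul_of_nonneg_left (Real.rpow_le_rpow_of_exponent_le (one_le_Sf n hr) ?_) hC.le
            have : 1/(2*m) = (1/m)/2 := by field_simp
            linarith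
end

/-- abstract Berryman-Holland argument -/
lemma ode_main {m T b c CB Y0 : ℝ} (hm0 : 0 < m) (hm1 : m < 1) (hbT : b < T) (hc : 0 < c) (hCB : 0 < CB)
    (hY0 : 0 < Y0) {y z d y' : ℕ → ℝ → ℝ} {ε τ : ℕ → ℝ}
    (hε : Tendsto ε atTop (𝓝 0)) (hτ : Tendsto τ atTop (𝓝 0))
    (hz' : ∀ k, ∀ t ∈ Ioo b T, HasDerivAt (z k) (2 * d k t - 2 * y k t) t)
    (hy' : ∀ k, ∀ t ∈ Ioo b T, HasDerivAt (y k) (y' k t) t)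
    (hyd : ∀ k, ∀ t ∈ Ioo b T, y' k t * z k t ≤ (1+m) * (CB * d k t * z k t - (y k t - d k t)^2))
    (hd0 : ∀ k, ∀ t ∈ Ioo b T, 0 ≤ d k t) (hd1 : ∀ k, ∀ t ∈ Ioo b T, d k t ≤ ε k)
    (hyz : ∀ k, ∀ t ∈ Ioo b T, c * z k t ^ ((1+m)/2) ≤ y k t)
    (hyY : ∀ k, ∀ t ∈ Ioo b T, y k t ≤ Y0) (hzY : ∀ k, ∀ t ∈ Ioo b T, z k t ≤ Y0)
    (hzp : ∀ k, ∀ t ∈ Ioo b T, 0 < z k t)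
    (hzm : ∀ j k, j ≤ k → ∀ t ∈ Ioo b T, z j t ≤ z k t)
    (hzt : ∀ j k, ∀ t ∈ Ioo b T, z j t ≤ z k t + τ k)
    (hext : ∀ k, Tendsto (z k) (𝓝[<] T) (𝓝 0)) :
    ∃ b' ∈ Ioo b T, ∃ C > 0, ∃ c' > 0, ∀ t ∈ Ioo b' T, ∃ k0, ∀ k ≥ k0,
      c' * (T - t) ^ (2/(1-m)) ≤ z k t ∧ y k t ≤ C * (T - t) ^ ((1+m)/(1-m)) := by
  have hm1' : 0 < 1 - m := by linarith
  set q := (1+m)/2 with hq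
  have hq0 : 0 < q := by positivity
  set p := (1-m)/2 with hp
  have hp0 : 0 < p := by positivity
  have hpq : p - 1 = -q := by rw [hp, hq]; ring
  obtain ⟨t0, ht0⟩ := exists_between hbT
  -- Q derivative and psi derivative
  have hQd : ∀ k, ∀ t ∈ Ioo b T, HasDerivAt (fun s => y k s * z k s ^ (-q))
      (y' k t * z k t ^ (-q) + y k t * ((2 * d k t - 2 * y k t) * (-q) * z k t ^ (-q-1))) t := fun k t ht =>
    (hy' k t ht).mul ((hz' k t ht).rpow_const (Or.inl (hzp k t ht).ne'))
  have hPd : ∀ k, ∀ t ∈ Ioo b T, HasDerivAt (fun s => z k s ^ p)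
      ((2 * d k t - 2 * y k t) * p * z k t ^ (-q)) t := fun k t ht => by
    rw [← hpq]; exact (hz' k t ht).rpow_const (Or.inl (hzp k t ht).ne')
  have hQle : ∀ k, ∀ t ∈ Ioo b T, y' k t * z k t ^ (-q) + y k t * ((2 * d k t - 2 * y k t) * (-q) * z k t ^ (-q-1))
      ≤ z k t ^ (-q-1) * ((1+m) * (ε k * (CB * Y0 + Y0))) := by
    intro k t ht
    have hz := hzp k t ht
    have e1 : z k t ^ (-q) = z k t ^ (-q-1) * z k t := by rw [← Real.rpow_add_one hz.ne']; ring_nf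
    have hX := Real.rpow_pos_of_pos hz (-q-1)
    rw [e1]
    have h1 : y' k t * (z k t ^ (-q-1) * z k t) + y k t * ((2 * d k t - 2 * y k t) * (-q) * z k t ^ (-q-1))
      = z k t ^ (-q-1) * (y' k t * z k t - (1+m) * y k t * (d k t - y k t)) := by rw [hq]; ring
    rw [h1]
    refine mul_le_mul_of_nonneg_left ?_ hX.le
    have h2 := hyd k t ht
    have hd := hd0 k t ht
    have hy0 : 0 ≤ y k t := le_trans (by positivity) (hyz k t ht)
    have h3 : y' k t * z k t - (1+m) * y k t * (d k t - y k t) ≤ (1+m) * (d k t * (CB * z k t + y k t)) := by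
      nlinarith [sq_nonneg (d k t)]
    refine h3.trans (mul_le_mul_of_nonneg_left ?_ (by linarith))
    apply mul_le_mul (hd1 k t ht) _ (by positivity) (hd.trans (hd1 k t ht))
    have := mul_le_mul_of_nonneg_left (hzY k t ht) hCB.le
    linarith [hyY k t ht]
  set Q1 := Y0 * z 0 t0 ^ (-q) + 1 with hQ1
  have hz00 := Real.rpow_pos_of_pos (hzp 0 t0 ht0) (-q)
  have hQ1p : 0 < Q1 := by positivity
  -- lower bound of z on compact intervals
  have hlow : ∀ t2 ∈ Ioo t0 T, ∃ ζ > 0, ∀ k, ∀ t ∈ Icc t0 t2, ζ ≤ z k t := by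
    intro t2 ht2
    have hsub : Icc t0 t2 ⊆ Ioo b T := fun x hx => ⟨ht0.1.trans_le hx.1, hx.2.trans_lt ht2.2⟩
    have hcont : ContinuousOn (z 0) (Icc t0 t2) := fun x hx => (hz' 0 x (hsub hx)).continuousAt.continuousWithinAt
    obtain ⟨x, hx, hmin⟩ := isCompact_Icc.exists_isMinOn (nonempty_Icc.2 ht2.1.le) hcont
    exact ⟨z 0 x, hzp 0 x (hsub hx), fun k t ht => (hmin ht).trans (hzm 0 k (Nat.zero_le _) t (hsub ht))⟩
  have hQb : ∀ t2 ∈ Ioo t0 T, ∀ᶠ k in atTop, ∀ t ∈ Icc t0 t2, y k t * z k t ^ (-q) ≤ Q1 := by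
    intro t2 ht2
    obtain ⟨ζ, hζ, hlo⟩ := hlow t2 ht2
    have hsub : Icc t0 t2 ⊆ Ioo b T := fun x hx => ⟨ht0.1.trans_le hx.1, hx.2.trans_lt ht2.2⟩
    have hlim : Tendsto (fun k => ζ ^ (-q-1) * ((1+m) * (ε k * (CB * Y0 + Y0))) * (t2 - t0)) atTop (𝓝 0) := by
      have := (((hε.mul_const (CB * Y0 + Y0)).const_mul (1+m)).const_mul (ζ ^ (-q-1))).mul_const (t2 - t0)
      simpa using this
    filter_upwards [hlim.eventually (gt_mem_nhds one_pos)] with k hk t ht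
    have hεk : 0 ≤ ε k := (hd0 k t0 ht0).trans (hd1 k t0 ht0)
    set D := ζ ^ (-q-1) * ((1+m) * (ε k * (CB * Y0 + Y0)))
    have hD : 0 ≤ D := by positivity
    have h1 := le_of_deriv_le (f := fun s => y k s * z k s ^ (-q)) (g := fun s => D * s) (g' := fun _ => D) ht.1
      (fun x hx => (hQd k x (hsub ⟨hx.1, hx.2.trans ht.2⟩)).continuousAt.continuousWithinAt) (by fun_prop)
      (fun x hx => hQd k x (hsub ⟨hx.1.le, hx.2.le.trans ht.2⟩))
      (fun x hx => by simpa using (hasDerivAt_id x).const_mul D)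
      (fun x hx => by
        have hx' : x ∈ Icc t0 t2 := ⟨hx.1.le, hx.2.le.trans ht.2⟩
        refine (hQle k x (hsub hx')).trans (mul_le_mul_of_nonneg_right ?_ (by positivity))
        exact Real.rpow_le_rpow_of_nonpos hζ (hlo k x hx') (by linarith))
    have h2 : D * t - D * t0 ≤ 1 := by nlinarith [ht.2]
    have h3 : y k t0 * z k t0 ^ (-q) ≤ Y0 * z 0 t0 ^ (-q) :=
      mul_le_mul (hyY k t0 ht0) (Real.rpow_le_rpow_of_nonpos (hzp 0 t0 ht0) (hzm 0 k (Nat.zero_le _) t0 ht0) (by linarith))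
        (Real.rpow_nonneg (hzp k t0 ht0).le _) hY0.le
    linarith
  -- limit function
  set zz := fun t => ⨆ k, z k t
  have hbdd : ∀ t ∈ Ioo b T, BddAbove (range fun k => z k t) := fun t ht => ⟨Y0, by rintro _ ⟨k, rfl⟩; exact hzY k t ht⟩
  have hzz : ∀ t ∈ Ioo b T, Tendsto (fun k => z k t) atTop (𝓝 (zz t)) := fun t ht =>
    tendsto_atTop_ciSup (fun j k hjk => hzm j k hjk t ht) (hbdd t ht)
  have hzzle : ∀ k, ∀ t ∈ Ioo b T, zz t ≤ z k t + τ k := fun k t ht => ciSup_le fun j => hzt j k t ht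
  have hlezz : ∀ k, ∀ t ∈ Ioo b T, z k t ≤ zz t := fun k t ht => le_ciSup (hbdd t ht) k
  have hzzp : ∀ t ∈ Ioo b T, 0 < zz t := fun t ht => (hzp 0 t ht).trans_le (hlezz 0 t ht)
  have hIoo : ∀ᶠ t in 𝓝[<] T, t ∈ Ioo b T := Ioo_mem_nhdsLT hbT
  have hzz0 : Tendsto zz (𝓝[<] T) (𝓝 0) := by
    rw [Metric.tendsto_nhds]
    intro e he
    obtain ⟨k, hk⟩ := (hτ.eventually (gt_mem_nhds (half_pos he))).exists
    filter_upwards [(hext k).eventually (gt_mem_nhds (half_pos he)), hIoo] with t ht hI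
    rw [Real.dist_eq, sub_zero, abs_of_pos (hzzp t hI)]
    linarith [hzzle k t hI]
  have hψ0 : Tendsto (fun t => zz t ^ p) (𝓝[<] T) (𝓝 0) := by
    have := hzz0.rpow_const (p := p) (Or.inr hp0.le)
    rwa [Real.zero_rpow hp0.ne'] at this
  have hψlim : ∀ t ∈ Ioo b T, Tendsto (fun k => z k t ^ p) atTop (𝓝 (zz t ^ p)) := fun t ht =>
    (hzz t ht).rpow_const (Or.inr hp0.le)
  -- integrated inequalities
  have hA : ∀ t1 ∈ Ioo t0 T, ∀ t2 ∈ Ioo t1 T, zz t1 ^ p ≤ zz t2 ^ p + (1-m) * Q1 * (t2 - t1) := by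
    intro t1 ht1 t2 ht2
    have ht2' : t2 ∈ Ioo t0 T := ⟨ht1.1.trans ht2.1, ht2.2⟩
    have hsub : Icc t0 t2 ⊆ Ioo b T := fun x hx => ⟨ht0.1.trans_le hx.1, hx.2.trans_lt ht2.2⟩
    have h1 := hsub ⟨ht1.1.le, ht2.1.le⟩
    have h2 := hsub ⟨ht2'.1.le, le_rfl⟩
    refine le_of_tendsto_of_tendsto (hψlim t1 h1) ((hψlim t2 h2).add_const _) ?_
    filter_upwards [hQb t2 ht2'] with k hk
    have := le_of_deriv_le (f := fun s => -((1-m)*Q1) * s) (f' := fun _ => -((1-m)*Q1)) (g := fun s => z k s ^ p) ht2.1.le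
      (by fun_prop) (fun x hx => (hPd k x (hsub ⟨ht1.1.le.trans hx.1, hx.2⟩)).continuousAt.continuousWithinAt)
      (fun x hx => by simpa using (hasDerivAt_id x).const_mul (-((1-m)*Q1)))
      (fun x hx => hPd k x (hsub ⟨ht1.1.le.trans hx.1.le, hx.2.le⟩))
      (fun x hx => by
        have hx' : x ∈ Icc t0 t2 := ⟨ht1.1.le.trans hx.1.le, hx.2.le⟩
        have h3 := hk x hx'
        have h4 := mul_nonneg (hd0 k x (hsub hx')) (Real.rpow_nonneg (hzp k x (hsub hx')).le (-q))
        have : (2 * d k x - 2 * y k x) * p * z k x ^ (-q) = (1-m) * (d k x * z k x ^ (-q) - y k x * z k x ^ (-q)) := by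
          rw [hp]; ring
        rw [this]; nlinarith)
    linarith
  have hB : ∀ t1 ∈ Ioo t0 T, ∀ t2 ∈ Ioo t1 T, (1-m) * (c/2) * (t2 - t1) ≤ zz t1 ^ p := by
    intro t1 ht1 t2 ht2
    have ht2' : t2 ∈ Ioo t0 T := ⟨ht1.1.trans ht2.1, ht2.2⟩
    have hsub : Icc t0 t2 ⊆ Ioo b T := fun x hx => ⟨ht0.1.trans_le hx.1, hx.2.trans_lt ht2.2⟩
    have h1 := hsub ⟨ht1.1.le, ht2.1.le⟩
    have h2 := hsub ⟨ht2'.1.le, le_rfl⟩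
    obtain ⟨ζ, hζ, hlo⟩ := hlow t2 ht2'
    have hlim : Tendsto (fun k => ε k * ζ ^ (-q)) atTop (𝓝 0) := by simpa using hε.mul_const (ζ ^ (-q))
    refine ge_of_tendsto (hψlim t1 h1) ?_
    filter_upwards [hlim.eventually (gt_mem_nhds (half_pos hc))] with k hk
    have := le_of_deriv_le (g := fun s => -((1-m)*(c/2)) * s) (g' := fun _ => -((1-m)*(c/2))) (f := fun s => z k s ^ p) ht2.1.le
      (fun x hx => (hPd k x (hsub ⟨ht1.1.le.trans hx.1, hx.2⟩)).continuousAt.continuousWithinAt) (by fun_prop)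
      (fun x hx => hPd k x (hsub ⟨ht1.1.le.trans hx.1.le, hx.2.le⟩))
      (fun x hx => by simpa using (hasDerivAt_id x).const_mul (-((1-m)*(c/2))))
      (fun x hx => by
        have hx' : x ∈ Icc t0 t2 := ⟨ht1.1.le.trans hx.1.le, hx.2.le⟩
        have hzx := hzp k x (hsub hx')
        have hZ := Real.rpow_pos_of_pos hzx (-q)
        have h3 : d k x * z k x ^ (-q) ≤ ε k * ζ ^ (-q) :=
          mul_le_mul (hd1 k x (hsub hx')) (Real.rpow_le_rpow_of_nonpos hζ (hlo k x hx') (by linarith)) hZ.le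
            ((hd0 k x (hsub hx')).trans (hd1 k x (hsub hx')))
        have h4 : c ≤ y k x * z k x ^ (-q) := by
          have := mul_le_mul_of_nonneg_right (hyz k x (hsub hx')) hZ.le
          rwa [mul_assoc, ← Real.rpow_add hzx, add_neg_cancel, Real.rpow_zero, mul_one] at this
        have : (2 * d k x - 2 * y k x) * p * z k x ^ (-q) = (1-m) * (d k x * z k x ^ (-q) - y k x * z k x ^ (-q)) := by
          rw [hp]; ring
        rw [this]; nlinarith)
    have h5 := Real.rpow_nonneg (hzp k t2 h2).le p
    linarith
  have hup : ∀ t1 ∈ Ioo t0 T, zz t1 ^ p ≤ (1-m) * Q1 * (T - t1) := by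
    intro t1 ht1
    have hl : Tendsto (fun t2 => zz t2 ^ p + (1-m) * Q1 * (t2 - t1)) (𝓝[<] T) (𝓝 (0 + (1-m) * Q1 * (T - t1))) :=
      hψ0.add ((tendsto_nhdsWithin_of_tendsto_nhds (by
        have : Continuous fun t2 : ℝ => (1-m) * Q1 * (t2 - t1) := by fun_prop
        exact this.tendsto T)))
    rw [zero_add] at hl
    refine ge_of_tendsto hl ?_
    filter_upwards [Ioo_mem_nhdsLT ht1.2] with t2 ht2 using hA t1 ht1 t2 ht2
  have hdn : ∀ t1 ∈ Ioo t0 T, (1-m) * (c/2) * (T - t1) ≤ zz t1 ^ p := by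
    intro t1 ht1
    have hl : Tendsto (fun t2 => (1-m) * (c/2) * (t2 - t1)) (𝓝[<] T) (𝓝 ((1-m) * (c/2) * (T - t1))) :=
      (tendsto_nhdsWithin_of_tendsto_nhds (by
        have : Continuous fun t2 : ℝ => (1-m) * (c/2) * (t2 - t1) := by fun_prop
        exact this.tendsto T))
    refine le_of_tendsto hl ?_
    filter_upwards [Ioo_mem_nhdsLT ht1.2] with t2 ht2 using hB t1 ht1 t2 ht2
  have hpp : ∀ x : ℝ, 0 ≤ x → (x ^ p) ^ (2/(1-m)) = x := by
    intro x hx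
    rw [← Real.rpow_mul hx, hp, show (1-m)/2 * (2/(1-m)) = 1 by field_simp, Real.rpow_one]
  refine ⟨t0, ht0, Q1 * ((1-m) * Q1) ^ ((1+m)/(1-m)), by positivity, ((1-m) * (c/2)) ^ (2/(1-m)) / 2, by positivity, ?_⟩
  intro t ht
  have htb : t ∈ Ioo b T := ⟨ht0.1.trans ht.1, ht.2⟩
  have hθ : 0 < T - t := sub_pos.2 ht.2
  have h1 : ((1-m) * (c/2)) ^ (2/(1-m)) * (T - t) ^ (2/(1-m)) ≤ zz t := by
    have := Real.rpow_le_rpow (by positivity) (hdn t ht) (z := 2/(1-m)) (by positivity)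
    rwa [hpp _ (hzzp t htb).le, Real.mul_rpow (by positivity) hθ.le] at this
  obtain ⟨t2, ht2⟩ := exists_between ht.2
  have hev := (hQb t2 ⟨ht.1.trans ht2.1, ht2.2⟩).and
    ((hzz t htb).eventually (lt_mem_nhds (show ((1-m) * (c/2)) ^ (2/(1-m)) / 2 * (T - t) ^ (2/(1-m)) < zz t by
      have : 0 < ((1-m) * (c/2)) ^ (2/(1-m)) * (T - t) ^ (2/(1-m)) := by positivity
      linarith)))
  obtain ⟨k0, hk0⟩ := eventually_atTop.1 hev
  refine ⟨k0, fun k hk => ⟨(hk0 k hk).2.le, ?_⟩⟩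
  have h2 := (hk0 k hk).1 t ⟨ht.1.le, ht2.1.le⟩
  have hz := hzp k t htb
  have h3 : y k t ≤ Q1 * z k t ^ q := by
    have := mul_le_mul_of_nonneg_right h2 (Real.rpow_nonneg hz.le q)
    rwa [mul_assoc, ← Real.rpow_add hz, neg_add_cancel, Real.rpow_zero, mul_one] at this
  have h4 : z k t ^ q ≤ ((1-m) * Q1) ^ ((1+m)/(1-m)) * (T - t) ^ ((1+m)/(1-m)) := by
    rw [← Real.mul_rpow (by positivity) hθ.le]
    have h5 : z k t ^ p ≤ (1-m) * Q1 * (T - t) := (Real.rpow_le_rpow hz.le (hlezz k t htb) hp0.le).trans (hup t ht)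
    have h6 := Real.rpow_le_rpow (Real.rpow_nonneg hz.le _) h5 (z := (1+m)/(1-m)) (by positivity)
    rwa [← Real.rpow_mul hz.le, show p * ((1+m)/(1-m)) = q by rw [hp, hq]; field_simp] at h6
  calc y k t ≤ Q1 * z k t ^ q := h3
    _ ≤ Q1 * (((1-m) * Q1) ^ ((1+m)/(1-m)) * (T - t) ^ ((1+m)/(1-m))) := mul_le_mul_of_nonneg_left h4 hQ1p.le
    _ = _ := by ring

lemma int_tail {n : ℕ} (hn : 1 ≤ n) {g : ℝ → ℝ} {B β r s : ℝ} (hr : 0 < r) (hrs : r ≤ s) (hβ : 0 < β) (hB : 0 ≤ B)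
    (hg : ContinuousOn g (Ici 0)) (h : ∀ x ∈ Icc r s, g x ≤ B * Sf n x ^ (-β)) :
    ∫ x in r..s, g x ≤ B * β⁻¹ * Sf n r ^ (-β) := by
  have hsub : uIcc r s ⊆ Ioi 0 := by
    rw [uIcc_of_le hrs]; intro x hx; exact lt_of_lt_of_le hr hx.1
  calc ∫ x in r..s, g x ≤ ∫ x in r..s, B * Sf n x ^ (-β) := by
        apply intervalIntegral.integral_mono_on hrs
        · exact ContinuousOn.intervalIntegrable (hg.mono (hsub.trans Ioi_subset_Ici_self))
        · exact (ContinuousOn.intervalIntegrable ((Sf_rpow_cont n (-β)).mono hsub)).const_mul B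
        · intro x hx; exact h x hx
    _ = B * ∫ x in r..s, Sf n x ^ (-β) := intervalIntegral.integral_const_mul _ _
    _ ≤ B * (β⁻¹ * Sf n r ^ (-β)) := mul_le_mul_of_nonneg_left (int_Sf_neg hn hβ hr hrs) hB
    _ = _ := by ring

lemma ii_of_cont {g : ℝ → ℝ} (hg : ContinuousOn g (Ici 0)) {x y : ℝ} (hx : 0 ≤ x) (hy : 0 ≤ y) :
    IntervalIntegrable g volume x y :=
  ContinuousOn.intervalIntegrable (hg.mono fun _ hz => le_trans (le_min hx hy) hz.1)

lemma int_const {g : ℝ → ℝ} {A r : ℝ} (hr : 0 ≤ r) (hg : ContinuousOn g (Ici 0)) (h : ∀ x ∈ Icc 0 r, g x ≤ A) :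
    ∫ x in (0:ℝ)..r, g x ≤ A * r := by
  have := intervalIntegral.integral_mono_on hr (ii_of_cont hg le_rfl hr)
    (intervalIntegrable_const (c := A)) h
  simpa [mul_comm] using this

lemma int_split {n : ℕ} (hn : 1 ≤ n) {g : ℝ → ℝ} {A B β s : ℝ} (hs : 1 ≤ s) (hβ : 0 < β) (hB : 0 ≤ B)
    (hg : ContinuousOn g (Ici 0)) (h0 : ∀ x ∈ Icc (0:ℝ) 1, g x ≤ A) (h : ∀ x ∈ Icc 1 s, g x ≤ B * Sf n x ^ (-β)) :
    ∫ x in (0:ℝ)..s, g x ≤ A + B * β⁻¹ := by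
  rw [← intervalIntegral.integral_add_adjacent_intervals (ii_of_cont hg le_rfl zero_le_one)
    (ii_of_cont hg zero_le_one (by linarith))]
  have h1 := int_const zero_le_one hg h0
  have h2 := int_tail hn one_pos hs hβ hB hg h
  have h3 : Sf n 1 ^ (-β) ≤ 1 := Real.rpow_le_one_of_one_le_of_nonpos (one_le_Sf n le_rfl) (by linarith)
  have : 0 ≤ B * β⁻¹ := by positivity
  nlinarith

lemma Vf_pos (n : ℕ) {r : ℝ} (hr : 0 < r) : 0 < Vf n r :=
  intervalIntegral.intervalIntegral_pos_of_pos_on ((Sf_cont n).intervalIntegrable _ _) (fun _ hx => Sf_pos n hx.1) hr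

lemma Vf_near {n : ℕ} {α r : ℝ} (hα0 : 0 < α) (hα1 : α < 1) (hr : 0 < r) :
    Vf n r ^ α / Sf n r ≤ r ^ (α * (n + 1) - n) := by
  have hS := Sf_pos n hr
  have h1 : Vf n r ^ α ≤ r ^ α * Sf n r ^ α := by
    rw [← Real.mul_rpow hr.le hS.le]
    exact Real.rpow_le_rpow (Vf_nonneg n hr.le) (Vf_le n hr.le) hα0.le
  have h2 : Sf n r ^ (α - 1) ≤ (r ^ n) ^ (α - 1) :=
    Real.rpow_le_rpow_of_nonpos (by positivity) (pow_le_pow_left₀ hr.le (Real.self_le_sinh_iff.2 hr.le) n) (by linarith)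
  calc Vf n r ^ α / Sf n r ≤ r ^ α * Sf n r ^ α / Sf n r := div_le_div_of_nonneg_right h1 hS.le
    _ = r ^ α * Sf n r ^ (α - 1) := by rw [Real.rpow_sub_one hS.ne']; ring
    _ ≤ r ^ α * (r ^ n) ^ (α - 1) := mul_le_mul_of_nonneg_left h2 (by positivity)
    _ = r ^ (α * (n + 1) - n) := by
        rw [← Real.rpow_natCast, ← Real.rpow_mul hr.le, ← Real.rpow_add hr]; ring_nf

lemma int_near {g : ℝ → ℝ} {D σ ρ : ℝ} (hσ : -1 < σ) (hρ : 0 ≤ ρ) (hg : ContinuousOn g (Ici 0))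
    (h : ∀ x ∈ Ioo 0 ρ, g x ≤ D * x ^ σ) : ∫ x in (0:ℝ)..ρ, g x ≤ D * (ρ ^ (σ+1) / (σ+1)) := by
  have h1 : ∫ x in (0:ℝ)..ρ, x ^ σ = ρ ^ (σ+1) / (σ+1) := by
    rw [integral_rpow (Or.inl hσ), Real.zero_rpow (by linarith)]; simp
  rw [← h1, ← intervalIntegral.integral_const_mul]
  exact intervalIntegral.integral_mono_on_of_le_Ioo hρ (ii_of_cont hg le_rfl hρ)
    ((intervalIntegral.intervalIntegrable_rpow' hσ).const_mul D) h

/-- the energy-type integrands -/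
noncomputable def Zf (n : ℕ) (u : ℝ → ℝ → ℝ) (R t : ℝ) : ℝ := ∫ x in (0:ℝ)..R, Mf n u x t ^ 2 / Sf n x
noncomputable def Yf (n : ℕ) (m : ℝ) (u : ℝ → ℝ → ℝ) (R t : ℝ) : ℝ := ∫ x in (0:ℝ)..R, u x t ^ m * (u x t * Sf n x)

section
variable {n : ℕ} {m a b T CB K : ℝ} {u wr ut : ℝ → ℝ → ℝ}

lemma Mf_zero (n : ℕ) (u : ℝ → ℝ → ℝ) (t : ℝ) : Mf n u 0 t = 0 := by simp [Mf]

lemma Ctx.zc (h : Ctx n m a b T CB K u wr ut) :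
    ContinuousOn (fun p : ℝ × ℝ => Mf n u p.1 p.2 ^ 2 / Sf n p.1) (Ici 0 ×ˢ Ioo b T) := by
  have hMc : ContinuousOn (fun p : ℝ × ℝ => Mf n u p.1 p.2) (Ici 0 ×ˢ Ioo b T) :=
    h.sol.Mc.mono (prod_mono le_rfl (Ioo_subset_Ioo_left h.hab.le))
  rintro ⟨r, t⟩ ⟨hr, ht⟩
  simp only [mem_Ici] at hr ht
  rcases hr.eq_or_lt with h0 | h0
  · subst h0
    obtain ⟨ν, -, -, C, hC, hM⟩ := h.Mbd
    have hz : Mf n u (0, t).1 (0, t).2 ^ 2 / Sf n ((0:ℝ), t).1 = 0 := by simp [Mf_zero]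
    rw [ContinuousWithinAt, hz]
    have hlim : Tendsto (fun p : ℝ × ℝ => C * p.1 * Mf n u p.1 p.2) (𝓝[Ici 0 ×ˢ Ioo b T] (0, t)) (𝓝 0) := by
      have : ContinuousWithinAt (fun p : ℝ × ℝ => C * p.1 * Mf n u p.1 p.2) (Ici 0 ×ˢ Ioo b T) (0, t) :=
        (by fun_prop : ContinuousWithinAt (fun p : ℝ × ℝ => C * p.1) _ _).mul (hMc (0, t) ⟨mem_Ici.2 le_rfl, ht⟩)
      have h2 := this.tendsto
      simpa [Mf_zero] using h2
    refine squeeze_zero' ?_ ?_ hlim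
    · filter_upwards [self_mem_nhdsWithin] with p hp
      exact div_nonneg (sq_nonneg _) (Sf_nonneg n hp.1)
    · have hlt : ∀ᶠ p : ℝ × ℝ in 𝓝[Ici 0 ×ˢ Ioo b T] (0, t), p.1 < 1 :=
        mem_nhdsWithin_of_mem_nhds ((continuous_fst.tendsto ((0:ℝ), t)).eventually (gt_mem_nhds one_pos))
      filter_upwards [self_mem_nhdsWithin, hlt] with p hp hp1
      have hp0 : 0 ≤ p.1 := hp.1
      rcases hp0.eq_or_lt with h1 | h1
      · rw [← h1, Sf_zero h.sol.hn]; simp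
      · have hS := Sf_pos n h1
        have hMn := h.sol.Mnn hp0 (h.sub hp.2)
        rw [div_le_iff₀ hS]
        have e1 := (hM p.2 hp.2).1 p.1 ⟨hp0, hp1.le⟩
        have e2 := mul_le_mul_of_nonneg_left (Vf_le n hp0) hC.le
        nlinarith
  · exact ((hMc (r, t) ⟨hr, ht⟩).pow 2).div ((Sf_cont n).comp continuous_fst).continuousWithinAt (Sf_pos n h0).ne'

lemma Ctx.zc' (h : Ctx n m a b T CB K u wr ut) {t : ℝ} (ht : t ∈ Ioo b T) :
    ContinuousOn (fun r => Mf n u r t ^ 2 / Sf n r) (Ici 0) :=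
  slice_r (g := fun r t => Mf n u r t ^ 2 / Sf n r) h.zc ht

lemma Sol.yc (h : Sol n m a T u wr ut) :
    ContinuousOn (fun p : ℝ × ℝ => u p.1 p.2 ^ m * (u p.1 p.2 * Sf n p.1)) (Ici 0 ×ˢ Ioo a T) := h.wc.mul h.uSc

lemma Sol.yc' (h : Sol n m a T u wr ut) {t : ℝ} (ht : t ∈ Ioo a T) :
    ContinuousOn (fun r => u r t ^ m * (u r t * Sf n r)) (Ici 0) :=
  slice_r (g := fun r t => u r t ^ m * (u r t * Sf n r)) h.yc ht

lemma Sol.MW (h : Sol n m a T u wr ut) {R t : ℝ} (hR : 0 ≤ R) (ht : t ∈ Ioo a T) :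
    ∫ x in (0:ℝ)..R, Mf n u x t * wr x t = Mf n u R t * u R t ^ m - Yf n m u R t := by
  have hM := slice_r h.Mc ht
  have hw := slice_r (g := fun r t => u r t ^ m) h.wc ht
  have hwr := slice_r h.wrc ht
  have c1 : ContinuousOn (fun x => u x t * Sf n x * u x t ^ m) (Ici 0) := (h.uSc' ht).mul hw
  have c2 : ContinuousOn (fun x => Mf n u x t * wr x t) (Ici 0) := hM.mul hwr
  have := ftc hR (f := fun x => Mf n u x t * u x t ^ m)
    (f' := fun x => u x t * Sf n x * u x t ^ m + Mf n u x t * wr x t)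
    ((hM.mul hw).mono Icc_subset_Ici_self) (fun x hx => (h.Mdr hx.1 ht).mul (h.dw x hx.1 t ht))
    ((c1.add c2).mono Icc_subset_Ici_self)
  rw [intervalIntegral.integral_add (ii_of_cont c1 le_rfl hR) (ii_of_cont c2 le_rfl hR), Mf_zero] at this
  have e : ∫ x in (0:ℝ)..R, u x t * Sf n x * u x t ^ m = Yf n m u R t := by
    rw [Yf]; congr 1; ext x; ring
  rw [e] at this; linarith

lemma Ctx.zd (h : Ctx n m a b T CB K u wr ut) {R t : ℝ} (hR : 0 ≤ R) (ht : t ∈ Ioo b T) :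
    HasDerivAt (Zf n u R) (2 * (Mf n u R t * u R t ^ m) - 2 * Yf n m u R t) t := by
  have hs : Icc 0 R ×ˢ Ioo b T ⊆ Ici 0 ×ˢ Ioo b T := prod_mono Icc_subset_Ici_self le_rfl
  have hs' : Icc 0 R ×ˢ Ioo b T ⊆ Ici 0 ×ˢ Ioo a T := prod_mono Icc_subset_Ici_self (Ioo_subset_Ioo_left h.hab.le)
  have := dint (g := fun x t => Mf n u x t ^ 2 / Sf n x) (gt := fun x t => 2 * (Mf n u x t * wr x t)) hR
    (h.zc.mono hs) ((continuousOn_const.mul (h.sol.Mc.mul h.sol.wrc)).mono hs')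
    (fun x hx t ht => by
      have hS := Sf_pos n hx.1
      refine (((h.sol.Mdt hx.1.le (h.sub ht)).fun_pow 2).div_const (Sf n x)).congr_deriv ?_
      field_simp; norm_num; ring) ht
  rw [intervalIntegral.integral_const_mul, h.sol.MW hR (h.sub ht)] at this
  exact this.congr_deriv (by ring)

lemma Sol.yd (h : Sol n m a T u wr ut) {R t : ℝ} (hR : 0 ≤ R) (ht : t ∈ Ioo a T) :
    HasDerivAt (Yf n m u R) ((1+m) * (u R t ^ m * (Sf n R * wr R t) - ∫ x in (0:ℝ)..R, Sf n x * wr x t ^ 2)) t := by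
  have hs : Icc 0 R ×ˢ Ioo a T ⊆ Ici 0 ×ˢ Ioo a T := prod_mono Icc_subset_Ici_self le_rfl
  have hSc : ContinuousOn (fun p : ℝ × ℝ => Sf n p.1) (Ici 0 ×ˢ Ioo a T) := ((Sf_cont n).comp continuous_fst).continuousOn
  have h1 := dint (g := fun x t => u x t ^ m * (u x t * Sf n x))
    (gt := fun x t => (1+m) * (u x t ^ m * (Sf n x * ut x t))) hR
    (h.yc.mono hs) ((continuousOn_const.mul (h.wc.mul (hSc.mul h.utc))).mono hs)
    (fun x hx t ht => by
      have hu := h.upos x hx.1.le t ht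
      refine ((h.dwt hx.1.le ht).mul ((h.du x hx.1.le t ht).mul_const (Sf n x))).congr_deriv ?_
      rw [Real.rpow_sub_one hu.ne']; field_simp; ring) ht
  have hw := slice_r (g := fun r t => u r t ^ m) h.wc ht
  have hwr := slice_r h.wrc ht
  have hut := slice_r h.utc ht
  have hS := (Sf_cont n).continuousOn (s := Ici 0)
  have c1 : ContinuousOn (fun x => wr x t * (Sf n x * wr x t)) (Ici 0) := hwr.mul (hS.mul hwr)
  have c2 : ContinuousOn (fun x => u x t ^ m * (Sf n x * ut x t)) (Ici 0) := hw.mul (hS.mul hut)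
  have := ftc hR (f := fun x => u x t ^ m * (Sf n x * wr x t))
    (f' := fun x => wr x t * (Sf n x * wr x t) + u x t ^ m * (Sf n x * ut x t))
    ((hw.mul (hS.mul hwr)).mono Icc_subset_Ici_self)
    (fun x hx => (h.dw x hx.1 t ht).mul (h.dF x hx.1 t ht))
    ((c1.add c2).mono Icc_subset_Ici_self)
  rw [intervalIntegral.integral_add (ii_of_cont c1 le_rfl hR) (ii_of_cont c2 le_rfl hR), Sf_zero h.hn] at this
  rw [intervalIntegral.integral_const_mul] at h1
  refine h1.congr_deriv ?_
  have e : ∫ x in (0:ℝ)..R, wr x t * (Sf n x * wr x t) = ∫ x in (0:ℝ)..R, Sf n x * wr x t ^ 2 := by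
    congr 1; ext x; ring
  rw [e] at this
  congr 1; linarith

lemma Ctx.cs (h : Ctx n m a b T CB K u wr ut) {R t : ℝ} (hR : 0 ≤ R) (ht : t ∈ Ioo b T) (hz : 0 < Zf n u R t) :
    (Yf n m u R t - Mf n u R t * u R t ^ m)^2 ≤ (∫ x in (0:ℝ)..R, Sf n x * wr x t ^ 2) * Zf n u R t := by
  have ht' := h.sub ht
  have hX := h.sol.MW hR ht'
  set A := ∫ x in (0:ℝ)..R, Sf n x * wr x t ^ 2
  set X := ∫ x in (0:ℝ)..R, Mf n u x t * wr x t with hXd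
  have hwr := slice_r h.sol.wrc ht'
  have c1 : ContinuousOn (fun x => Sf n x * wr x t ^ 2) (Ici 0) := (Sf_cont n).continuousOn.mul (hwr.pow 2)
  have c2 : ContinuousOn (fun x => Mf n u x t * wr x t) (Ici 0) := (slice_r h.sol.Mc ht').mul hwr
  have c3 := h.zc' ht
  have key : ∀ c : ℝ, 0 ≤ A + 2 * c * X + c^2 * Zf n u R t := by
    intro c
    have i1 := ii_of_cont c1 le_rfl hR
    have i2 := (ii_of_cont c2 le_rfl hR).const_mul (2*c)
    have i3 := (ii_of_cont c3 le_rfl hR).const_mul (c^2)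
    have : A + 2 * c * X + c^2 * Zf n u R t =
      ∫ x in (0:ℝ)..R, (Sf n x * wr x t ^ 2 + 2 * c * (Mf n u x t * wr x t) + c^2 * (Mf n u x t ^ 2 / Sf n x)) := by
      rw [intervalIntegral.integral_add (i1.add i2) i3, intervalIntegral.integral_add i1 i2,
        intervalIntegral.integral_const_mul, intervalIntegral.integral_const_mul, Zf]
    rw [this]
    refine intervalIntegral.integral_nonneg hR fun x hx => ?_
    rcases hx.1.eq_or_lt with h0 | h0
    · rw [← h0, Sf_zero h.sol.hn, Mf_zero]; simp
    · have hS := Sf_pos n h0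
      have : Sf n x * wr x t ^ 2 + 2 * c * (Mf n u x t * wr x t) + c^2 * (Mf n u x t ^ 2 / Sf n x)
        = Sf n x * (wr x t + c * Mf n u x t / Sf n x)^2 := by field_simp; ring
      rw [this]; positivity
  have h1 := key (-X / Zf n u R t)
  have h2 : A + 2 * (-X / Zf n u R t) * X + (-X / Zf n u R t)^2 * Zf n u R t = (A * Zf n u R t - X^2) / Zf n u R t := by
    field_simp; ring
  rw [h2] at h1
  have h3 := (div_nonneg_iff.1 h1).resolve_right (fun hh => absurd hh.2 (not_le.2 hz))
  have : (Yf n m u R t - Mf n u R t * u R t ^ m)^2 = X^2 := by rw [hX]; ring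
  linarith [h3.1]

lemma Sol.holder (h : Sol n m a T u wr ut) {r R t : ℝ} (hr : 0 ≤ r) (hR : r ≤ R) (ht : t ∈ Ioo a T) :
    Mf n u r t ≤ 2 * Yf n m u R t ^ (1/(1+m)) * Vf n r ^ (m/(1+m)) := by
  have hm0 := h.hm0
  rcases hr.eq_or_lt with h0 | h0
  · rw [← h0, Mf_zero, Vf_zero, Real.zero_rpow (by positivity)]; simp
  have hV := Vf_pos n h0
  have hYr : Yf n m u r t ≤ Yf n m u R t := by
    refine intervalIntegral.integral_mono_interval le_rfl hr hR ?_ (ii_of_cont (h.yc' ht) le_rfl (hr.trans hR))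
    filter_upwards [ae_restrict_mem measurableSet_Ioc] with x hx
    exact mul_nonneg (h.wpos hx.1.le ht).le (mul_nonneg (h.upos x hx.1.le t ht).le (Sf_nonneg n hx.1.le))
  have hY0 : 0 < Yf n m u r t := by
    refine intervalIntegral.intervalIntegral_pos_of_pos_on (ii_of_cont (h.yc' ht) le_rfl hr) ?_ h0
    intro x hx
    exact mul_pos (h.wpos hx.1.le ht) (mul_pos (h.upos x hx.1.le t ht) (Sf_pos n hx.1))
  set Y := Yf n m u R t
  have hY : 0 < Y := hY0.trans_le hYr
  set V := Vf n r
  set l := (Y / V) ^ (1/(1+m)) with hl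
  have hl0 : 0 < l := by positivity
  have h1 : Mf n u r t ≤ l ^ (-m) * Y + l * V := by
    have : Mf n u r t ≤ l ^ (-m) * Yf n m u r t + l * V := by
      simp only [Mf, Yf, V, Vf]
      rw [← intervalIntegral.integral_const_mul, ← intervalIntegral.integral_const_mul,
        ← intervalIntegral.integral_add ((ii_of_cont (h.yc' ht) le_rfl hr).const_mul _)
          (((Sf_cont n).intervalIntegrable _ _).const_mul _)]
      apply intervalIntegral.integral_mono_on hr (h.uSi ht le_rfl hr)
        (((ii_of_cont (h.yc' ht) le_rfl hr).const_mul _).add (((Sf_cont n).intervalIntegrable _ _).const_mul _))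
      intro x hx
      have hu := h.upos x hx.1 t ht
      have hS := Sf_nonneg n hx.1
      have hlm := Real.rpow_pos_of_pos hl0 (-m)
      have hw := h.wpos hx.1 ht
      rcases le_total (u x t) l with hle | hle
      · have : 0 ≤ l ^ (-m) * (u x t ^ m * (u x t * Sf n x)) := by positivity
        nlinarith
      · have : 1 ≤ l ^ (-m) * u x t ^ m := by
          rw [Real.rpow_neg hl0.le, ← div_eq_inv_mul, one_le_div (Real.rpow_pos_of_pos hl0 _)]
          exact Real.rpow_le_rpow hl0.le hle hm0.le
        have h3 : 0 ≤ u x t * Sf n x := by positivity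
        have h4 := mul_le_mul_of_nonneg_right this h3
        have h5 : 0 ≤ l * Sf n x := by positivity
        nlinarith
    have h2 := mul_le_mul_of_nonneg_left hYr (Real.rpow_pos_of_pos hl0 (-m)).le
    linarith
  have e0 : Y ^ (1/(1+m)) * V ^ (m/(1+m)) = l * V := by
    rw [hl, Real.div_rpow hY.le hV.le]
    have : V ^ (m/(1+m)) = V / V ^ (1/(1+m)) := by
      rw [eq_div_iff (by positivity), ← Real.rpow_add hV, show m/(1+m) + 1/(1+m) = 1 by field_simp; ring, Real.rpow_one]
    rw [this]; field_simp
  have e1 : l ^ (-m) * Y = l * V := by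
    have : l ^ (1+m) = Y / V := by
      rw [hl, ← Real.rpow_mul (by positivity), show 1/(1+m) * (1+m) = 1 by field_simp, Real.rpow_one]
    rw [Real.rpow_add hl0, Real.rpow_one] at this
    rw [Real.rpow_neg hl0.le]
    have hlm := Real.rpow_pos_of_pos hl0 m
    field_simp at this ⊢
    linarith
  rw [mul_assoc, e0]; linarith
end

section
variable {n : ℕ} {m a b T CB K : ℝ} {u wr ut : ℝ → ℝ → ℝ}

lemma a2_lt {m : ℝ} (hm0 : 0 < m) (hm1 : m < 1) : 0 < 2*m/(1+m) ∧ 2*m/(1+m) < 1 :=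
  ⟨by positivity, by rw [div_lt_one (by linarith)]; linarith⟩

lemma Ctx.sig (h : Ctx n m a b T CB K u wr ut) : -1 < 2*m/(1+m) * (n+1) - n := by
  have hm0 := h.sol.hm0
  have := h.hms
  have e : 2*m/(1+m) * (n+1) - n - (-1) = (m * (n+3) - (n-1)) / (1+m) := by field_simp; ring
  have : 0 < (m * (n+3) - ((n:ℝ)-1)) / (1+m) := div_pos (by linarith) (by linarith)
  linarith

lemma sq_rpow_alpha {V m : ℝ} (hV : 0 ≤ V) : (V ^ (m/(1+m)))^2 = V ^ (2*m/(1+m)) := by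
  rw [← Real.rpow_natCast, ← Real.rpow_mul hV]; congr 1; push_cast; ring

lemma Ctx.znear (h : Ctx n m a b T CB K u wr ut) {D ρ t : ℝ} (ht : t ∈ Ioo b T) (hρ : 0 ≤ ρ)
    (hM : ∀ x ∈ Icc 0 ρ, Mf n u x t ≤ D * Vf n x ^ (m/(1+m))) :
    ∫ x in (0:ℝ)..ρ, Mf n u x t ^ 2 / Sf n x ≤
      D^2 * (ρ ^ (2*m/(1+m) * (n+1) - n + 1) / (2*m/(1+m) * (n+1) - n + 1)) := by
  refine int_near h.sig hρ (h.zc' ht) fun x hx => ?_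
  have hS := Sf_pos n hx.1
  have h1 := a2_lt h.sol.hm0 h.sol.hm1
  have h2 := pow_le_pow_left₀ (h.sol.Mnn hx.1.le (h.sub ht)) (hM x ⟨hx.1.le, hx.2.le⟩) 2
  rw [mul_pow, sq_rpow_alpha (Vf_nonneg n hx.1.le)] at h2
  calc _ ≤ D^2 * Vf n x ^ (2*m/(1+m)) / Sf n x := div_le_div_of_nonneg_right h2 hS.le
    _ = D^2 * (Vf n x ^ (2*m/(1+m)) / Sf n x) := by ring
    _ ≤ _ := mul_le_mul_of_nonneg_left (Vf_near h1.1 h1.2 hx.1) (sq_nonneg D)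

lemma Ctx.zfar (h : Ctx n m a b T CB K u wr ut) {D r s t : ℝ} (ht : t ∈ Ioo b T) (hr : 1 ≤ r) (hs : r ≤ s)
    (hM : ∀ x ∈ Icc r s, Mf n u x t ≤ D * Vf n x ^ (m/(1+m))) :
    ∫ x in r..s, Mf n u x t ^ 2 / Sf n x ≤
      D^2 * (1 - 2*m/(1+m))⁻¹ * Sf n r ^ (-(1 - 2*m/(1+m))) := by
  have h1 := a2_lt h.sol.hm0 h.sol.hm1
  refine int_tail h.sol.hn (by linarith) hs (by linarith) (sq_nonneg D) (h.zc' ht) fun x hx => ?_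
  have hx0 : 0 < x := by linarith [hx.1]
  have hS := Sf_pos n hx0
  have h2 := pow_le_pow_left₀ (h.sol.Mnn hx0.le (h.sub ht)) (hM x hx) 2
  rw [mul_pow, sq_rpow_alpha (Vf_nonneg n hx0.le)] at h2
  calc _ ≤ D^2 * Vf n x ^ (2*m/(1+m)) / Sf n x := div_le_div_of_nonneg_right h2 hS.le
    _ ≤ D^2 * Sf n x ^ (2*m/(1+m)) / Sf n x := by
        have := Real.rpow_le_rpow (Vf_nonneg n hx0.le) (Vf_le' h.sol.hn hx0.le) h1.1.le
        gcongr
    _ = _ := by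
        rw [show -(1 - 2*m/(1+m)) = 2*m/(1+m) - 1 by ring, Real.rpow_sub_one hS.ne']; ring

lemma Ctx.zsplit (h : Ctx n m a b T CB K u wr ut) {r s t : ℝ} (ht : t ∈ Ioo b T) (hr : 0 ≤ r) (hs : 0 ≤ s) :
    Zf n u s t = Zf n u r t + ∫ x in r..s, Mf n u x t ^ 2 / Sf n x :=
  (intervalIntegral.integral_add_adjacent_intervals (ii_of_cont (h.zc' ht) le_rfl hr)
    (ii_of_cont (h.zc' ht) hr hs)).symm

lemma Ctx.hyz (h : Ctx n m a b T CB K u wr ut) : ∃ c > 0, ∀ R ≥ 1, ∀ t ∈ Ioo b T,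
    c * Zf n u R t ^ ((1+m)/2) ≤ Yf n m u R t := by
  have hm0 := h.sol.hm0
  have h1 := a2_lt h.sol.hm0 h.sol.hm1
  have hσ := h.sig
  set σ := 2*m/(1+m) * (n+1) - (n:ℝ)
  set Q := 4 * ((1:ℝ) / (σ+1) + (1 - 2*m/(1+m))⁻¹) with hQ
  have hQ0 : 0 < Q := by
    have : 0 < (1:ℝ)/(σ+1) := by apply one_div_pos.2; linarith
    have : 0 < (1 - 2*m/(1+m))⁻¹ := by apply inv_pos.2; linarith
    positivity
  refine ⟨(Q ^ ((1+m)/2))⁻¹, by positivity, fun R hR t ht => ?_⟩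
  have hY : 0 ≤ Yf n m u R t := intervalIntegral.integral_nonneg (by linarith) fun x hx =>
    mul_nonneg (h.sol.wpos hx.1 (h.sub ht)).le (mul_nonneg (h.sol.upos x hx.1 t (h.sub ht)).le (Sf_nonneg n hx.1))
  set D := 2 * Yf n m u R t ^ (1/(1+m)) with hD
  have hZ : Zf n u R t ≤ Q * Yf n m u R t ^ (2/(1+m)) := by
    rw [h.zsplit ht zero_le_one (by linarith : 0 ≤ R)]
    have e1 := h.znear (D := D) ht zero_le_one fun x hx => h.sol.holder hx.1 (hx.2.trans hR) (h.sub ht)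
    have e2 := h.zfar (D := D) ht le_rfl hR fun x hx => h.sol.holder (by linarith [hx.1]) hx.2 (h.sub ht)
    have e3 : Sf n 1 ^ (-(1 - 2*m/(1+m))) ≤ 1 :=
      Real.rpow_le_one_of_one_le_of_nonpos (one_le_Sf n le_rfl) (by linarith)
    have e4 : D^2 = 4 * Yf n m u R t ^ (2/(1+m)) := by
      rw [hD, mul_pow, ← Real.rpow_natCast (Yf n m u R t ^ (1/(1+m))), ← Real.rpow_mul hY]
      norm_num; congr 1; ring
    have e5 : 0 < (1 - 2*m/(1+m))⁻¹ := by apply inv_pos.2; linarith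
    rw [Real.one_rpow] at e1
    have e6 : D^2 * (1 - 2*m/(1+m))⁻¹ * Sf n 1 ^ (-(1 - 2*m/(1+m))) ≤ D^2 * (1 - 2*m/(1+m))⁻¹ :=
      mul_le_of_le_one_right (by positivity) e3
    rw [hQ]
    have e7 : Zf n u 1 t ≤ D^2 * (1/(σ+1)) := e1
    have : 4 * (1/(σ+1) + (1 - 2*m/(1+m))⁻¹) * Yf n m u R t ^ (2/(1+m)) =
      D^2 * (1/(σ+1)) + D^2 * (1 - 2*m/(1+m))⁻¹ := by rw [e4]; ring
    linarith
  have hZ0 : 0 ≤ Zf n u R t := intervalIntegral.integral_nonneg (by linarith) fun x hx =>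
    div_nonneg (sq_nonneg _) (Sf_nonneg n hx.1)
  have := Real.rpow_le_rpow hZ0 hZ (by positivity : 0 ≤ (1+m)/2)
  rw [Real.mul_rpow hQ0.le (by positivity), ← Real.rpow_mul hY,
    show 2/(1+m)*((1+m)/2) = 1 by field_simp, Real.rpow_one] at this
  rw [inv_mul_le_iff₀ (by positivity)]; exact this

lemma Ctx.hext (h : Ctx n m a b T CB K u wr ut) {R : ℝ} (hR : 0 ≤ R) : Tendsto (Zf n u R) (𝓝[<] T) (𝓝 0) := by
  have hn := h.sol.hn
  have hu0 : ∀ ε > 0, ∀ᶠ t in 𝓝[<] T, ∀ x ∈ Icc 0 R, u x t < ε := by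
    intro ε hε
    have hcov : ∀ x ∈ Icc (0:ℝ) R, ∃ s ∈ 𝓝[Icc 0 R] x, ∀ᶠ t in 𝓝[<] T, ∀ y ∈ s, u y t < ε := by
      intro x hx
      have h1 := h.ucT (x, T) ⟨hx.1, h.hbT.le, le_rfl⟩
      have h2 : ∀ᶠ p in 𝓝[Ici 0 ×ˢ Icc b T] (x, T), u p.1 p.2 < ε :=
        h1.tendsto.eventually (gt_mem_nhds (by simp [h.uT x hx.1, hε]))
      rw [nhdsWithin_prod_eq] at h2
      obtain ⟨s, hs, t, ht, hst⟩ := Filter.mem_prod_iff.1 h2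
      refine ⟨s, nhdsWithin_mono x Icc_subset_Ici_self hs, ?_⟩
      have hI : Icc b T ∈ 𝓝[<] T := mem_of_superset (Ioo_mem_nhdsLT h.hbT) Ioo_subset_Icc_self
      have : t ∈ 𝓝[<] T := (nhdsWithin_le_iff.2 hI) ht
      filter_upwards [this] with τ hτ y hy
      exact hst (mk_mem_prod hy hτ)
    refine isCompact_Icc.induction_on (p := fun s => ∀ᶠ t in 𝓝[<] T, ∀ y ∈ s, u y t < ε) (by simp)
      (fun s t hst h => h.mono fun τ h y hy => h y (hst hy))
      (fun s t h1 h2 => by filter_upwards [h1, h2] with τ h1 h2 y hy; exact hy.elim (h1 y) (h2 y)) hcov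
  rw [tendsto_order]
  have hI : Ioo b T ∈ 𝓝[<] T := Ioo_mem_nhdsLT h.hbT
  refine ⟨fun a' ha' => ?_, fun a' ha' => ?_⟩
  · filter_upwards [hI] with t ht
    exact ha'.trans_le (intervalIntegral.integral_nonneg hR fun x hx => div_nonneg (sq_nonneg _) (Sf_nonneg n hx.1))
  · have hex : ∃ ε > 0, ε^2 * Sf n R * R < a' := by
      have : Tendsto (fun ε : ℝ => ε^2 * Sf n R * R) (𝓝[>] 0) (𝓝 0) := by
        have : Tendsto (fun ε : ℝ => ε^2 * Sf n R * R) (𝓝 0) (𝓝 (0^2 * Sf n R * R)) := Continuous.tendsto (by fun_prop) 0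
        simp at this; exact this.mono_left nhdsWithin_le_nhds
      obtain ⟨ε, h1, h2⟩ := ((this.eventually (gt_mem_nhds ha')).and self_mem_nhdsWithin).exists
      exact ⟨ε, h2, h1⟩
    obtain ⟨ε, hε, hεa⟩ := hex
    filter_upwards [hu0 ε hε, hI] with t h1 ht
    refine lt_of_le_of_lt (int_const hR (h.zc' ht) fun x hx => ?_) hεa
    have hMV : Mf n u x t ≤ ε * Vf n x := by
      rw [Mf, Vf, ← intervalIntegral.integral_const_mul]
      refine intervalIntegral.integral_mono_on hx.1 (h.sol.uSi (h.sub ht) le_rfl hx.1)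
        (((Sf_cont n).intervalIntegrable _ _).const_mul ε) fun y hy => ?_
      exact mul_le_mul_of_nonneg_right (h1 y ⟨hy.1, hy.2.trans hx.2⟩).le (Sf_nonneg n hy.1)
    rcases hx.1.eq_or_lt with h0 | h0
    · rw [← h0, Sf_zero hn]; simp; exact mul_nonneg (sq_nonneg ε) (Sf_nonneg n hR)
    · have hS := Sf_pos n h0
      have h3 := hMV.trans (mul_le_mul_of_nonneg_left (Vf_le' hn h0.le) hε.le)
      have h4 := pow_le_pow_left₀ (h.sol.Mnn h0.le (h.sub ht)) h3 2
      rw [div_le_iff₀ hS]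
      refine h4.trans ?_
      rw [mul_pow, mul_assoc]
      refine mul_le_mul_of_nonneg_left ?_ (sq_nonneg ε)
      nlinarith [Sf_mono n h0.le hx.2]

lemma Ctx.energy (h : Ctx n m a b T CB K u wr ut) : ∃ b' ∈ Ioo b T, ∃ C > 0, ∃ c' > 0, ∀ t ∈ Ioo b' T,
    (∀ r ≥ 0, Mf n u r t ≤ C * (T-t)^(1/(1-m)) * Vf n r ^ (m/(1+m))) ∧
    ∃ R0, ∀ R ≥ R0, c' * ((T-t)^(1/(1-m)))^2 ≤ Zf n u R t := by
  have hm0 := h.sol.hm0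
  have hm1 := h.sol.hm1
  have hn := h.sol.hn
  obtain ⟨ν, hν0, hν1, C1, hC1, hM⟩ := h.Mbd
  obtain ⟨C2, hC2, hu⟩ := h.ubd
  obtain ⟨c, hc, hyz⟩ := h.hyz
  have hμ : 0 < 1/m - 1 := by rw [sub_pos, lt_div_iff₀ hm0]; linarith
  have hk : ∀ k : ℕ, (1:ℝ) ≤ (k:ℝ) + 1 := fun k => by have := k.cast_nonneg (α := ℝ); linarith
  have hk0 : ∀ k : ℕ, (0:ℝ) ≤ (k:ℝ) + 1 := fun k => by have := k.cast_nonneg (α := ℝ); linarith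
  have htop : ∀ β : ℝ, 0 < β → Tendsto (fun k : ℕ => Sf n ((k:ℝ)+1) ^ (-β)) atTop (𝓝 0) := fun β hβ =>
    (tendsto_rpow_neg_atTop hβ).comp ((Sf_tendsto hn).comp
      (tendsto_atTop_add_const_right _ _ tendsto_natCast_atTop_atTop))
  -- integrand bounds
  have hz1 : ∀ t ∈ Ioo b T, ∀ x ∈ Icc (0:ℝ) 1, Mf n u x t ^ 2 / Sf n x ≤ C1^2 * Sf n 1 := by
    intro t ht x hx
    rcases hx.1.eq_or_lt with h0 | h0
    · rw [← h0, Sf_zero hn]; simp; exact mul_nonneg (sq_nonneg _) (Sf_nonneg n zero_le_one)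
    · have hS := Sf_pos n h0
      have h3 := ((hM t ht).1 x hx).trans (mul_le_mul_of_nonneg_left (Vf_le' hn h0.le) hC1.le)
      have h4 := pow_le_pow_left₀ (h.sol.Mnn h0.le (h.sub ht)) h3 2
      rw [div_le_iff₀ hS]
      refine h4.trans ?_
      rw [mul_pow, mul_assoc]
      refine mul_le_mul_of_nonneg_left ?_ (sq_nonneg _)
      nlinarith [Sf_mono n h0.le hx.2]
  have hz2 : ∀ t ∈ Ioo b T, ∀ x ≥ 1, Mf n u x t ^ 2 / Sf n x ≤ C1^2 * Sf n x ^ (-(2*ν)) := by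
    intro t ht x hx
    have hx0 : 0 < x := by linarith
    have hS := Sf_pos n hx0
    have h4 := pow_le_pow_left₀ (h.sol.Mnn hx0.le (h.sub ht)) ((hM t ht).2 x hx) 2
    rw [div_le_iff₀ hS, mul_assoc, ← Real.rpow_add_one hS.ne']
    refine h4.trans (le_of_eq ?_)
    rw [mul_pow, ← Real.rpow_natCast (Sf n x ^ (1/2 - ν)), ← Real.rpow_mul hS.le]; congr 2; push_cast; ring
  have hy1 : ∀ t ∈ Ioo b T, ∀ x ∈ Icc (0:ℝ) 1, u x t ^ m * (u x t * Sf n x) ≤ C2^m * (C2 * Sf n 1) := by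
    intro t ht x hx
    have hu0 := (h.sol.upos x hx.1 t (h.sub ht)).le
    have h1 := (hu t ht).1 x hx
    have h2 := Real.rpow_le_rpow hu0 h1 hm0.le
    have h3 := Sf_mono n hx.1 hx.2
    have := Sf_nonneg n hx.1
    gcongr
  have hy2 : ∀ t ∈ Ioo b T, ∀ x ≥ 1, u x t ^ m * (u x t * Sf n x) ≤ C2^2 * Sf n x ^ (-((1/m-1)/2)) := by
    intro t ht x hx
    have hx0 : 0 < x := by linarith
    have hS := Sf_pos n hx0
    have hu0 := (h.sol.upos x hx0.le t (h.sub ht)).le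
    have h1 := (hu t ht).2.1 x hx
    have h2 := (hu t ht).2.2 x hx
    calc _ ≤ C2 * Sf n x ^ (-(1/2):ℝ) * (C2 * Sf n x ^ (-(1/(2*m)):ℝ) * Sf n x) := by gcongr
      _ = C2^2 * (Sf n x ^ (-(1/2):ℝ) * (Sf n x ^ (-(1/(2*m)):ℝ) * Sf n x)) := by ring
      _ = _ := by
        rw [← Real.rpow_add_one hS.ne', ← Real.rpow_add hS]; congr 2; field_simp; ring
  have hZp : ∀ k : ℕ, ∀ t ∈ Ioo b T, 0 < Zf n u ((k:ℝ)+1) t := fun k t ht =>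
    intervalIntegral.intervalIntegral_pos_of_pos_on (ii_of_cont (h.zc' ht) le_rfl (hk0 k))
      (fun x hx => div_pos (pow_pos (h.sol.Mpos hx.1 (h.sub ht)) 2) (Sf_pos n hx.1)) (by linarith [hk k])
  have hzm : ∀ j k : ℕ, j ≤ k → ∀ t ∈ Ioo b T, Zf n u ((j:ℝ)+1) t ≤ Zf n u ((k:ℝ)+1) t := by
    intro j k hjk t ht
    have hjk' : (j:ℝ) + 1 ≤ k + 1 := by have : (j:ℝ) ≤ k := by exact_mod_cast hjk
                                        linarith
    rw [h.zsplit ht (hk0 j) (hk0 k)]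
    have := intervalIntegral.integral_nonneg hjk' (f := fun x => Mf n u x t ^ 2 / Sf n x) (μ := volume) fun x hx =>
      div_nonneg (sq_nonneg _) (Sf_nonneg n ((hk0 j).trans hx.1))
    linarith
  have hτ0 : ∀ k : ℕ, 0 ≤ C1^2 * (2*ν)⁻¹ * Sf n ((k:ℝ)+1) ^ (-(2*ν)) := fun k => by
    have := Real.rpow_nonneg (Sf_nonneg n (hk0 k)) (-(2*ν)); positivity
  have hB1 : 0 < C2^m * (C2 * Sf n 1) + C2^2 * ((1/m-1)/2)⁻¹ := by
    have := Sf_pos n one_pos; positivity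
  have hB2 : 0 < C1^2 * Sf n 1 + C1^2 * (2*ν)⁻¹ := by
    have := Sf_pos n one_pos; positivity
  obtain ⟨b', hb', C, hC, c', hc', hfin⟩ := ode_main (m := m) (T := T) (b := b) (c := c) (CB := CB)
    (Y0 := (C2^m * (C2 * Sf n 1) + C2^2 * ((1/m-1)/2)⁻¹) + (C1^2 * Sf n 1 + C1^2 * (2*ν)⁻¹))
    (y := fun k => Yf n m u ((k:ℝ)+1)) (z := fun k => Zf n u ((k:ℝ)+1))
    (d := fun k t => Mf n u ((k:ℝ)+1) t * u ((k:ℝ)+1) t ^ m)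
    (y' := fun k t => (1+m) * (u ((k:ℝ)+1) t ^ m * (Sf n ((k:ℝ)+1) * wr ((k:ℝ)+1) t) -
      ∫ x in (0:ℝ)..((k:ℝ)+1), Sf n x * wr x t ^ 2))
    (ε := fun k => C1 * C2 * Sf n ((k:ℝ)+1) ^ (-ν)) (τ := fun k => C1^2 * (2*ν)⁻¹ * Sf n ((k:ℝ)+1) ^ (-(2*ν)))
    hm0 hm1 h.hbT hc h.hCB (by positivity)
    (by simpa using (htop ν hν0).const_mul (C1 * C2)) (by simpa using (htop (2*ν) (by positivity)).const_mul (C1^2 * (2*ν)⁻¹))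
    (fun k t ht => h.zd (hk0 k) ht) (fun k t ht => h.sol.yd (hk0 k) (h.sub ht))
    (fun k t ht => by
      have e1 := h.cs (hk0 k) ht (hZp k t ht)
      have e2 := h.Fle (hk0 k) ht
      have e3 := mul_le_mul_of_nonneg_right (mul_le_mul_of_nonneg_left e2 (h.sol.wpos (hk0 k) (h.sub ht)).le) (hZp k t ht).le
      rw [mul_assoc]
      refine mul_le_mul_of_nonneg_left ?_ (by linarith)
      rw [sub_mul]
      nlinarith)
    (fun k t ht => mul_nonneg (h.sol.Mnn (hk0 k) (h.sub ht)) (h.sol.wpos (hk0 k) (h.sub ht)).le)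
    (fun k t ht => by
      have hS := Sf_pos n (by linarith [hk k] : (0:ℝ) < (k:ℝ)+1)
      have e1 := (hM t ht).2 _ (hk k)
      have e2 := (hu t ht).2.1 _ (hk k)
      refine (mul_le_mul e1 e2 (h.sol.wpos (hk0 k) (h.sub ht)).le (by positivity)).trans (le_of_eq ?_)
      rw [show C1 * Sf n ((k:ℝ)+1) ^ (1/2-ν) * (C2 * Sf n ((k:ℝ)+1) ^ (-(1/2):ℝ)) =
        C1 * C2 * (Sf n ((k:ℝ)+1) ^ (1/2-ν) * Sf n ((k:ℝ)+1) ^ (-(1/2):ℝ)) by ring, ← Real.rpow_add hS]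
      congr 2; ring)
    (fun k t ht => hyz _ (hk k) t ht)
    (fun k t ht => by
      have := int_split hn (hk k) (by positivity : 0 < (1/m-1)/2) (sq_nonneg C2) (h.sol.yc' (h.sub ht)) (hy1 t ht)
        fun x hx => hy2 t ht x hx.1
      have e : Yf n m u ((k:ℝ)+1) t ≤ _ := this
      linarith)
    (fun k t ht => by
      have := int_split hn (hk k) (by positivity : 0 < 2*ν) (sq_nonneg C1) (h.zc' ht) (hz1 t ht)
        fun x hx => hz2 t ht x hx.1
      have e : Zf n u ((k:ℝ)+1) t ≤ _ := this
      linarith)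
    hZp hzm
    (fun j k t ht => by
      rcases le_total j k with hjk | hjk
      · have := hzm j k hjk t ht
        have := hτ0 k
        linarith
      · have hjk' : (k:ℝ) + 1 ≤ j + 1 := by have : (k:ℝ) ≤ j := by exact_mod_cast hjk
                                            linarith
        have e := h.zsplit ht (hk0 k) (hk0 j)
        have e2 := int_tail hn (by linarith [hk k]) hjk' (by positivity : 0 < 2*ν) (sq_nonneg C1) (h.zc' ht)
          fun x hx => hz2 t ht x ((hk k).trans hx.1)
        linarith)
    (fun k => h.hext (hk0 k))
  have hm1' : 0 < 1 - m := by linarith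
  refine ⟨b', hb', 2 * C ^ (1/(1+m)), by positivity, c', hc', fun t ht => ?_⟩
  have ht2 : t ∈ Ioo b T := ⟨hb'.1.trans ht.1, ht.2⟩
  have hθ : 0 < T - t := by linarith [ht.2]
  obtain ⟨k0, hk0'⟩ := hfin t ht
  refine ⟨fun r hr => ?_, (k0:ℝ) + 1, fun R hR => ?_⟩
  · obtain ⟨k1, hk1⟩ := exists_nat_ge r
    set k := max k0 k1
    have hrk : r ≤ (k:ℝ) + 1 := by
      have : (k1:ℝ) ≤ k := by exact_mod_cast le_max_right _ _
      linarith
    have e1 := (hk0' k (le_max_left _ _)).2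
    have e2 := h.sol.holder hr hrk (h.sub ht2)
    have hY0 : 0 ≤ Yf n m u ((k:ℝ)+1) t := intervalIntegral.integral_nonneg (hk0 k) fun x hx =>
      mul_nonneg (h.sol.wpos hx.1 (h.sub ht2)).le (mul_nonneg (h.sol.upos x hx.1 t (h.sub ht2)).le (Sf_nonneg n hx.1))
    have e3 := Real.rpow_le_rpow hY0 e1 (by positivity : 0 ≤ 1/(1+m))
    rw [Real.mul_rpow hC.le (by positivity), ← Real.rpow_mul hθ.le,
      show (1+m)/(1-m) * (1/(1+m)) = 1/(1-m) by field_simp] at e3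
    refine e2.trans (mul_le_mul_of_nonneg_right ?_ (Real.rpow_nonneg (Vf_nonneg n hr) _))
    linarith
  · have hR0 : 0 ≤ R := (hk0 k0).trans hR
    have e1 := (hk0' k0 le_rfl).1
    have e0 := intervalIntegral.integral_nonneg hR (f := fun x => Mf n u x t ^ 2 / Sf n x) (μ := volume) fun x hx =>
      div_nonneg (sq_nonneg _) (Sf_nonneg n ((hk0 k0).trans hx.1))
    rw [h.zsplit ht2 (hk0 k0) hR0]
    rw [← Real.rpow_natCast, ← Real.rpow_mul hθ.le, show 1/(1-m) * ((2:ℕ):ℝ) = 2/(1-m) by push_cast; ring]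
    linarith

end

section
variable {n : ℕ} {m a b T CB K : ℝ} {u wr ut : ℝ → ℝ → ℝ}

lemma Ctx.umid (h : Ctx n m a b T CB K u wr ut) : ∃ b' ∈ Ioo b T, ∃ ρ > 0, ∃ R ≥ ρ, ∃ c > 0, ∀ t ∈ Ioo b' T,
    ∃ r1 ∈ Icc ρ R, c * (T-t)^(1/(1-m)) ≤ u r1 t := by
  have hm0 := h.sol.hm0
  have hn := h.sol.hn
  obtain ⟨b', hb', C, hC, c', hc', hE⟩ := h.energy
  have h1 := a2_lt h.sol.hm0 h.sol.hm1
  have hσ := h.sig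
  set σ := 2*m/(1+m) * (n+1) - (n:ℝ) with hσd
  have l1 : Tendsto (fun ρ : ℝ => C^2 * (ρ ^ (σ+1) / (σ+1))) (𝓝[>] 0) (𝓝 0) := by
    have : ContinuousAt (fun ρ : ℝ => C^2 * (ρ ^ (σ+1) / (σ+1))) 0 :=
      continuousAt_const.mul ((continuousAt_id.rpow_const (Or.inr (by linarith))).div_const _)
    have := this.tendsto
    simp only [Real.zero_rpow (by linarith : σ + 1 ≠ 0)] at this
    simpa using this.mono_left nhdsWithin_le_nhds
  have l2 : Tendsto (fun R : ℝ => C^2 * (1 - 2*m/(1+m))⁻¹ * Sf n R ^ (-(1 - 2*m/(1+m)))) atTop (𝓝 0) := by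
    simpa using ((tendsto_rpow_neg_atTop (by linarith : 0 < 1 - 2*m/(1+m))).comp (Sf_tendsto hn)).const_mul
      (C^2 * (1 - 2*m/(1+m))⁻¹)
  obtain ⟨ρ, hρ2, hρ0, hρ1⟩ := ((l1.eventually (gt_mem_nhds (by positivity : 0 < c'/4))).and
    (Ioo_mem_nhdsGT one_pos : ∀ᶠ x in 𝓝[>] (0:ℝ), x ∈ Ioo 0 1)).exists
  obtain ⟨R, hR2, hR1⟩ := ((l2.eventually (gt_mem_nhds (by positivity : 0 < c'/4))).and (eventually_ge_atTop 1)).exists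
  have hR0 : 0 < R := by linarith
  have hSρ := Sf_pos n hρ0
  set c1 := Real.sqrt (c'/2 * Sf n ρ / R) with hc1d
  have hc1 : 0 < c1 := Real.sqrt_pos.2 (by positivity)
  have l3 : Tendsto (fun ρ : ℝ => C * Vf n ρ ^ (m/(1+m))) (𝓝[>] 0) (𝓝 0) := by
    have : ContinuousAt (fun ρ : ℝ => C * Vf n ρ ^ (m/(1+m))) 0 :=
      continuousAt_const.mul ((Vf_hasDeriv n 0).continuousAt.rpow_const (Or.inr (by positivity)))
    have := this.tendsto
    simp only [Vf_zero, Real.zero_rpow (by positivity : m/(1+m) ≠ 0)] at this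
    simpa using this.mono_left nhdsWithin_le_nhds
  obtain ⟨ρ', hρ2', hρ0', hρ1'⟩ := ((l3.eventually (gt_mem_nhds (by positivity : 0 < c1/2))).and
    (Ioo_mem_nhdsGT one_pos : ∀ᶠ x in 𝓝[>] (0:ℝ), x ∈ Ioo 0 1)).exists
  have hV := Vf_pos n hR0
  refine ⟨b', hb', ρ', hρ0', R, by linarith, c1/(2 * Vf n R), by positivity, fun t ht => ?_⟩
  have ht2 : t ∈ Ioo b T := ⟨hb'.1.trans ht.1, ht.2⟩
  obtain ⟨hMb, R0, hR0'⟩ := hE t ht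
  set E := (T-t)^(1/(1-m))
  have hE0 : 0 < E := Real.rpow_pos_of_pos (by linarith [ht.2]) _
  have g1 := hR0' (max R R0) (le_max_right _ _)
  have hRm := le_max_left R R0
  rw [h.zsplit ht2 hR0.le (hR0.le.trans hRm), h.zsplit ht2 hρ0.le hR0.le] at g1
  have g2 : Zf n u ρ t ≤ c'/4 * E^2 := by
    have := h.znear ht2 hρ0.le (D := C * E) fun x hx => hMb x hx.1
    refine this.trans ?_
    rw [mul_pow, mul_right_comm, ← hσd]
    gcongr
  have g3 := h.zfar ht2 hR1 hRm (D := C * E) fun x hx => hMb x (by linarith [hx.1])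
  have g4 : (C*E)^2 * (1 - 2*m/(1+m))⁻¹ * Sf n R ^ (-(1 - 2*m/(1+m))) ≤ c'/4 * E^2 := by
    rw [mul_pow, mul_right_comm (C^2), mul_right_comm (C^2 * _)]; gcongr
  have g5 : ∫ x in ρ..R, Mf n u x t ^ 2 / Sf n x ≤ Mf n u R t ^ 2 / Sf n ρ * R := by
    have := intervalIntegral.integral_mono_on (by linarith) (ii_of_cont (h.zc' ht2) hρ0.le hR0.le)
      (intervalIntegrable_const (c := Mf n u R t ^ 2 / Sf n ρ)) (fun x hx => ?_)
    · refine this.trans ?_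
      rw [intervalIntegral.integral_const, smul_eq_mul, mul_comm]
      exact mul_le_mul_of_nonneg_left (by linarith) (by positivity)
    · have := h.sol.Mnn (hρ0.le.trans hx.1) (h.sub ht2)
      have := h.sol.Mmono (hρ0.le.trans hx.1) hx.2 (h.sub ht2)
      have := Sf_mono n hρ0.le hx.1
      gcongr
  have g6 : c1 * E ≤ Mf n u R t := by
    refine abs_le_of_sq_le_sq' ?_ (h.sol.Mnn hR0.le (h.sub ht2)) |>.2
    rw [mul_pow, hc1d, Real.sq_sqrt (by positivity)]
    have : c'/2 * E^2 ≤ Mf n u R t ^ 2 / Sf n ρ * R := by nlinarith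
    rw [div_mul_eq_mul_div (Mf n u R t ^ 2), le_div_iff₀ hSρ] at this
    rw [div_mul_eq_mul_div, div_le_iff₀ hR0]; linarith
  by_contra! hcon
  have g7 : Mf n u ρ' t ≤ c1/2 * E := (hMb ρ' hρ0'.le).trans (by rw [mul_right_comm]; gcongr)
  have g8 : Mf n u R t = Mf n u ρ' t + ∫ x in ρ'..R, u x t * Sf n x :=
    (intervalIntegral.integral_add_adjacent_intervals (h.sol.uSi (h.sub ht2) le_rfl hρ0'.le)
      (h.sol.uSi (h.sub ht2) hρ0'.le hR0.le)).symm
  have g9 : ∫ x in ρ'..R, u x t * Sf n x < ∫ x in ρ'..R, c1/(2 * Vf n R) * E * Sf n x := by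
    refine intervalIntegral.integral_lt_integral_of_continuousOn_of_le_of_exists_lt (by linarith)
      ((h.sol.uSc' (h.sub ht2)).mono fun x hx => hρ0'.le.trans hx.1) (continuousOn_const.mul (Sf_cont n).continuousOn)
      (fun x hx => ?_) ⟨R, ⟨by linarith, le_rfl⟩, ?_⟩
    · exact mul_le_mul_of_nonneg_right (hcon x ⟨hx.1.le, hx.2⟩).le (Sf_nonneg n (by linarith [hx.1]))
    · exact mul_lt_mul_of_pos_right (hcon R ⟨by linarith, le_rfl⟩) (Sf_pos n hR0)
  rw [intervalIntegral.integral_const_mul] at g9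
  have g10 : ∫ x in ρ'..R, Sf n x ≤ Vf n R := by
    rw [Vf, ← intervalIntegral.integral_add_adjacent_intervals ((Sf_cont n).intervalIntegrable 0 ρ')
      ((Sf_cont n).intervalIntegrable ρ' R)]
    have : 0 ≤ Vf n ρ' := Vf_nonneg n hρ0'.le
    unfold Vf at this; linarith
  have g11 : c1/(2 * Vf n R) * E * (∫ x in ρ'..R, Sf n x) ≤ c1/2 * E := by
    refine (mul_le_mul_of_nonneg_left g10 (by positivity)).trans (le_of_eq ?_)
    field_simp
  linarith

end

/-- the time profile -/
noncomputable def Ef (m T t : ℝ) : ℝ := (T - t) ^ (1/(1-m))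

lemma Ef_pos {m T t : ℝ} (ht : t < T) : 0 < Ef m T t := Real.rpow_pos_of_pos (by linarith) _

lemma Ef_mul {m T t : ℝ} (hm1 : m < 1) (ht : t < T) : (T - t) * Ef m T t ^ m = Ef m T t := by
  have hθ : 0 < T - t := by linarith
  have h1 : 1 - m ≠ 0 := by linarith
  rw [Ef, ← Real.rpow_mul hθ.le]
  nth_rewrite 1 [← Real.rpow_one (T - t)]
  rw [← Real.rpow_add hθ]; congr 1; field_simp; ring

/-- mass bound with rate -/
def PP (n : ℕ) (m b T : ℝ) (u : ℝ → ℝ → ℝ) (η : ℝ) : Prop :=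
  ∃ b1 ∈ Ioo b T, ∃ C > 0, ∀ t ∈ Ioo b1 T, ∀ r ≥ 1, Mf n u r t ≤ C * Ef m T t * Sf n r ^ (1 - η)

section
variable {n : ℕ} {m a b T CB K : ℝ} {u wr ut : ℝ → ℝ → ℝ}

lemma Ctx.Wlem (h : Ctx n m a b T CB K u wr ut) {t0 t1 D η r : ℝ} (ht0 : t0 ∈ Ioo b T) (ht1 : t1 ∈ Ioo b T)
    (h01 : t0 < t1) (hη : 0 < η) (hr : 1 ≤ r) (hD : 0 ≤ D)
    (hM : ∀ x ≥ r, Mf n u x t0 ≤ D * Sf n x ^ (1 - η)) :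
    (t1 - t0) * u r t1 ^ m ≤ K * (D * η⁻¹ * Sf n r ^ (-η)) := by
  have hn := h.sol.hn
  obtain ⟨C, hC, hb⟩ := h.ubd
  have hr0 : 0 < r := by linarith
  have hI : Icc t0 t1 ⊆ Ioo b T := fun x hx => ⟨ht0.1.trans_le hx.1, hx.2.trans_lt ht1.2⟩
  have hI' : Icc t0 t1 ⊆ Ioo a T := fun x hx => h.sub (hI hx)
  have hu' : uIcc t0 t1 = Icc t0 t1 := uIcc_of_le h01.le
  set W := fun x => ∫ s in t0..t1, u x s ^ m
  have hWd : ∀ x > 0, HasDerivAt W (∫ s in t0..t1, wr x s) x := fun x hx => by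
    have hs : ∀ {A B : Set ℝ}, A ⊆ Ioo a T → B ⊆ Ici 0 → A ×ˢ B ⊆ Ioo a T ×ˢ Ici 0 := fun hA hB => prod_mono hA hB
    have hB : Ioo (0:ℝ) (x+1) ⊆ Ici 0 := fun y hy => hy.1.le
    refine dint (g := fun s x => u x s ^ m) (gt := fun s x => wr x s) h01.le
      ((swap_cont (g := fun r t => u r t ^ m) h.sol.wc).mono (hs hI' hB)) ((swap_cont h.sol.wrc).mono (hs hI' hB))
      (fun s hs y hy => h.sol.dw y hy.1 s (hI' ⟨hs.1.le, hs.2⟩)) (t1 := 0) (t2 := x+1) ⟨hx, by linarith⟩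
  have hSW : ∀ x > 0, Sf n x * ∫ s in t0..t1, wr x s = Mf n u x t1 - Mf n u x t0 := fun x hx => by
    rw [← intervalIntegral.integral_const_mul]
    exact ftc h01.le (f := fun s => Mf n u x s) ((slice_t h.sol.Mc hx.le).mono hI')
      (fun s hs => h.sol.Mdt hx.le (hI' ⟨hs.1.le, hs.2.le⟩))
      (continuousOn_const.mul ((slice_t h.sol.wrc hx.le).mono hI'))
  have hWc : ContinuousOn W (Ioi 0) := fun x hx => (hWd x hx).continuousAt.continuousWithinAt
  have hbd : ∀ s ≥ r, W r ≤ (t1 - t0) * (C * Sf n s ^ (-(1/2):ℝ)) + D * η⁻¹ * Sf n r ^ (-η) := by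
    intro s hs
    have hs0 : 0 < s := by linarith
    have hsub : Icc r s ⊆ Ioi 0 := fun x hx => hr0.trans_le hx.1
    have hcS : ContinuousOn (fun x => Sf n x ^ (-η)) (Icc r s) := (Sf_rpow_cont n _).mono hsub
    have e1 := le_of_deriv_le hs (f := fun x => D * -∫ y in r..x, Sf n y ^ (-η)) (g := W)
      (f' := fun x => D * -(Sf n x ^ (-η))) (g' := fun x => ∫ s in t0..t1, wr x s) ?_ (hWc.mono hsub)
      (fun x hx => ?_) (fun x hx => hWd x (hr0.trans hx.1)) (fun x hx => ?_)
    · have e2 := mul_le_mul_of_nonneg_left (int_Sf_neg hn hη hr0 hs) hD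
      have e3 : W s ≤ (t1 - t0) * (C * Sf n s ^ (-(1/2):ℝ)) := by
        have := intervalIntegral.integral_mono_on (μ := volume) h01.le (ContinuousOn.intervalIntegrable
          (by rw [hu']; exact (slice_t (g := fun r t => u r t ^ m) h.sol.wc hs0.le).mono hI'))
          (intervalIntegrable_const (c := C * Sf n s ^ (-(1/2):ℝ))) (fun x hx => (hb x (hI hx)).2.1 s (by linarith))
        rwa [intervalIntegral.integral_const, smul_eq_mul] at this
      simp only [intervalIntegral.integral_same] at e1
      nlinarith
    · refine continuousOn_const.mul (ContinuousOn.neg ?_)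
      have := intervalIntegral.continuousOn_primitive_interval (a := r) (b := s) (μ := volume)
        (f := fun y => Sf n y ^ (-η)) (by rw [uIcc_of_le hs]; exact hcS.integrableOn_Icc)
      rwa [uIcc_of_le hs] at this
    · refine (HasDerivAt.neg ?_).const_mul D
      refine intervalIntegral.integral_hasDerivAt_right ?_ ?_ ?_
      · exact ContinuousOn.intervalIntegrable (hcS.mono (by rw [uIcc_of_le hx.1.le]; exact Icc_subset_Icc_right hx.2.le))
      · exact (Sf_rpow_cont n (-η)).stronglyMeasurableAtFilter isOpen_Ioi x (hr0.trans hx.1)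
      · exact (Sf_rpow_cont n (-η)).continuousAt (Ioi_mem_nhds (hr0.trans hx.1))
    · have hx0 := hr0.trans hx.1
      have hS := Sf_pos n hx0
      have e1 := hSW x hx0
      have e2 := hM x hx.1.le
      have e3 := h.sol.Mnn hx0.le (h.sub ht1)
      rw [show 1 - η = -η + 1 by ring, Real.rpow_add_one hS.ne'] at e2
      have : Sf n x * (D * -(Sf n x ^ (-η))) ≤ Sf n x * ∫ s in t0..t1, wr x s := by rw [e1]; nlinarith
      exact le_of_mul_le_mul_left this hS
  have hlim : W r ≤ D * η⁻¹ * Sf n r ^ (-η) := by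
    have : Tendsto (fun s => (t1 - t0) * (C * Sf n s ^ (-(1/2):ℝ)) + D * η⁻¹ * Sf n r ^ (-η)) atTop
        (𝓝 ((t1 - t0) * (C * 0) + D * η⁻¹ * Sf n r ^ (-η))) :=
      ((((tendsto_rpow_neg_atTop (by norm_num : (0:ℝ) < 1/2)).comp (Sf_tendsto hn)).const_mul C).const_mul _).add_const _
    simp only [mul_zero, zero_add] at this
    exact ge_of_tendsto this ((eventually_ge_atTop r).mono hbd)
  have e1 := intervalIntegral.integral_mono_on (μ := volume) h01.le (intervalIntegrable_const (c := u r t1 ^ m))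
    (ContinuousOn.intervalIntegrable (u := fun s => K * u r s ^ m)
      (by rw [hu']; exact continuousOn_const.mul ((slice_t (g := fun r t => u r t ^ m) h.sol.wc hr0.le).mono hI')))
    (fun s hs => h.bc2 r hr0.le s t1 (ht0.1.le.trans hs.1) hs.2 ht1.2)
  rw [intervalIntegral.integral_const, intervalIntegral.integral_const_mul, smul_eq_mul] at e1
  exact e1.trans (mul_le_mul_of_nonneg_left hlim h.hK.le)

lemma Ctx.wdec (h : Ctx n m a b T CB K u wr ut) {η : ℝ} (hη : 0 < η) (hP : PP n m b T u η) :
    ∃ b1 ∈ Ioo b T, ∃ C > 0, ∀ t ∈ Ioo b1 T, ∀ r ≥ 1, u r t ^ m ≤ C * Ef m T t ^ m * Sf n r ^ (-η) := by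
  obtain ⟨b1, hb1, C, hC, hM⟩ := hP
  have hK := h.hK
  refine ⟨(b1+T)/2, ⟨by linarith [hb1.1, hb1.2], by linarith [hb1.2]⟩, K * C * 2 ^ (1/(1-m)) * η⁻¹, by positivity,
    fun t ht r hr => ?_⟩
  have hθ : 0 < T - t := by linarith [ht.2]
  have ht0 : 2*t - T ∈ Ioo b1 T := ⟨by linarith [ht.1], by linarith⟩
  have e := h.Wlem (t0 := 2*t - T) (t1 := t) (D := C * Ef m T (2*t-T)) ⟨hb1.1.trans ht0.1, ht0.2⟩
    ⟨by linarith [ht.1, hb1.1, hb1.2], ht.2⟩ (by linarith) hη hr (mul_pos hC (Ef_pos ht0.2)).le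
    (fun x hx => hM _ ht0 x (by linarith))
  have e2 : Ef m T (2*t-T) = 2 ^ (1/(1-m)) * ((T - t) * Ef m T t ^ m) := by
    rw [Ef_mul h.sol.hm1 ht.2, Ef, Ef, ← Real.mul_rpow (by norm_num) hθ.le]; congr 1; ring
  rw [e2, show t - (2*t-T) = T - t by ring] at e
  refine le_of_mul_le_mul_left (e.trans (le_of_eq ?_)) hθ
  ring

lemma Ctx.udec (h : Ctx n m a b T CB K u wr ut) {η C t r : ℝ} (hC : 0 < C) (ht : t ∈ Ioo b T) (hr : 0 < r)
    (hw : u r t ^ m ≤ C * Ef m T t ^ m * Sf n r ^ (-η)) : u r t ≤ C ^ (1/m) * Ef m T t * Sf n r ^ (-(η/m)) := by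
  have hm0 := h.sol.hm0
  have hS := Sf_pos n hr
  have hE := Ef_pos (m := m) ht.2
  have h1 := Real.rpow_le_rpow (h.sol.wpos hr.le (h.sub ht)).le hw (by positivity : 0 ≤ 1/m)
  rw [Real.mul_rpow (by positivity) (by positivity), Real.mul_rpow hC.le (by positivity),
    ← Real.rpow_mul (h.sol.upos r hr.le t (h.sub ht)).le, ← Real.rpow_mul hE.le, ← Real.rpow_mul hS.le,
    mul_one_div_cancel hm0.ne', Real.rpow_one, Real.rpow_one] at h1
  convert h1 using 3; ring

lemma Ctx.pstep (h : Ctx n m a b T CB K u wr ut) {η η' : ℝ} (hη : 0 < η) (hP : PP n m b T u η)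
    (hη' : (η' ≤ η/m ∧ η' < 1) ∨ (η' = 1 ∧ 1 < η/m)) : PP n m b T u η' := by
  obtain ⟨b2, hb2, C2, hC2, hw⟩ := h.wdec hη hP
  obtain ⟨b1, hb1, C, hC, hM⟩ := hP
  have hn := h.sol.hn
  have hS1 := Sf_pos n one_pos
  have key : ∃ Q > 0, ∀ r ≥ 1, ∫ x in (1:ℝ)..r, Sf n x ^ (1 - η/m) ≤ Q * Sf n r ^ (1 - η') := by
    rcases hη' with ⟨h1, h2⟩ | ⟨h1, h2⟩
    · refine ⟨(1-η')⁻¹, inv_pos.2 (by linarith), fun r hr => ?_⟩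
      have hc : ∀ β : ℝ, IntervalIntegrable (fun x => Sf n x ^ β) volume 1 r := fun β =>
        ContinuousOn.intervalIntegrable ((Sf_rpow_cont n β).mono (by rw [uIcc_of_le hr]; exact fun x hx => one_pos.trans_le hx.1))
      refine le_trans ?_ (int_Sf_pos hn (by linarith) one_pos hr)
      exact intervalIntegral.integral_mono_on hr (hc _) (hc _) fun x hx =>
        Real.rpow_le_rpow_of_exponent_le (one_le_Sf n hx.1) (by linarith)
    · refine ⟨(η/m-1)⁻¹, inv_pos.2 (by linarith), fun r hr => ?_⟩
      have := int_Sf_neg hn (β := η/m-1) (by linarith) one_pos hr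
      rw [neg_sub] at this
      refine this.trans ?_
      rw [h1, sub_self, Real.rpow_zero]
      exact mul_le_mul_of_nonneg_left (Real.rpow_le_one_of_one_le_of_nonpos (one_le_Sf n le_rfl) (by linarith))
        (inv_pos.2 (by linarith)).le
  have hle : η' ≤ 1 := by rcases hη' with h1 | h1 <;> linarith [h1.1, h1.2]
  obtain ⟨Q, hQ, hint⟩ := key
  refine ⟨max b1 b2, ⟨lt_max_of_lt_left hb1.1, max_lt hb1.2 hb2.2⟩, C * Sf n 1 ^ (1-η) + C2 ^ (1/m) * Q, by positivity,
    fun t ht r hr => ?_⟩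
  have ht1 : t ∈ Ioo b1 T := ⟨(le_max_left _ _).trans_lt ht.1, ht.2⟩
  have ht2 : t ∈ Ioo b2 T := ⟨(le_max_right _ _).trans_lt ht.1, ht.2⟩
  have htb : t ∈ Ioo b T := ⟨hb1.1.trans ht1.1, ht.2⟩
  have hE := Ef_pos (m := m) ht.2
  have hS := Sf_pos n (by linarith : 0 < r)
  have e1 : Mf n u r t = Mf n u 1 t + ∫ x in (1:ℝ)..r, u x t * Sf n x :=
    (intervalIntegral.integral_add_adjacent_intervals (h.sol.uSi (h.sub htb) le_rfl zero_le_one)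
      (h.sol.uSi (h.sub htb) zero_le_one (by linarith))).symm
  have e2 : ∫ x in (1:ℝ)..r, u x t * Sf n x ≤ ∫ x in (1:ℝ)..r, C2 ^ (1/m) * Ef m T t * Sf n x ^ (1 - η/m) := by
    refine intervalIntegral.integral_mono_on hr (h.sol.uSi (h.sub htb) zero_le_one (by linarith)) ?_ fun x hx => ?_
    · exact (ContinuousOn.intervalIntegrable ((Sf_rpow_cont n _).mono
        (by rw [uIcc_of_le hr]; exact fun x hx => one_pos.trans_le hx.1))).const_mul _
    · have hx0 : 0 < x := by linarith [hx.1]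
      have hSx := Sf_pos n hx0
      have := h.udec hC2 htb hx0 (hw t ht2 x hx.1)
      rw [show 1 - η/m = -(η/m) + 1 by ring, Real.rpow_add_one hSx.ne', ← mul_assoc]
      exact mul_le_mul_of_nonneg_right this hSx.le
  rw [intervalIntegral.integral_const_mul] at e2
  have e3 := hM t ht1 1 le_rfl
  have e4 := mul_le_mul_of_nonneg_left (hint r hr) (by positivity : 0 ≤ C2 ^ (1/m) * Ef m T t)
  have e5 : 1 ≤ Sf n r ^ (1 - η') := Real.one_le_rpow (one_le_Sf n hr) (by linarith)
  have e6 : C * Ef m T t * Sf n 1 ^ (1-η) ≤ C * Ef m T t * Sf n 1 ^ (1-η) * Sf n r ^ (1 - η') :=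
    le_mul_of_one_le_right (by positivity) e5
  rw [e1]; linarith

lemma Ctx.pone (h : Ctx n m a b T CB K u wr ut) : PP n m b T u 1 := by
  have hm0 := h.sol.hm0
  have hm1 := h.sol.hm1
  have hn := h.sol.hn
  set l := Real.sqrt m with hl
  have hl0 : 0 < l := Real.sqrt_pos.2 hm0
  have hl2 : l * l = m := Real.mul_self_sqrt hm0.le
  have hl1 : l < 1 := by nlinarith
  have h0 : PP n m b T u (min (1/(1+m)) l) := by
    obtain ⟨b', hb', C, hC, c', hc', hE⟩ := h.energy
    refine ⟨b', hb', C, hC, fun t ht r hr => ((hE t ht).1 r (by linarith)).trans ?_⟩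
    refine mul_le_mul_of_nonneg_left ?_ (mul_pos hC (Ef_pos (m := m) ht.2)).le
    have h1 := one_le_Sf n hr
    refine (Real.rpow_le_rpow (Vf_nonneg n (by linarith)) (Vf_le' hn (by linarith)) (by positivity)).trans ?_
    refine Real.rpow_le_rpow_of_exponent_le h1 ?_
    have : min (1/(1+m)) l ≤ 1/(1+m) := min_le_left _ _
    have e : m/(1+m) = 1 - 1/(1+m) := by field_simp; ring
    linarith
  obtain ⟨g, hg⟩ : ∃ g, g = 1/(1+m) := ⟨_, rfl⟩
  have hg0 : 0 < g := by rw [hg]; positivity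
  rw [← hg] at h0
  have hi : ∀ i : ℕ, PP n m b T u (min (g / l^i) l) := by
    intro i
    induction i with
    | zero => simpa using h0
    | succ i ih =>
      have hp : 0 < min (g / l^i) l := by positivity
      refine h.pstep hp ih (Or.inl ⟨?_, (min_le_right _ _).trans_lt hl1⟩)
      rw [le_div_iff₀ hm0, ← hl2]
      refine le_min ?_ ?_
      · have : min (g / l^(i+1)) l ≤ g / l^(i+1) := min_le_left _ _
        calc _ ≤ g / l^(i+1) * (l * l) := by gcongr
          _ = g / l^i * l := by field_simp; ring
          _ ≤ _ := mul_le_of_le_one_right (by positivity) hl1.le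
      · have : min (g / l^(i+1)) l ≤ l := min_le_right _ _
        nlinarith
  obtain ⟨i, hi'⟩ := exists_pow_lt_of_lt_one (hg0) hl1
  have h2 : min (g / l^i) l = l := min_eq_right (by
    rw [le_div_iff₀ (by positivity)]; nlinarith [pow_pos hl0 i])
  have h3 := hi i
  rw [h2] at h3
  refine h.pstep hl0 h3 (Or.inr ⟨rfl, ?_⟩)
  rw [lt_div_iff₀ hm0]; nlinarith

end

section
variable {n : ℕ} {m a b T CB K : ℝ} {u wr ut : ℝ → ℝ → ℝ}

set_option maxHeartbeats 1000000 in
lemma Ctx.bounds (h : Ctx n m a b T CB K u wr ut) : ∃ b1 ∈ Ioo b T, ∃ R ≥ 1, ∃ c > 0, ∃ C > 0, ∃ c0 > 0, ∃ C0 > 0,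
    ∀ t ∈ Ioo b1 T, ∀ r ≥ R, c * Ef m T t ^ m * (Sf n r)⁻¹ ≤ u r t ^ m ∧ u r t ^ m ≤ C * Ef m T t ^ m * (Sf n r)⁻¹ ∧
      -C0 * u r t ^ m ≤ wr r t ∧ wr r t ≤ -c0 * u r t ^ m := by
  have hm0 := h.sol.hm0
  have hm1 := h.sol.hm1
  have hn := h.sol.hn
  have hCB := h.hCB
  obtain ⟨b2, hb2, C, hC, hw⟩ := h.wdec one_pos h.pone
  obtain ⟨b3, hb3, D, hD, hM⟩ := h.pone
  obtain ⟨b4, hb4, ρ, hρ, R0, hR0, c1, hc1, hmid⟩ := h.umid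
  obtain ⟨Y, cY, hcY, hYd, hYl, hYp, hYu, hYlo⟩ := exists_Y hn
  have hSρ := Sf_pos n hρ
  obtain ⟨Δ, hΔ1, hΔ0⟩ : ∃ Δ : ℝ, 4 * C / (c1^m * Sf n ρ * cY) ≤ Real.exp (n * Δ) ∧ 0 ≤ Δ := by
    have : Tendsto (fun Δ : ℝ => Real.exp (n * Δ)) atTop atTop :=
      Real.tendsto_exp_atTop.comp (tendsto_id.const_mul_atTop (by exact_mod_cast hn))
    exact ((this.eventually_ge_atTop _).and (eventually_ge_atTop 0)).exists
  set c := c1^m / 2 * Sf n ρ * cY with hc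
  have hc0 : 0 < c := by positivity
  obtain ⟨δ, hδ0, hδ1, hδ2⟩ : ∃ δ > 0, 2 * (CB * D * δ) * (Sf n ρ)⁻¹ ≤ c1^m/2 ∧ CB * D * δ ≤ c/4 := by
    refine ⟨min (c1^m/2 * Sf n ρ / (2*CB*D)) (c/4/(CB*D)), by positivity, ?_, ?_⟩
    · have e := min_le_left (c1^m/2 * Sf n ρ / (2*CB*D)) (c/4/(CB*D))
      rw [le_div_iff₀ (by positivity)] at e
      rw [← div_eq_mul_inv, div_le_iff₀ hSρ]; linarith
    · have e := min_le_right (c1^m/2 * Sf n ρ / (2*CB*D)) (c/4/(CB*D))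
      rw [le_div_iff₀ (by positivity)] at e
      linarith
  set R1 := max R0 1
  refine ⟨max (max b2 b3) (max b4 (T-δ)), ⟨lt_max_of_lt_left (lt_max_of_lt_left hb2.1),
    max_lt (max_lt hb2.2 hb3.2) (max_lt hb4.2 (by linarith))⟩, R1 + Δ, by have := le_max_right R0 1; linarith,
    c, hc0, C, hC, c/4/C, by positivity, 1/cY + 1, by positivity, fun t ht => ?_⟩
  have ht2 : t ∈ Ioo b2 T := ⟨((le_max_left _ _).trans (le_max_left _ _)).trans_lt ht.1, ht.2⟩
  have ht3 : t ∈ Ioo b3 T := ⟨((le_max_right _ _).trans (le_max_left _ _)).trans_lt ht.1, ht.2⟩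
  have ht4 : t ∈ Ioo b4 T := ⟨((le_max_left _ _).trans (le_max_right _ _)).trans_lt ht.1, ht.2⟩
  have htδ : T - t ≤ δ := by
    have := ((le_max_right b4 (T-δ)).trans (le_max_right (max b2 b3) _)).trans_lt ht.1; linarith
  have htb : t ∈ Ioo b T := ⟨hb2.1.trans ht2.1, ht.2⟩
  have hta := h.sub htb
  have hE := Ef_pos (m := m) ht.2
  have hEm : 0 < Ef m T t ^ m := by positivity
  have hEE := Ef_mul hm1 ht.2
  set e := CB * D * Ef m T t with he
  have he0 : 0 < e := by positivity
  have hed : e ≤ CB * D * δ * Ef m T t ^ m := by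
    have := mul_le_mul_of_nonneg_right htδ hEm.le
    calc e = CB * D * ((T - t) * Ef m T t ^ m) := by rw [hEE]
      _ ≤ CB * D * (δ * Ef m T t ^ m) := by gcongr
      _ = _ := by ring
  have hF : ∀ x s, 0 < x → x ≤ s → Sf n s * wr s t ≤ Sf n x * wr x t + e := by
    intro x s hx hs
    have e1 := h.Fle2 hx hs htb
    have e2 := h.sol.Mnn hx.le hta
    have e3 : Mf n u s t ≤ D * Ef m T t := by
      have f1 := h.sol.Mmono (hx.le.trans hs) (le_max_left s 1) hta
      have f2 := hM t ht3 (max s 1) (le_max_right _ _)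
      simp only [sub_self, Real.rpow_zero, mul_one] at f2
      exact f1.trans f2
    have e4 := mul_le_mul_of_nonneg_left e3 hCB.le
    linarith [mul_nonneg hCB.le e2]
  have hwd : ∀ x > 0, HasDerivAt (fun r => u r t ^ m) (wr x t) x := fun x hx => h.sol.dw x hx t hta
  have hYm : ∀ x s, 0 < x → x ≤ s → Y s ≤ Y x := by
    intro x s hx hs
    have := mono_of_deriv hs (f := fun x => -Y x) (f' := fun x => (Sf n x)⁻¹)
      (fun y hy => (hYd y (hx.trans_le hy.1)).neg.continuousAt.continuousWithinAt)
      (fun y hy => (hYd y (hx.trans hy.1)).neg.congr_deriv (by simp)) (fun y hy => (inv_pos.2 (Sf_pos n (hx.trans hy.1))).le)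
    linarith
  have A1 : ∀ x s, 0 < x → x ≤ s → u x t ^ m - u s t ^ m ≤ (-(Sf n s * wr s t) + e) * (Y x - Y s) := by
    intro x s hx hs
    have := le_of_deriv_le hs (f := fun x => -(u x t ^ m)) (f' := fun x => -(wr x t))
      (g := fun x => (-(Sf n s * wr s t) + e) * (-Y x)) (g' := fun x => (-(Sf n s * wr s t) + e) * (-(-(Sf n x)⁻¹)))
      (fun y hy => (hwd y (hx.trans_le hy.1)).neg.continuousAt.continuousWithinAt)
      (fun y hy => ((hYd y (hx.trans_le hy.1)).neg.const_mul _).continuousAt.continuousWithinAt)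
      (fun y hy => (hwd y (hx.trans hy.1)).neg) (fun y hy => (hYd y (hx.trans hy.1)).neg.const_mul _)
      (fun y hy => by
        have hS := Sf_pos n (hx.trans hy.1)
        have := hF y s (hx.trans hy.1) hy.2.le
        rw [neg_neg, ← div_eq_mul_inv, le_div_iff₀ hS]; linarith)
    linarith
  have A2 : ∀ x s, 0 < x → x ≤ s → -(Sf n x * wr x t + e) * (Y x - Y s) ≤ u x t ^ m - u s t ^ m := by
    intro x s hx hs
    have := le_of_deriv_le hs (g := fun x => -(u x t ^ m)) (g' := fun x => -(wr x t))
      (f := fun z => -(Sf n x * wr x t + e) * (-Y z)) (f' := fun z => -(Sf n x * wr x t + e) * (-(-(Sf n z)⁻¹)))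
      (fun y hy => ((hYd y (hx.trans_le hy.1)).neg.const_mul _).continuousAt.continuousWithinAt)
      (fun y hy => (hwd y (hx.trans_le hy.1)).neg.continuousAt.continuousWithinAt)
      (fun y hy => (hYd y (hx.trans hy.1)).neg.const_mul _) (fun y hy => (hwd y (hx.trans hy.1)).neg)
      (fun y hy => by
        have hS := Sf_pos n (hx.trans hy.1)
        have := hF x y hx hy.1.le
        rw [neg_neg, ← div_eq_mul_inv, div_le_iff₀ hS]; linarith)
    linarith
  have A3 : ∀ x > 0, -(Sf n x * wr x t + e) * Y x ≤ u x t ^ m := by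
    intro x hx
    have l1 : Tendsto (fun s => -(Sf n x * wr x t + e) * (Y x - Y s)) atTop (𝓝 (-(Sf n x * wr x t + e) * (Y x - 0))) :=
      (tendsto_const_nhds.sub hYl).const_mul _
    rw [sub_zero] at l1
    refine le_of_tendsto l1 ((eventually_ge_atTop x).mono fun s hs => (A2 x s hx hs).trans ?_)
    have := (h.sol.wpos (hx.le.trans hs) hta).le
    linarith
  have low : ∀ r ≥ R1, c * Ef m T t ^ m * (Sf n r)⁻¹ ≤ u r t ^ m := by
    intro r hr
    have hr1 : 1 ≤ r := (le_max_right _ _).trans hr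
    have hr0 : 0 < r := by linarith
    obtain ⟨x, hx, hux⟩ := hmid t ht4
    have hx0 : 0 < x := hρ.trans_le hx.1
    have hxr : x ≤ r := hx.2.trans ((le_max_left _ _).trans hr)
    have e1 : c1^m * Ef m T t ^ m ≤ u x t ^ m := by
      rw [← Real.mul_rpow hc1.le hE.le]; exact Real.rpow_le_rpow (by positivity) hux hm0.le
    have e2 := A1 x r hx0 hxr
    have e3 := A3 r hr0
    have hYr := hYp r hr0
    have hYx := hYp x hx0
    have hYxr := hYm x r hx0 hxr
    have e4 : u x t ^ m * Y r ≤ u r t ^ m * Y x + 2 * e * Y x * Y r := by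
      have f1 := mul_le_mul_of_nonneg_right e2 hYr.le
      have f2 := mul_le_mul_of_nonneg_right e3 (sub_nonneg.2 hYxr)
      linarith [mul_pos he0 (mul_pos hYr hYr)]
    have e5 : Y x ≤ (Sf n ρ)⁻¹ := (hYu x hx0).trans (inv_anti₀ hSρ (Sf_mono n hρ.le hx.1))
    have e6 : 2 * e * Y x ≤ c1^m/2 * Ef m T t ^ m := by
      calc 2 * e * Y x ≤ 2 * (CB * D * δ * Ef m T t ^ m) * (Sf n ρ)⁻¹ := by gcongr
        _ = 2 * (CB * D * δ) * (Sf n ρ)⁻¹ * Ef m T t ^ m := by ring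
        _ ≤ _ := by gcongr
    have e7 : c1^m/2 * Ef m T t ^ m * Y r ≤ u r t ^ m * (Sf n ρ)⁻¹ := by
      have f1 := mul_le_mul_of_nonneg_right e6 hYr.le
      have f2 := mul_le_mul_of_nonneg_right e1 hYr.le
      have f3 := mul_le_mul_of_nonneg_left e5 (h.sol.wpos hr0.le hta).le
      linarith
    rw [← div_eq_mul_inv _ (Sf n ρ), le_div_iff₀ hSρ] at e7
    have e8 := hYlo r hr1
    calc _ = c1^m/2 * Ef m T t ^ m * (cY * (Sf n r)⁻¹) * Sf n ρ := by rw [hc]; ring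
      _ ≤ c1^m/2 * Ef m T t ^ m * Y r * Sf n ρ := by gcongr
      _ ≤ _ := e7
  have up : ∀ r ≥ 1, u r t ^ m ≤ C * Ef m T t ^ m * (Sf n r)⁻¹ := fun r hr => by
    have := hw t ht2 r hr
    rwa [Real.rpow_neg_one] at this
  intro r hr
  have hrR : R1 ≤ r := by linarith
  have hr1 : 1 ≤ r := (le_max_right _ _).trans hrR
  have hr0 : 0 < r := by linarith
  have hS := Sf_pos n hr0
  refine ⟨low r hrR, up r hr1, ?_, ?_⟩
  · have e1 := A3 r hr0
    have e2 := hYlo r hr1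
    have e3 := low r hrR
    have hw0 := h.sol.wpos hr0.le hta
    rw [← div_eq_mul_inv] at e2 e3
    rw [div_le_iff₀ hS] at e2 e3
    have e4 : e ≤ u r t ^ m * Sf n r := by
      refine le_trans (hed.trans ?_) e3
      gcongr; linarith
    have e5 : -(Sf n r * wr r t + e) ≤ u r t ^ m * Sf n r / cY := by
      rcases le_or_gt (-(Sf n r * wr r t + e)) 0 with hneg | hpos
      · exact hneg.trans (by positivity)
      · rw [le_div_iff₀ hcY]
        have f1 := mul_le_mul_of_nonneg_left e2 hpos.le
        have f2 := mul_le_mul_of_nonneg_right e1 hS.le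
        linarith
    have : Sf n r * (-(1/cY+1) * u r t ^ m) ≤ Sf n r * wr r t := by
      have : Sf n r * (-(1/cY+1) * u r t ^ m) = -(u r t ^ m * Sf n r / cY) - u r t ^ m * Sf n r := by ring
      linarith
    exact le_of_mul_le_mul_left this hS
  · have hx1 : R1 ≤ r - Δ := by linarith
    have hx0 : 0 < r - Δ := lt_of_lt_of_le one_pos ((le_max_right _ _).trans hx1)
    have hSx := Sf_pos n hx0
    have e1 := A1 (r - Δ) r hx0 (by linarith)
    have e2 := low _ hx1
    have e3 := up r hr1
    have e4 := Sf_add n hx0.le hΔ0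
    rw [sub_add_cancel] at e4
    have e5 : 2 * C / c * Sf n (r - Δ) ≤ Sf n r := by
      refine le_trans (mul_le_mul_of_nonneg_right ?_ hSx.le) e4
      refine le_trans (le_of_eq ?_) hΔ1
      rw [hc]; field_simp; ring
    have e6 : C * Ef m T t ^ m * (Sf n r)⁻¹ ≤ c/2 * Ef m T t ^ m * (Sf n (r-Δ))⁻¹ := by
      rw [← div_eq_mul_inv, ← div_eq_mul_inv, div_le_div_iff₀ hS hSx]
      rw [div_mul_eq_mul_div, div_le_iff₀ hc0] at e5
      linarith [mul_le_mul_of_nonneg_left e5 hEm.le]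
    have e7 : c/2 * Ef m T t ^ m * (Sf n (r-Δ))⁻¹ ≤ (-(Sf n r * wr r t) + e) * (Y (r-Δ) - Y r) := by linarith
    have hYd0 := hYm (r-Δ) r hx0 (by linarith)
    have hpos : 0 < -(Sf n r * wr r t) + e := by
      by_contra! hneg
      have : 0 < c/2 * Ef m T t ^ m * (Sf n (r-Δ))⁻¹ := by positivity
      linarith [mul_nonneg_of_nonpos_of_nonpos hneg (sub_nonpos.2 hYd0)]
    have e8 : Y (r-Δ) - Y r ≤ (Sf n (r-Δ))⁻¹ := by linarith [hYu _ hx0, hYp r hr0]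
    have e9 := le_of_mul_le_mul_right (e7.trans (mul_le_mul_of_nonneg_left e8 hpos.le)) (inv_pos.2 hSx)
    have e10 : e ≤ c/4 * Ef m T t ^ m := hed.trans (by gcongr)
    rw [← div_eq_mul_inv, le_div_iff₀ hS] at e3
    have e11 : c/4/C * (u r t ^ m * Sf n r) ≤ c/4 * Ef m T t ^ m := by
      refine (mul_le_mul_of_nonneg_left e3 (by positivity)).trans (le_of_eq ?_); field_simp
    have : Sf n r * wr r t ≤ Sf n r * (-(c/4/C) * u r t ^ m) := by linarith
    exact le_of_mul_le_mul_left this hS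

end

lemma pmax {P Pr Prr Pt : ℝ → ℝ → ℝ} {ra rb ta tb x y : ℝ}
    (hc : ContinuousOn (fun p : ℝ × ℝ => P p.1 p.2) (Icc ra rb ×ˢ Icc ta tb))
    (h1 : ∀ r ∈ Ioo ra rb, ∀ t ∈ Icc ta tb, HasDerivAt (fun ρ => P ρ t) (Pr r t) r)
    (h2 : ∀ r ∈ Ioo ra rb, ∀ t ∈ Icc ta tb, HasDerivAt (fun ρ => Pr ρ t) (Prr r t) r)
    (h3 : ∀ r ∈ Ioo ra rb, ∀ t ∈ Icc ta tb, HasDerivAt (fun τ => P r τ) (Pt r t) t)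
    (hx : x ∈ Icc ra rb) (hy : y ∈ Icc ta tb)
    (ha : ∀ t ∈ Icc ta tb, P ra t ≤ 0) (hb : ∀ t ∈ Icc ta tb, P rb t ≤ 0)
    (h0 : ∀ r ∈ Icc ra rb, P r ta ≤ 0) (hpos : 0 < P x y) :
    ∃ r ∈ Ioo ra rb, ∃ t ∈ Ioc ta tb, P x y ≤ P r t ∧ Pr r t = 0 ∧ Prr r t ≤ 0 ∧ 0 ≤ Pt r t := by
  obtain ⟨⟨r, t⟩, ⟨hr, ht⟩, hmax⟩ := (isCompact_Icc.prod isCompact_Icc).exists_isMaxOn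
    ⟨(x, y), show (x, y) ∈ Icc ra rb ×ˢ Icc ta tb from ⟨hx, hy⟩⟩ hc
  have hM : ∀ r' ∈ Icc ra rb, ∀ t' ∈ Icc ta tb, P r' t' ≤ P r t := fun r' h t' h' =>
    hmax (show (r', t') ∈ _ from ⟨h, h'⟩)
  dsimp only at hr ht
  have hp : 0 < P r t := hpos.trans_le (hM x hx y hy)
  have hr' : r ∈ Ioo ra rb := by
    refine ⟨lt_of_le_of_ne hr.1 ?_, lt_of_le_of_ne hr.2 ?_⟩
    · rintro rfl; linarith [ha t ht]
    · rintro rfl; linarith [hb t ht]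
  have ht' : t ∈ Ioc ta tb := by
    refine ⟨lt_of_le_of_ne ht.1 ?_, ht.2⟩
    rintro rfl; linarith [h0 r hr]
  have hloc : IsLocalMax (fun ρ => P ρ t) r := by
    filter_upwards [Ioo_mem_nhds hr'.1 hr'.2] with ρ hρ
    exact hM ρ (Ioo_subset_Icc_self hρ) t ht
  have := max_second hloc (f' := fun ρ => Pr ρ t) (by
    filter_upwards [Ioo_mem_nhds hr'.1 hr'.2] with ρ hρ
    exact h1 ρ hρ t ht) (h2 r hr' t ht)
  exact ⟨r, hr', t, ht', hM x hx y hy, this.1, this.2,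
    max_left ht'.1 (fun s hs => hM r hr s ⟨hs.1, hs.2.trans ht.2⟩) (h3 r hr' t ht)⟩

lemma barrier {v v1 v2 vt A K G h : ℝ → ℝ → ℝ} {R1 X r0 ta t0 α η D g K0 A0 : ℝ}
    (hα : 0 < α) (hη : 0 < η) (hD : 0 < D) (hg : 0 < g) (hA0 : 0 < A0) (hX0 : 0 < X)
    (hαg : α ^ 2 + K0 * α ≤ g / 2) (hX : D ≤ η / 4 * Real.exp (α * X)) (hr0 : R1 + X ≤ r0)
    (hta : ta < t0) (hZ : D * Real.exp (-(g * A0 * (t0 - ta))) ≤ η / 4)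
    (hc : ContinuousOn (fun p : ℝ × ℝ => v p.1 p.2) (Icc R1 (r0 + X) ×ˢ Icc ta t0))
    (h1 : ∀ r ∈ Icc R1 (r0 + X), ∀ t ∈ Icc ta t0, HasDerivAt (fun ρ => v ρ t) (v1 r t) r)
    (h2 : ∀ r ∈ Icc R1 (r0 + X), ∀ t ∈ Icc ta t0, HasDerivAt (fun ρ => v1 ρ t) (v2 r t) r)
    (h3 : ∀ r ∈ Icc R1 (r0 + X), ∀ t ∈ Icc ta t0, HasDerivAt (fun τ => v r τ) (vt r t) t)
    (heq : ∀ r ∈ Icc R1 (r0 + X), ∀ t ∈ Icc ta t0,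
      vt r t = A r t * (v2 r t + K r t * v1 r t - G r t * v r t + h r t))
    (hbd : ∀ r ∈ Icc R1 (r0 + X), ∀ t ∈ Icc ta t0,
      v r t ≤ D ∧ A0 ≤ A r t ∧ |K r t| ≤ K0 ∧ g ≤ G r t ∧ h r t ≤ g * η / 8) :
    v r0 t0 ≤ η := by
  by_contra hcon
  push Not at hcon
  set e1 : ℝ → ℝ := fun r => D * Real.exp (-(α * (r - R1)))
  set e2 : ℝ → ℝ := fun r => η / 4 * Real.exp (α * (r - r0))
  set Z : ℝ → ℝ := fun t => D * Real.exp (-(g * A0 * (t - ta)))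
  have de1 : ∀ r, HasDerivAt e1 (-α * e1 r) r := fun r => by
    have := ((((hasDerivAt_id r).sub_const R1).const_mul α).fun_neg.exp).const_mul D
    exact this.congr_deriv (by simp only [e1, id]; ring)
  have de2 : ∀ r, HasDerivAt e2 (α * e2 r) r := fun r => by
    have := ((((hasDerivAt_id r).sub_const r0).const_mul α).exp).const_mul (η / 4)
    exact this.congr_deriv (by simp only [e2, id]; ring)
  have dZ : ∀ t, HasDerivAt Z (-(g * A0) * Z t) t := fun t => by
    have := ((((hasDerivAt_id t).sub_const ta).const_mul (g * A0)).fun_neg.exp).const_mul D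
    exact this.congr_deriv (by simp only [Z, id]; ring)
  have pe1 : ∀ r, 0 < e1 r := fun r => by positivity
  have pe2 : ∀ r, 0 < e2 r := fun r => by positivity
  have pZ : ∀ r, 0 < Z r := fun r => by positivity
  have a1 : e1 r0 ≤ η / 4 := by
    have : e1 r0 * Real.exp (α * X) ≤ D := by
      simp only [e1]; rw [mul_assoc, ← Real.exp_add]
      refine mul_le_of_le_one_right hD.le (Real.exp_le_one_iff.2 ?_)
      have := mul_le_mul_of_nonneg_left hr0 hα.le
      linarith
    exact le_of_mul_le_mul_right (this.trans hX) (Real.exp_pos _)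
  obtain ⟨r, hr, t, ht, hle, c1, c2, c3⟩ := pmax
    (P := fun r t => v r t - (η / 4 + e1 r + e2 r + Z t))
    (Pr := fun r t => v1 r t - (-α * e1 r + α * e2 r))
    (Prr := fun r t => v2 r t - (-α * (-α * e1 r) + α * (α * e2 r)))
    (Pt := fun r t => vt r t - (-(g * A0) * Z t))
    (ra := R1) (rb := r0 + X) (ta := ta) (tb := t0) (x := r0) (y := t0)
    (by
      refine hc.sub (Continuous.continuousOn ?_)
      have a1 : Continuous e1 := by fun_prop
      have a2 : Continuous e2 := by fun_prop
      have a3 : Continuous Z := by fun_prop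
      fun_prop)
    (fun r hr t ht => by
      have := (((de1 r).const_add (η / 4)).add (de2 r)).add_const (Z t)
      exact (h1 r (Ioo_subset_Icc_self hr) t ht).sub this)
    (fun r hr t ht => (h2 r (Ioo_subset_Icc_self hr) t ht).sub
      (((de1 r).const_mul (-α)).add ((de2 r).const_mul α)))
    (fun r hr t ht => by
      have := (dZ t).const_add (η / 4 + e1 r + e2 r)
      exact (h3 r (Ioo_subset_Icc_self hr) t ht).sub this)
    ⟨by linarith, by linarith⟩ ⟨hta.le, le_rfl⟩
    (fun t ht => by
      have a := (hbd R1 ⟨le_rfl, by linarith⟩ t ht).1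
      have b : e1 R1 = D := by simp [e1]
      have := pe2 R1; have := pZ t
      linarith)
    (fun t ht => by
      have a := (hbd (r0 + X) ⟨by linarith, le_rfl⟩ t ht).1
      have b : e2 (r0 + X) = η / 4 * Real.exp (α * X) := by simp [e2]
      have := pe1 (r0 + X); have := pZ t
      linarith)
    (fun r hr => by
      have a := (hbd r hr ta ⟨le_rfl, hta.le⟩).1
      have b : Z ta = D := by simp [Z]
      have := pe1 r; have := pe2 r
      linarith)
    (by
      have a2 : e2 r0 = η / 4 := by simp [e2]
      linarith)
  have hrI := Ioo_subset_Icc_self hr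
  have htI := Ioc_subset_Icc_self ht
  obtain ⟨b1, b2, b3, b4, b5⟩ := hbd r hrI t htI
  have hv : η / 4 + e1 r + e2 r + Z t ≤ v r t := by
    by_contra hh; push Not at hh
    have : 0 < v r0 t0 - (η / 4 + e1 r0 + e2 r0 + Z t0) := by
      have a2 : e2 r0 = η / 4 := by simp [e2]
      linarith
    linarith
  have q1 := pe1 r
  have q2 := pe2 r
  have q3 := pZ t
  have hGv : g * (η / 4 + e1 r + e2 r + Z t) ≤ G r t * v r t :=
    mul_le_mul b4 hv (by positivity) (hg.le.trans b4)
  have hKv : K r t * v1 r t ≤ K0 * (α * (e1 r + e2 r)) := by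
    refine (le_abs_self _).trans ?_
    rw [abs_mul]
    refine mul_le_mul b3 ?_ (abs_nonneg _) ((abs_nonneg _).trans b3)
    have : v1 r t = α * (e2 r - e1 r) := by linarith
    rw [this, abs_mul, abs_of_pos hα]
    refine mul_le_mul_of_nonneg_left (abs_le.2 ⟨by linarith, by linarith⟩) hα.le
  have hin : v2 r t + K r t * v1 r t - G r t * v r t + h r t < -(g * Z t) := by
    have h5 := mul_le_mul_of_nonneg_right hαg (by positivity : 0 ≤ e1 r + e2 r)
    have : 0 < g * (e1 r + e2 r) := by positivity
    have : 0 < g * η := by positivity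
    linarith
  have hlt : vt r t < A r t * (-(g * Z t)) := by
    rw [heq r hrI t htI]
    exact mul_lt_mul_of_pos_left hin (hA0.trans_le b2)
  have := mul_le_mul_of_nonneg_right b2 (by positivity : 0 ≤ g * Z t)
  linarith

/-- the limit filter -/
noncomputable def LL (T : ℝ) : Filter (ℝ × ℝ) := atTop ×ˢ 𝓝[<] T

lemma LL_iff {T : ℝ} (hT : 0 < T) {P : ℝ × ℝ → Prop} :
    (∀ᶠ p in LL T, P p) ↔ ∃ R ≥ 1, ∃ t1 ∈ Ioo 0 T, ∀ r ≥ R, ∀ t ∈ Ioo t1 T, P (r, t) := by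
  constructor
  · intro h
    obtain ⟨U, hU, V, hV, hUV⟩ := Filter.mem_prod_iff.1 h
    obtain ⟨R, hR⟩ := mem_atTop_sets.1 hU
    obtain ⟨s, hs, hsV⟩ := (mem_nhdsLT_iff_exists_Ioo_subset' (a := T) hT).1 hV
    refine ⟨max R 1, le_max_right _ _, (max s 0 + T) / 2, ⟨?_, ?_⟩, fun r hr t ht => ?_⟩
    · have := le_max_right s 0; linarith
    · have : max s 0 < T := max_lt hs hT
      linarith
    · refine hUV (show (r, t) ∈ U ×ˢ V from ⟨hR r ((le_max_left _ _).trans hr), hsV ⟨?_, ht.2⟩⟩)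
      have := le_max_left s 0
      have : max s 0 < T := max_lt hs hT
      linarith [ht.1]
  · rintro ⟨R, -, t1, ht1, h⟩
    exact Filter.mem_prod_iff.2 ⟨Ici R, Ici_mem_atTop R, Ioo t1 T, Ioo_mem_nhdsLT ht1.2,
      fun p hp => h p.1 hp.1 p.2 hp.2⟩

/-- logarithmic derivative hierarchy -/
structure Lg (n : ℕ) (μ T : ℝ) (f : ℕ → ℝ → ℝ → ℝ) (A : ℝ → ℝ → ℝ) : Prop where
  hn : 1 ≤ n
  hμ : 0 < μ
  hT : 0 < T
  sm : ∀ k, Sm T (f k)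
  fs : ∀ k, f (k + 1) = Dr (f k)
  Ar : ∀ r > 0, ∀ t ∈ Ioo 0 T, HasDerivAt (fun ρ => A ρ t) (-μ * f 0 r t * A r t) r
  pde : ∀ r > 0, ∀ t ∈ Ioo 0 T, Dt (f 0) r t = A r t * (f 2 r t + ((2 - μ) * f 0 r t + bf n r) * f 1 r t
    + (-μ * f 0 r t ^ 2 * (f 0 r t + bf n r) + ((n:ℝ) - bf n r ^ 2 / n) * f 0 r t))
  fb : ∃ c0 > 0, ∃ C0 > 0, ∀ᶠ p in LL T, -C0 ≤ f 0 p.1 p.2 ∧ f 0 p.1 p.2 ≤ -c0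
  Ab : ∃ c > 0, ∀ᶠ p in LL T, c * Sf n p.1 ^ μ / (T - p.2) ≤ A p.1 p.2

lemma Lg.dr {n : ℕ} {μ T : ℝ} {f : ℕ → ℝ → ℝ → ℝ} {A : ℝ → ℝ → ℝ} (h : Lg n μ T f A) (k : ℕ) {r t : ℝ}
    (hr : 0 < r) (ht : t ∈ Ioo 0 T) : HasDerivAt (fun ρ => f k ρ t) (f (k + 1) r t) r := by
  rw [h.fs]; exact (h.sm k).hasDr hr ht

section
variable {N : ℕ} {m T : ℝ} {u : ℝ → ℝ → ℝ}

/-- derivatives of the log pressure -/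
noncomputable def ff (m : ℝ) (u : ℝ → ℝ → ℝ) (k : ℕ) : ℝ → ℝ → ℝ :=
  Dr^[k + 1] (fun r t => m * Real.log (u r t))

lemma ff_succ (m : ℝ) (u : ℝ → ℝ → ℝ) (k : ℕ) : ff m u (k + 1) = Dr (ff m u k) := by
  simp only [ff]; rw [Function.iterate_succ_apply' Dr (k + 1)]

lemma mk_pde (hN : 2 ≤ N) (hm0 : 0 < m) (hu : IsRadialEnergySolution N m T u) :
    (∀ k, Sm T (ff m u k)) ∧
    (∀ r > 0, ∀ t ∈ Ioo 0 T, HasDerivAt (fun ρ => u ρ t) (ff m u 0 r t / m * u r t) r) ∧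
    (∀ r > 0, ∀ t ∈ Ioo 0 T, HasDerivAt (fun ρ => m * u ρ t ^ (m - 1))
      (-(1 / m - 1) * ff m u 0 r t * (m * u r t ^ (m - 1))) r) ∧
    (∀ r > 0, ∀ t ∈ Ioo 0 T, Dt (ff m u 0) r t = m * u r t ^ (m - 1) *
      (ff m u 2 r t + ((2 - (1 / m - 1)) * ff m u 0 r t + bf (N - 1) r) * ff m u 1 r t
      + (-(1 / m - 1) * ff m u 0 r t ^ 2 * (ff m u 0 r t + bf (N - 1) r) +
        (((N - 1 : ℕ):ℝ) - bf (N - 1) r ^ 2 / ((N - 1 : ℕ):ℝ)) * ff m u 0 r t))) := by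
  set p : ℝ → ℝ → ℝ := fun r t => m * Real.log (u r t) with hpdef
  have hp : Sm T p := contDiffOn_const.mul (hu.smU.log fun q hq => (hu.pos q.1 (mem_Ici.2 (le_of_lt hq.1)) q.2 hq.2).ne')
  have hf0 : ff m u 0 = Dr p := rfl
  have hf1 : ff m u 1 = Dr (ff m u 0) := rfl
  have hf2 : ff m u 2 = Dr (ff m u 1) := rfl
  have sm : ∀ k, Sm T (ff m u k) := by
    intro k
    induction k with
    | zero => exact hp.Dr
    | succ k ih => rw [ff_succ]; exact ih.Dr
  have up : ∀ r > 0, ∀ t ∈ Ioo 0 T, 0 < u r t := fun r hr t ht => hu.pos r (le_of_lt hr) t ht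
  have dur : ∀ r > 0, ∀ t ∈ Ioo 0 T, HasDerivAt (fun ρ => u ρ t) (ff m u 0 r t / m * u r t) r := by
    intro r hr t ht
    have h1 := hu.smU.hasDr hr ht
    have h2 : HasDerivAt (fun ρ => p ρ t) (m * (Dr u r t / u r t)) r :=
      (h1.log (up r hr t ht).ne').const_mul m
    refine h1.congr_deriv ?_
    have : ff m u 0 r t = m * (Dr u r t / u r t) := h2.deriv
    have := (up r hr t ht).ne'
    rw [‹ff m u 0 r t = _›]; field_simp
  have dA : ∀ r > 0, ∀ t ∈ Ioo 0 T, HasDerivAt (fun ρ => m * u ρ t ^ (m - 1))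
      (-(1 / m - 1) * ff m u 0 r t * (m * u r t ^ (m - 1))) r := by
    intro r hr t ht
    have hp0 := up r hr t ht
    refine (((dur r hr t ht).rpow_const (p := m - 1) (Or.inl hp0.ne')).const_mul m).congr_deriv ?_
    have e : u r t ^ (m - 1 - 1) = u r t ^ (m - 1) / u r t := Real.rpow_sub_one hp0.ne' _
    rw [e]; field_simp; ring
  refine ⟨sm, dur, dA, fun r hr t ht => ?_⟩
  have dw : ∀ r > 0, ∀ t ∈ Ioo 0 T, HasDerivAt (fun ρ => u ρ t ^ m) (ff m u 0 r t * u r t ^ m) r := by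
    intro r hr t ht
    have hp0 := up r hr t ht
    refine ((dur r hr t ht).rpow_const (p := m) (Or.inl hp0.ne')).congr_deriv ?_
    rw [Real.rpow_sub_one hp0.ne']; field_simp
  have hn0 : ((N - 1 : ℕ):ℝ) = (N:ℝ) - 1 := by rw [Nat.cast_sub (by omega)]; simp
  have pt : ∀ r > 0, ∀ t ∈ Ioo 0 T, Dt p r t = m * u r t ^ (m - 1) *
      (ff m u 1 r t + ff m u 0 r t ^ 2 + bf (N - 1) r * ff m u 0 r t) := by
    intro r hr t ht
    have hp0 := up r hr t ht
    have h1 := hu.smU.hasDt hr ht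
    have h2 : HasDerivAt (fun τ => p r τ) (m * (Dt u r t / u r t)) t :=
      (h1.log hp0.ne').const_mul m
    have h3 : HasDerivAt (deriv (fun ρ => u ρ t ^ m))
        (ff m u 1 r t * u r t ^ m + ff m u 0 r t * (ff m u 0 r t * u r t ^ m)) r := by
      refine (((sm 0).hasDr hr ht).mul (dw r hr t ht)).congr_of_eventuallyEq ?_
      filter_upwards [Ioi_mem_nhds hr] with ρ hρ
      exact (dw ρ hρ t ht).deriv
    have h4 := hu.pde r hr t ht
    rw [h3.deriv, (dw r hr t ht).deriv] at h4
    have h5 : Dt u r t = deriv (fun τ => u r τ) t := rfl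
    have h6 : Dt p r t = m * (Dt u r t / u r t) := h2.deriv
    rw [h6, h5, h4, Real.rpow_sub_one hp0.ne', bf, hn0]
    field_simp
  have h0 : Dt (ff m u 0) r t = Dr (Dt p) r t := hp.comm hr ht
  have d : HasDerivAt (fun ρ => Dt p ρ t) _ r :=
    ((dA r hr t ht).mul ((((sm 1).hasDr hr ht).add (((sm 0).hasDr hr ht).pow 2)).add
    ((bf_hasDeriv (n := N - 1) (by omega) hr).mul ((sm 0).hasDr hr ht)))).congr_of_eventuallyEq (by
      filter_upwards [Ioi_mem_nhds hr] with ρ hρ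
      exact pt ρ hρ t ht)
  have h1 : Dr (Dt p) r t = _ := d.deriv
  rw [h0, h1, hf2]
  simp only [Pi.add_apply, Pi.mul_apply, Pi.pow_apply]
  rw [← hf1]
  push_cast
  ring

lemma mkLg (hN : 2 ≤ N) (hm : m ∈ Ioo (((N : ℝ) - 2) / ((N : ℝ) + 2)) 1) (hT : 0 < T)
    (hu : IsRadialEnergySolution N m T u) :
    Lg (N - 1) (1 / m - 1) T (ff m u) (fun r t => m * u r t ^ (m - 1)) ∧ ∃ c > 0, ∀ᶠ p in LL T,
      c * (1 - p.2 / T) ^ (1 / (1 - m)) * Real.exp (-((N : ℝ) - 1) * p.1 / m) ≤ u p.1 p.2 := by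
  have hN' : (2:ℝ) ≤ N := by exact_mod_cast hN
  have hm0 : 0 < m := lt_of_le_of_lt (div_nonneg (by linarith) (by linarith)) hm.1
  have hm1 := hm.2
  have hn0 : ((N - 1 : ℕ):ℝ) = (N:ℝ) - 1 := by rw [Nat.cast_sub (by omega)]; simp
  obtain ⟨wr, ut, hwr, hut, hsol⟩ := exists_sol hN hm0 hm1 hu
  have hs := hsol (T / 4) ⟨by linarith, by linarith⟩
  obtain ⟨CB, hCB, K, hK, bc1, bc2⟩ := hs.BC (b := T / 2) (by linarith) (by linarith)
  have ctx : Ctx (N - 1) m (T / 4) (T / 2) T CB K u wr ut := by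
    refine ⟨hs, by linarith, by linarith, hCB, hK, ?_,
      hu.continuousOn.mono (prod_mono le_rfl (Icc_subset_Icc_left (by linarith))),
      fun r hr => hu.extinction r hr, bc1, bc2⟩
    have := hm.1
    rw [div_lt_iff₀ (by linarith)] at this
    rw [hn0]; linarith
  obtain ⟨b1, hb1, R, hR, c, hc, C, hC, c0, hc0, C0, hC0, hb⟩ := ctx.bounds
  obtain ⟨sm, dur, dA, pde⟩ := mk_pde hN hm0 hu
  have hμ : 0 < 1 / m - 1 := by rw [sub_pos, lt_div_iff₀ hm0]; linarith
  have hb10 : 0 < b1 := by linarith [hb1.1]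
  have hb1m : b1 ∈ Ioo 0 T := ⟨hb10, hb1.2⟩
  have hw : ∀ r ≥ R, ∀ t ∈ Ioo b1 T, 0 < u r t ∧ 0 < u r t ^ m ∧ ff m u 0 r t * u r t ^ m = wr r t := by
    intro r hr t ht
    have hr0 : 0 < r := by linarith
    have ht0 : t ∈ Ioo 0 T := ⟨hb10.trans ht.1, ht.2⟩
    have hp0 := hu.pos r hr0.le t ht0
    refine ⟨hp0, Real.rpow_pos_of_pos hp0 m, ?_⟩
    rw [hwr r hr0 t ht0]
    have h1 := (dur r hr0 t ht0).rpow_const (p := m) (Or.inl hp0.ne')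
    have h2 : Dr (fun r t => u r t ^ m) r t = _ := h1.deriv
    rw [h2, Real.rpow_sub_one hp0.ne']; field_simp
  refine ⟨⟨by omega, hμ, hT, sm, ff_succ m u, dA, pde, ⟨c0, hc0, C0, hC0, ?_⟩,
    m * C ^ (-(1 / m - 1)), by positivity, ?_⟩, ?_⟩
  · refine (LL_iff hT).2 ⟨R, hR, b1, hb1m, fun r hr t ht => ?_⟩
    dsimp only
    obtain ⟨-, h2, h3⟩ := hw r hr t ht
    obtain ⟨-, -, h4, h5⟩ := hb t ht r hr
    rw [← h3] at h4 h5
    exact ⟨le_of_mul_le_mul_right h4 h2, le_of_mul_le_mul_right h5 h2⟩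
  · refine (LL_iff hT).2 ⟨R, hR, b1, hb1m, fun r hr t ht => ?_⟩
    dsimp only
    obtain ⟨h1, h2, h3⟩ := hw r hr t ht
    obtain ⟨-, h4, -, -⟩ := hb t ht r hr
    have hS := Sf_pos (N - 1) (show 0 < r by linarith)
    have hE := Ef_pos (m := m) ht.2
    have hθ : 0 < T - t := by linarith [ht.2]
    have e1 : u r t ^ (m - 1) = (u r t ^ m) ^ (-(1 / m - 1)) := by
      rw [← Real.rpow_mul h1.le]; congr 1; field_simp; ring
    have e2 := Real.rpow_le_rpow_of_nonpos h2 h4 (by linarith : -(1 / m - 1) ≤ 0)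
    have e3 : (C * Ef m T t ^ m * (Sf (N - 1) r)⁻¹) ^ (-(1 / m - 1)) =
        C ^ (-(1 / m - 1)) * Sf (N - 1) r ^ (1 / m - 1) / (T - t) := by
      rw [Real.mul_rpow (by positivity) (by positivity), Real.mul_rpow hC.le (by positivity),
        Real.inv_rpow hS.le, Real.rpow_neg hS.le, inv_inv, Ef, ← Real.rpow_mul hθ.le, ← Real.rpow_mul hθ.le]
      have : 1 / (1 - m) * m * -(1 / m - 1) = -1 := by
        have : 1 - m ≠ 0 := by linarith
        field_simp
      rw [this, Real.rpow_neg_one]; field_simp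
    rw [e1, mul_assoc, mul_div_assoc, ← e3]
    exact mul_le_mul_of_nonneg_left e2 hm0.le
  · refine ⟨c ^ (1 / m) * T ^ (1 / (1 - m)), by positivity, (LL_iff hT).2 ⟨R, hR, b1, hb1m, fun r hr t ht => ?_⟩⟩
    dsimp only
    obtain ⟨h1, h2, h3⟩ := hw r hr t ht
    obtain ⟨h4, -, -, -⟩ := hb t ht r hr
    have hS := Sf_pos (N - 1) (show 0 < r by linarith)
    have hE := Ef_pos (m := m) ht.2
    have hθ : 0 < T - t := by linarith [ht.2]
    have e0 : c * Ef m T t ^ m * (Real.exp (((N - 1 : ℕ):ℝ) * r))⁻¹ ≤ u r t ^ m := by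
      refine le_trans ?_ h4
      have := Sf_le_exp (N - 1) (show 0 ≤ r by linarith)
      gcongr
    have e1 := Real.rpow_le_rpow (by positivity) e0 (by positivity : 0 ≤ 1 / m)
    rw [← Real.rpow_mul h1.le, mul_one_div_cancel hm0.ne', Real.rpow_one,
      Real.mul_rpow (by positivity) (by positivity), Real.mul_rpow hc.le (by positivity),
      ← Real.rpow_mul hE.le, mul_one_div_cancel hm0.ne', Real.rpow_one, ← Real.exp_neg,
      ← Real.exp_mul, Ef] at e1
    refine le_trans (le_of_eq ?_) e1
    have e2 : T ^ (1 / (1 - m)) * (1 - t / T) ^ (1 / (1 - m)) = (T - t) ^ (1 / (1 - m)) := by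
      have ee : 1 - t / T = (T - t) / T := by field_simp
      rw [ee, ← Real.mul_rpow hT.le (by positivity)]; congr 1; field_simp
    rw [mul_assoc (c ^ (1 / m)), e2, hn0]; congr 2; ring
end

section
variable {n : ℕ} {μ T : ℝ} {f : ℕ → ℝ → ℝ → ℝ} {A : ℝ → ℝ → ℝ}

lemma Lg.lim (h : Lg n μ T f A) : Tendsto (fun p : ℝ × ℝ => f 0 p.1 p.2) (LL T) (𝓝 (-(n:ℝ))) := by
  have hT := h.hT
  have hμ := h.hμ
  have hn : (1:ℝ) ≤ n := by exact_mod_cast h.hn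
  obtain ⟨c0, hc0, C0, hC0, hf⟩ := h.fb
  obtain ⟨c, hc, hA⟩ := h.Ab
  obtain ⟨R0, hR0, t1, ht1, hreg⟩ := (LL_iff hT).1 (hf.and hA)
  dsimp only at hreg
  rw [Metric.tendsto_nhds]
  intro η' hη'
  obtain ⟨η, hη, hηη⟩ := exists_between hη'
  set D := C0 + n
  set g := μ * c0 ^ 2
  set K0 := |2 - μ| * C0 + 2 * n
  set C4 := (μ * C0 ^ 2 + 3 * C0) * n
  have hD : 0 < D := by positivity
  have hg : 0 < g := by positivity
  have hK0 : 0 < K0 := by positivity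
  obtain ⟨α, hα, hαg⟩ : ∃ α : ℝ, 0 < α ∧ α ^ 2 + K0 * α ≤ g / 2 := by
    refine ⟨min 1 (g / (2 * (1 + K0))), by positivity, ?_⟩
    set α := min 1 (g / (2 * (1 + K0)))
    have a0 : 0 < α := by positivity
    have a1 : α ≤ 1 := min_le_left _ _
    have a2 : α ≤ g / (2 * (1 + K0)) := min_le_right _ _
    rw [le_div_iff₀ (by positivity)] at a2
    have := mul_le_mul_of_nonneg_left a1 a0.le
    have : α * (2 * (1 + K0)) = 2 * α + 2 * (K0 * α) := by ring
    linarith [sq α]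
  obtain ⟨X, hX0, hX⟩ : ∃ X : ℝ, 0 < X ∧ D ≤ η / 4 * Real.exp (α * X) := by
    refine ⟨4 * D / η / α, by positivity, ?_⟩
    have e : α * (4 * D / η / α) = 4 * D / η := by field_simp
    have := Real.add_one_le_exp (4 * D / η)
    have h2 : η / 4 * (4 * D / η) = D := by field_simp
    rw [e]
    have := mul_le_mul_of_nonneg_left this (by positivity : 0 ≤ η / 4)
    linarith
  have lim1 : Tendsto (fun R : ℝ => C4 * Real.exp (-R)) atTop (𝓝 (C4 * 0)) :=
    (Real.tendsto_exp_neg_atTop_nhds_zero).const_mul _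
  have lim2 : Tendsto (fun R : ℝ => D * Real.exp (-(g * c / 2 * Sf n R ^ μ))) atTop (𝓝 (D * 0)) :=
    (Real.tendsto_exp_neg_atTop_nhds_zero.comp
      (((tendsto_rpow_atTop hμ).comp (Sf_tendsto h.hn)).const_mul_atTop (by positivity))).const_mul _
  rw [mul_zero] at lim1 lim2
  obtain ⟨R1, ⟨l1, l2⟩, l3⟩ := ((lim1.eventually_le_const (by positivity : 0 < g * η / 8)).and
    (lim2.eventually_le_const (by positivity : 0 < η / 4)) |>.and (eventually_ge_atTop R0)).exists
  refine (LL_iff hT).2 ⟨R1 + X, by linarith, (t1 + T) / 2, ⟨by linarith [ht1.1], by linarith [ht1.2]⟩, ?_⟩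
  intro r0 hr0 t0 ht0
  dsimp only
  have hθ : 0 < T - t0 := by linarith [ht0.2]
  have hS1 := Sf_pos n (show 0 < R1 by linarith)
  have main : ∀ σ : ℝ, |σ| = 1 → σ * (f 0 r0 t0 + n) ≤ η := by
    intro σ hσ
    have dom : ∀ r ∈ Icc R1 (r0 + X), ∀ t ∈ Icc (t0 - (T - t0)) t0,
        0 < r ∧ t ∈ Ioo 0 T ∧ R0 ≤ r ∧ t ∈ Ioo t1 T := by
      intro r hr t ht
      have := hr.1; have := ht.1; have := ht.2; have := ht0.1; have := ht0.2
      refine ⟨by linarith, ⟨by linarith [ht1.1], by linarith⟩, by linarith, ⟨by linarith, by linarith⟩⟩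
    refine barrier (v := fun r t => σ * (f 0 r t + n)) (v1 := fun r t => σ * f 1 r t)
      (v2 := fun r t => σ * f 2 r t) (vt := fun r t => σ * Dt (f 0) r t) (A := A)
      (K := fun r t => (2 - μ) * f 0 r t + bf n r) (G := fun r t => μ * f 0 r t ^ 2)
      (h := fun r t => σ * (-μ * f 0 r t ^ 2 * (bf n r - n) - (bf n r - n) * (2 + (bf n r - n) / n) * f 0 r t))
      (R1 := R1) (X := X) (ta := t0 - (T - t0)) (D := D) (g := g) (K0 := K0)
      (A0 := c * Sf n R1 ^ μ / (2 * (T - t0))) hα hη hD hg (by positivity) hX0 hαg hX hr0 (by linarith)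
      ?_ ?_ ?_ ?_ ?_ ?_ ?_
    · refine le_of_eq_of_le ?_ l2
      congr 3; field_simp; ring
    · refine continuousOn_const.mul (((h.sm 0).cont.mono fun q hq => ?_).add continuousOn_const)
      have := dom q.1 hq.1 q.2 hq.2
      exact ⟨this.1, this.2.1⟩
    · intro r hr t ht
      obtain ⟨d1, d2, -, -⟩ := dom r hr t ht
      exact ((h.dr 0 d1 d2).add_const _).const_mul σ
    · intro r hr t ht
      obtain ⟨d1, d2, -, -⟩ := dom r hr t ht
      exact (h.dr 1 d1 d2).const_mul σ
    · intro r hr t ht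
      obtain ⟨d1, d2, -, -⟩ := dom r hr t ht
      exact (((h.sm 0).hasDt d1 d2).add_const _).const_mul σ
    · intro r hr t ht
      obtain ⟨d1, d2, -, -⟩ := dom r hr t ht
      rw [h.pde r d1 t d2]
      have : (n:ℝ) ≠ 0 := by linarith
      field_simp
      ring
    · intro r hr t ht
      obtain ⟨d1, d2, d3, d4⟩ := dom r hr t ht
      obtain ⟨⟨k1, k2⟩, k3⟩ := hreg r d3 t d4
      have b0 := bf_ge n d1
      have b1 := bf_sub n (show 1 ≤ r by linarith)
      have b2 : Real.exp (-r) ≤ Real.exp (-R1) := Real.exp_le_exp.2 (by linarith [hr.1])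
      have b3 : Real.exp (-r) ≤ 1 := Real.exp_le_one_iff.2 (by linarith)
      have b4 : (n:ℝ) * Real.exp (-r) ≤ n * Real.exp (-R1) := by gcongr
      have b5 : (n:ℝ) * Real.exp (-r) ≤ n * 1 := by gcongr
      have fa : |f 0 r t| ≤ C0 := abs_le.2 ⟨k1, by linarith⟩
      refine ⟨?_, ?_, ?_, ?_, ?_⟩
      · refine (le_abs_self _).trans ?_
        rw [abs_mul, hσ, one_mul]
        refine (abs_add_le _ _).trans ?_
        rw [abs_of_nonneg (by linarith : (0:ℝ) ≤ n)]
        exact add_le_add fa le_rfl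
      · refine le_trans ?_ k3
        have := d4.2
        have := ht.1
        have := Sf_mono n (show 0 ≤ R1 by linarith) hr.1
        have := Sf_pos n d1
        gcongr; linarith
      · refine (abs_add_le _ _).trans (add_le_add ?_ ?_)
        · rw [abs_mul]; gcongr
        · rw [abs_of_nonneg (by linarith)]; linarith
      · have : c0 ^ 2 ≤ f 0 r t ^ 2 := by rw [← neg_sq (f 0 r t)]; exact pow_le_pow_left₀ hc0.le (by linarith) 2
        exact mul_le_mul_of_nonneg_left this hμ.le
      · refine le_trans ?_ l1
        refine (le_abs_self _).trans ?_
        rw [abs_mul, hσ, one_mul]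
        set d := bf n r - n
        have hd0 : 0 ≤ d := by linarith
        have hdn : d / n ≤ 1 := by rw [div_le_one (by linarith)]; linarith
        have hdn0 : 0 ≤ d / n := by positivity
        have e1 : |(-μ * f 0 r t ^ 2 * d)| ≤ μ * C0 ^ 2 * d := by
          rw [abs_mul, abs_mul, abs_neg, abs_of_pos hμ, abs_of_nonneg hd0, abs_pow]; gcongr
        have e2 : |d * (2 + d / n) * f 0 r t| ≤ d * 3 * C0 := by
          rw [abs_mul, abs_of_nonneg (by positivity : 0 ≤ d * (2 + d / n))]; gcongr; linarith
        refine (abs_sub _ _).trans ((add_le_add e1 e2).trans ?_)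
        have := mul_le_mul_of_nonneg_left (b1.trans b4) (by positivity : 0 ≤ μ * C0 ^ 2 + 3 * C0)
        simp only [C4]
        linarith
  have m1 := main 1 (by simp)
  have m2 := main (-1) (by simp)
  rw [Real.dist_eq]
  refine lt_of_le_of_lt (abs_le.2 ⟨?_, ?_⟩) hηη <;> linarith
end

section
variable {n : ℕ} {μ T : ℝ} {f : ℕ → ℝ → ℝ → ℝ} {A : ℝ → ℝ → ℝ}

/-- polynomial expressions in the first `k` derivatives -/
inductive Od (n : ℕ) (f : ℕ → ℝ → ℝ → ℝ) (k : ℕ) : (ℝ → ℝ → ℝ) → Prop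
  | const (c : ℝ) : Od n f k (fun _ _ => c)
  | b : Od n f k (fun r _ => bf n r)
  | var (j : ℕ) (hj : j ≤ k) : Od n f k (f j)
  | add {g h : ℝ → ℝ → ℝ} : Od n f k g → Od n f k h → Od n f k (fun r t => g r t + h r t)
  | mul {g h : ℝ → ℝ → ℝ} : Od n f k g → Od n f k h → Od n f k (fun r t => g r t * h r t)

lemma Od.mono {k l : ℕ} (hkl : k ≤ l) {g : ℝ → ℝ → ℝ} (hg : Od n f k g) : Od n f l g := by
  induction hg with
  | const c => exact .const c
  | b => exact .b
  | var j hj => exact .var j (hj.trans hkl)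
  | add _ _ h1 h2 => exact .add h1 h2
  | mul _ _ h1 h2 => exact .mul h1 h2

/-- boundedness along the filter -/
def Bd (T : ℝ) (g : ℝ → ℝ → ℝ) : Prop := ∃ C : ℝ, ∀ᶠ p in LL T, |g p.1 p.2| ≤ C

lemma Bd.of_tendsto {g : ℝ → ℝ → ℝ} {c : ℝ} (h : Tendsto (fun p : ℝ × ℝ => g p.1 p.2) (LL T) (𝓝 c)) :
    Bd T g := ⟨|c| + 1, h.abs.eventually_le_const (by linarith)⟩

lemma Od.bdd (hT : 0 < T) {k : ℕ} (hf : ∀ j ≤ k, Bd T (f j)) {g : ℝ → ℝ → ℝ} (hg : Od n f k g) : Bd T g := by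
  induction hg with
  | const c => exact ⟨|c|, Eventually.of_forall fun _ => le_rfl⟩
  | b =>
    refine ⟨2 * n, (LL_iff hT).2 ⟨1, le_rfl, T / 2, ⟨by linarith, by linarith⟩, fun r hr t _ => ?_⟩⟩
    have b0 := bf_ge n (show 0 < r by linarith)
    have b1 := bf_sub n hr
    have b3 : Real.exp (-r) ≤ 1 := Real.exp_le_one_iff.2 (by linarith)
    have hn : (0:ℝ) ≤ n := Nat.cast_nonneg n
    have := mul_le_mul_of_nonneg_left b3 hn
    dsimp only
    rw [abs_of_nonneg (by linarith)]; linarith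
  | var j hj => exact hf j hj
  | add _ _ h1 h2 =>
    obtain ⟨C1, h1⟩ := h1
    obtain ⟨C2, h2⟩ := h2
    refine ⟨C1 + C2, ?_⟩
    filter_upwards [h1, h2] with p h1 h2
    exact (abs_add_le _ _).trans (add_le_add h1 h2)
  | mul _ _ h1 h2 =>
    obtain ⟨C1, h1⟩ := h1
    obtain ⟨C2, h2⟩ := h2
    refine ⟨C1 * C2, ?_⟩
    filter_upwards [h1, h2] with p h1 h2
    rw [abs_mul]
    exact mul_le_mul h1 h2 (abs_nonneg _) ((abs_nonneg _).trans h1)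

lemma Od.deriv (h : Lg n μ T f A) {k : ℕ} {g : ℝ → ℝ → ℝ} (hg : Od n f k g) :
    ∃ H K, Od n f k H ∧ Od n f k K ∧ ∀ r > 0, ∀ t ∈ Ioo 0 T,
      HasDerivAt (fun ρ => g ρ t) (H r t + K r t * f (k + 1) r t) r := by
  induction hg with
  | const c =>
    refine ⟨_, _, .const 0, .const 0, fun r _ t _ => ?_⟩
    exact (hasDerivAt_const r c).congr_deriv (by ring)
  | b =>
    refine ⟨_, _, .add (.const n) (.mul (.const (-1 / n)) (.mul .b .b)), .const 0, fun r hr t _ => ?_⟩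
    exact (bf_hasDeriv h.hn hr).congr_deriv (by ring)
  | var j hj =>
    rcases hj.eq_or_lt with rfl | hlt
    · exact ⟨_, _, .const 0, .const 1, fun r hr t ht => (h.dr j hr ht).congr_deriv (by ring)⟩
    · exact ⟨_, _, .var (j + 1) hlt, .const 0, fun r hr t ht => (h.dr j hr ht).congr_deriv (by ring)⟩
  | add _ _ h1 h2 =>
    obtain ⟨H1, K1, a1, a2, a3⟩ := h1
    obtain ⟨H2, K2, b1, b2, b3⟩ := h2
    exact ⟨_, _, a1.add b1, a2.add b2, fun r hr t ht =>
      ((a3 r hr t ht).add (b3 r hr t ht)).congr_deriv (by ring)⟩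
  | mul g1 g2 h1 h2 =>
    obtain ⟨H1, K1, a1, a2, a3⟩ := h1
    obtain ⟨H2, K2, b1, b2, b3⟩ := h2
    exact ⟨_, _, (a1.mul g2).add (g1.mul b1), (a2.mul g2).add (g1.mul b2), fun r hr t ht =>
      ((a3 r hr t ht).mul (b3 r hr t ht)).congr_deriv (by ring)⟩

lemma Od.deriv' (h : Lg n μ T f A) {k : ℕ} {g : ℝ → ℝ → ℝ} (hg : Od n f k g) :
    ∃ g', Od n f (k + 1) g' ∧ ∀ r > 0, ∀ t ∈ Ioo 0 T, HasDerivAt (fun ρ => g ρ t) (g' r t) r := by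
  obtain ⟨H, K, a, b, c⟩ := hg.deriv h
  exact ⟨_, (a.mono k.le_succ).add ((b.mono k.le_succ).mul (.var (k + 1) le_rfl)), c⟩

/-- evolution step: quadratic structure -/
lemma Lg.step (h : Lg n μ T f A) (k : ℕ) {K H : ℝ → ℝ → ℝ} (hK : Od n f k K) (hH : Od n f k H)
    (he : ∀ r > 0, ∀ t ∈ Ioo 0 T, Dt (f k) r t = A r t * (f (k + 2) r t + K r t * f (k + 1) r t + H r t)) :
    ∃ K' a b c, Od n f k K' ∧ Od n f k a ∧ Od n f k b ∧ Od n f k c ∧ ∀ r > 0, ∀ t ∈ Ioo 0 T,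
      Dt (f (k + 1)) r t = A r t * (f (k + 3) r t + K' r t * f (k + 2) r t +
        (a r t + b r t * f (k + 1) r t + c r t * (f (k + 1) r t * f (k + 1) r t))) := by
  obtain ⟨K1, K2, o1, o2, dK⟩ := hK.deriv h
  obtain ⟨H1, H2, o3, o4, dH⟩ := hH.deriv h
  have f0 : Od n f k (f 0) := .var 0 k.zero_le
  have m0 : Od n f k (fun r t => -μ * f 0 r t) := .mul (.const (-μ)) f0
  refine ⟨_, _, _, _, hK.add m0, o3.add (m0.mul hH), (o1.add o4).add (m0.mul hK), o2, fun r hr t ht => ?_⟩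
  have e1 : Dt (f (k + 1)) r t = Dr (Dt (f k)) r t := by rw [h.fs]; exact (h.sm k).comm hr ht
  have d : HasDerivAt (fun ρ => Dt (f k) ρ t) _ r :=
    ((h.Ar r hr t ht).mul (((h.dr (k + 2) hr ht).add ((dK r hr t ht).mul (h.dr (k + 1) hr ht))).add
      (dH r hr t ht))).congr_of_eventuallyEq (by
        filter_upwards [Ioi_mem_nhds hr] with ρ hρ
        exact he ρ hρ t ht)
  have e2 : Dr (Dt (f k)) r t = _ := d.deriv
  rw [e1, e2]
  simp only [Pi.add_apply, Pi.mul_apply]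
  ring

lemma Lg.evol (h : Lg n μ T f A) (k : ℕ) : ∃ K H, Od n f k K ∧ Od n f k H ∧ ∀ r > 0, ∀ t ∈ Ioo 0 T,
    Dt (f k) r t = A r t * (f (k + 2) r t + K r t * f (k + 1) r t + H r t) := by
  induction k with
  | zero =>
    have f0 : Od n f 0 (f 0) := .var 0 le_rfl
    have m0 : Od n f 0 (fun r t => -μ * f 0 r t) := .mul (.const (-μ)) f0
    refine ⟨_, _, .add (.mul (.const (2 - μ)) f0) .b, .add ((m0.mul f0).mul (f0.add .b))
      (.mul (.add (.const n) (.mul (.const (-1 / n)) (.mul .b .b))) f0), fun r hr t ht => ?_⟩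
    rw [h.pde r hr t ht]; ring
  | succ k ih =>
    obtain ⟨K, H, hK, hH, he⟩ := ih
    obtain ⟨K', a, b, c, o1, o2, o3, o4, e⟩ := h.step k hK hH he
    have v : Od n f (k + 1) (f (k + 1)) := .var _ le_rfl
    exact ⟨_, _, o1.mono k.le_succ, ((o2.mono k.le_succ).add ((o3.mono k.le_succ).mul v)).add
      ((o4.mono k.le_succ).mul (v.mul v)), e⟩
end

lemma bern_alg1 {C : ℝ} (hC : 1 ≤ C) : ∃ C1 : ℝ, 0 ≤ C1 ∧ ∀ f f1 e K H K' H' : ℝ, |e| ≤ C → |K| ≤ C → |H| ≤ C →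
    |K'| ≤ C → |H'| ≤ C * (1 + f ^ 2) →
    -2 * (16 * C ^ 2 + e ^ 2) * f1 ^ 2 + 2 * (16 * C ^ 2 + e ^ 2) * K' * f * f1 - 8 * e * f ^ 2 * f1
      + 2 * (16 * C ^ 2 + e ^ 2) * f * H' + 2 * e * f ^ 3 * K + 2 * e * f ^ 2 * H - 2 * f ^ 4 ≤
    -(1/2) * f ^ 4 + C1 := by
  have hC0 : 0 < C := by linarith
  refine ⟨(17 * C ^ 4 + 2 * C ^ 2 + 34 * C ^ 3 + (34 * C ^ 3 + 2 * C ^ 2) ^ 2) ^ 2 + 34 * C ^ 3, by positivity, ?_⟩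
  intro f f1 e K H K' H' he hK hH hK' hH'
  set E := 16 * C ^ 2 + e ^ 2 with hE
  set y := |f| with hy
  have hy0 : 0 ≤ y := abs_nonneg f
  have y2 : f ^ 2 = y ^ 2 := (sq_abs f).symm
  have y4 : f ^ 4 = y ^ 4 := by rw [show f ^ 4 = (f ^ 2) ^ 2 by ring, y2]; ring
  have he2 : e ^ 2 ≤ C ^ 2 := sq_le_sq' (abs_le.1 he).1 (abs_le.1 he).2
  have hK2 : K' ^ 2 ≤ C ^ 2 := sq_le_sq' (abs_le.1 hK').1 (abs_le.1 hK').2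
  have hE1 : E ≤ 17 * C ^ 2 := by linarith
  have hE0 : 16 * C ^ 2 ≤ E := by linarith [sq_nonneg e]
  have hEp : 0 ≤ E := by positivity
  have t1 : 2 * E * K' * f * f1 ≤ E * f1 ^ 2 + 17 * C ^ 4 * y ^ 2 := by
    have a : E * (K' ^ 2 * f ^ 2) ≤ (17 * C ^ 2) * (C ^ 2 * y ^ 2) := by rw [y2]; gcongr
    linarith [mul_nonneg hEp (sq_nonneg (f1 - K' * f))]
  have t2 : -8 * e * f ^ 2 * f1 ≤ E * f1 ^ 2 + y ^ 4 := by
    have a : 16 * e ^ 2 * f1 ^ 2 ≤ E * f1 ^ 2 := by gcongr; linarith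
    rw [← y4]
    linarith [sq_nonneg (4 * e * f1 + f ^ 2)]
  have t3 : 2 * E * f * H' ≤ 34 * C ^ 3 * (y + y ^ 3) := by
    have a : |2 * E * f * H'| ≤ 2 * (17 * C ^ 2) * y * (C * (1 + f ^ 2)) := by
      rw [abs_mul, abs_mul, abs_of_nonneg (by positivity : 0 ≤ 2 * E)]; gcongr
    rw [y2] at a
    linarith [le_abs_self (2 * E * f * H')]
  have t4 : 2 * e * f ^ 3 * K ≤ 2 * C ^ 2 * y ^ 3 := by
    have a : |2 * e * f ^ 3 * K| ≤ 2 * C * y ^ 3 * C := by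
      rw [abs_mul, abs_mul, abs_mul, abs_pow, abs_two]; gcongr
    linarith [le_abs_self (2 * e * f ^ 3 * K)]
  have t5 : 2 * e * f ^ 2 * H ≤ 2 * C ^ 2 * y ^ 2 := by
    have a : |2 * e * f ^ 2 * H| ≤ 2 * C * y ^ 2 * C := by
      rw [abs_mul, abs_mul, abs_mul, abs_pow, abs_two]; gcongr
    linarith [le_abs_self (2 * e * f ^ 2 * H)]
  have t6 : 34 * C ^ 3 * y ≤ 34 * C ^ 3 * (1 + y ^ 2) := by
    gcongr; linarith [sq_nonneg (y - 1), sq_nonneg y]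
  generalize hb : 34 * C ^ 3 + 2 * C ^ 2 = b
  have t7 : b * y ^ 3 ≤ 1/4 * y ^ 4 + b ^ 2 * y ^ 2 := by
    linarith [sq_nonneg (1/2 * y ^ 2 - b * y)]
  generalize ha : 17 * C ^ 4 + 2 * C ^ 2 + 34 * C ^ 3 + b ^ 2 = a
  have t8 : a * y ^ 2 ≤ 1/4 * y ^ 4 + a ^ 2 := by
    linarith [sq_nonneg (1/2 * y ^ 2 - a)]
  rw [y4]
  have e1 : a * y ^ 2 = 17 * C ^ 4 * y ^ 2 + 2 * C ^ 2 * y ^ 2 + 34 * C ^ 3 * y ^ 2 + b ^ 2 * y ^ 2 := by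
    rw [← ha]; ring
  have e2 : b * y ^ 3 = 34 * C ^ 3 * y ^ 3 + 2 * C ^ 2 * y ^ 3 := by rw [← hb]; ring
  clear ha hb
  linarith only [t1, t2, t3, t4, t5, t6, t7, t8, e1, e2]

lemma bern_alg2 {G Gr Grr Gt f A A0 C C1 z η η1 η2 : ℝ} (hC1 : 0 ≤ C1) (hz : z ∈ Ioc 0 1)
    (hη : η ∈ Ioc 0 1) (h1 : η1 ^ 2 ≤ 16 * η) (h2 : |η2| ≤ 8) (hA0 : 0 < A0) (hA : A0 ≤ A)
    (hG0 : 0 ≤ G) (hG : G ≤ 17 * C ^ 2 * f ^ 2)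
    (hGt : Gt ≤ A * (Grr + (-(1/2) * f ^ 4 + C1)))
    (p1 : η1 * G + η * Gr = 0) (p2 : η2 * G + 2 * (η1 * Gr) + η * Grr ≤ 0)
    (p3 : 0 ≤ A0 * η * G + z * η * Gt) :
    z * η * f ^ 2 ≤ 1 + 2 * (697 * C ^ 2 + C1) := by
  obtain ⟨z0, z1⟩ := hz
  obtain ⟨e0, e1⟩ := hη
  have hAp : 0 < A := by linarith
  have q1 : η * Grr ≤ 40 * G := by
    have a1 := mul_le_mul_of_nonneg_left p2 e0.le
    have a2 : η * Gr = -(η1 * G) := by linarith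
    have a3 : η * (η1 * Gr) = -(η1 ^ 2 * G) := by linear_combination η1 * a2
    have a4 : η1 ^ 2 * G ≤ 16 * η * G := by gcongr
    have a5 : -(η2 * G) ≤ 8 * G := by
      have := mul_le_mul_of_nonneg_right (show -η2 ≤ 8 by linarith [(abs_le.1 h2).1]) hG0
      linarith
    have a6 := mul_le_mul_of_nonneg_left a5 e0.le
    refine le_of_mul_le_mul_left ?_ e0
    linarith
  have q2 : z * η * Gt ≤ A * (z * (40 * G) + z * η * (-(1/2) * f ^ 4 + C1)) := by
    have b1 := mul_le_mul_of_nonneg_left hGt (by positivity : 0 ≤ z * η)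
    have b2 := mul_le_mul_of_nonneg_left q1 (by positivity : 0 ≤ A * z)
    linarith
  have q3 : A0 * η * G ≤ A * (1 * G) := by
    rw [mul_assoc]; gcongr
  have q4 : 0 ≤ G + z * (40 * G) + z * η * (-(1/2) * f ^ 4 + C1) := by
    refine nonneg_of_mul_nonneg_right (a := A) ?_ hAp
    linarith
  have q5 : z * (40 * G) ≤ 1 * (40 * G) := by gcongr
  have ze : z * η ≤ 1 := mul_le_one₀ z1 e0.le e1
  have q6 : z * η * C1 ≤ 1 * C1 := by gcongr
  set x := z * η * f ^ 2 with hx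
  have hzη : 0 ≤ z * η := by positivity
  have hx0 : 0 ≤ x := by positivity
  have q7 : 1/2 * (z * η * f ^ 4) ≤ 697 * C ^ 2 * f ^ 2 + C1 := by linarith
  have q8 : 1/2 * x ^ 2 ≤ 697 * C ^ 2 * x + C1 := by
    have := mul_le_mul_of_nonneg_left q7 hzη
    have e : z * η * (697 * C ^ 2 * f ^ 2 + C1) = 697 * C ^ 2 * x + z * η * C1 := by rw [hx]; ring
    have e' : z * η * (1/2 * (z * η * f ^ 4)) = 1/2 * x ^ 2 := by rw [hx]; ring
    linarith
  by_contra hcon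
  push Not at hcon
  have c1 : 0 ≤ 697 * C ^ 2 := by positivity
  have hx1 : 1 ≤ x := by linarith
  have c2 := mul_lt_mul_of_pos_left hcon (by linarith : 0 < x)
  have c3 := mul_le_mul_of_nonneg_left hx1 hC1
  linarith [sq x]

lemma bern {C : ℝ} (hC : 1 ≤ C) : ∃ M : ℝ, ∀ (e f f1 f2 et ft A K H K' H' : ℝ → ℝ → ℝ) (r0 t0 A0 : ℝ),
    0 < A0 →
    ContinuousOn (fun p : ℝ × ℝ => e p.1 p.2) (Icc (r0 - 1) (r0 + 1) ×ˢ Icc (t0 - 1 / A0) t0) →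
    ContinuousOn (fun p : ℝ × ℝ => f p.1 p.2) (Icc (r0 - 1) (r0 + 1) ×ˢ Icc (t0 - 1 / A0) t0) →
    (∀ r ∈ Icc (r0 - 1) (r0 + 1), ∀ t ∈ Icc (t0 - 1 / A0) t0, HasDerivAt (fun ρ => e ρ t) (f r t) r ∧
      HasDerivAt (fun ρ => f ρ t) (f1 r t) r ∧ HasDerivAt (fun ρ => f1 ρ t) (f2 r t) r ∧
      HasDerivAt (fun τ => e r τ) (et r t) t ∧ HasDerivAt (fun τ => f r τ) (ft r t) t ∧
      et r t = A r t * (f1 r t + K r t * f r t + H r t) ∧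
      ft r t = A r t * (f2 r t + K' r t * f1 r t + H' r t) ∧ A0 ≤ A r t ∧
      |e r t| ≤ C ∧ |K r t| ≤ C ∧ |H r t| ≤ C ∧ |K' r t| ≤ C ∧ |H' r t| ≤ C * (1 + f r t ^ 2)) →
    |f r0 t0| ≤ M := by
  obtain ⟨C1, hC1p, halg⟩ := bern_alg1 hC
  obtain ⟨M, hM⟩ : ∃ M, M = 1 + 2 * (697 * C ^ 2 + C1) := ⟨_, rfl⟩
  have hC0 : 0 < C := by linarith
  have hMp : 1 ≤ M := by rw [hM]; linarith [sq_nonneg C]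
  refine ⟨2 * M, ?_⟩
  intro e f f1 f2 et ft A K H K' H' r0 t0 A0 hA0 ce cf hall
  by_contra hcon
  push Not at hcon
  have hi : 0 < 1 / A0 := by positivity
  have hf0 : 2 * M < f r0 t0 ^ 2 := by
    rw [← sq_abs]
    have := mul_lt_mul'' hcon hcon (by linarith) (by linarith)
    have := mul_le_mul_of_nonneg_right hMp (show 0 ≤ M by linarith)
    linarith [sq |f r0 t0|]
  set z : ℝ → ℝ := fun t => A0 * (t - t0) + 1 with hz
  set η : ℝ → ℝ := fun r => (1 - (r - r0) ^ 2) ^ 2 with hη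
  set η1 : ℝ → ℝ := fun r => -4 * (r - r0) * (1 - (r - r0) ^ 2) with hη1
  set η2 : ℝ → ℝ := fun r => -4 + 12 * (r - r0) ^ 2 with hη2
  set E : ℝ → ℝ → ℝ := fun r t => 16 * C ^ 2 + e r t ^ 2 with hE
  set G : ℝ → ℝ → ℝ := fun r t => f r t ^ 2 * E r t with hG
  set Gr : ℝ → ℝ → ℝ := fun r t => 2 * f r t * f1 r t * E r t + 2 * e r t * f r t ^ 3 with hGr
  set Grr : ℝ → ℝ → ℝ := fun r t => 2 * E r t * (f1 r t ^ 2 + f r t * f2 r t) +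
    10 * e r t * f r t ^ 2 * f1 r t + 2 * f r t ^ 4 with hGrr
  set Gt : ℝ → ℝ → ℝ := fun r t => 2 * f r t * ft r t * E r t + f r t ^ 2 * (2 * e r t * et r t) with hGt
  have dη : ∀ r, HasDerivAt η (η1 r) r := fun r =>
    (((((hasDerivAt_id r).sub_const r0).fun_pow 2).const_sub 1).fun_pow 2).congr_deriv (by
      simp only [hη1, id]; push_cast; ring)
  have dη1 : ∀ r, HasDerivAt η1 (η2 r) r := fun r =>
    ((((hasDerivAt_id r).sub_const r0).const_mul (-4)).fun_mul
      ((((hasDerivAt_id r).sub_const r0).fun_pow 2).const_sub 1)).congr_deriv (by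
      simp only [hη2, id]; push_cast; ring)
  have dz : ∀ t, HasDerivAt z A0 t := fun t =>
    ((((hasDerivAt_id t).sub_const t0).const_mul A0).add_const 1).congr_deriv (by ring)
  have dG : ∀ r ∈ Icc (r0 - 1) (r0 + 1), ∀ t ∈ Icc (t0 - 1 / A0) t0,
      HasDerivAt (fun ρ => G ρ t) (Gr r t) r ∧ HasDerivAt (fun ρ => Gr ρ t) (Grr r t) r ∧
      HasDerivAt (fun τ => G r τ) (Gt r t) t := by
    intro r hr t ht
    obtain ⟨a1, a2, a3, a4, a5, -⟩ := hall r hr t ht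
    have dE : HasDerivAt (fun ρ => E ρ t) (2 * e r t * f r t) r :=
      ((a1.fun_pow 2).const_add _).congr_deriv (by push_cast; ring)
    have dEt : HasDerivAt (fun τ => E r τ) (2 * e r t * et r t) t :=
      ((a4.fun_pow 2).const_add _).congr_deriv (by push_cast; ring)
    refine ⟨((a2.fun_pow 2).fun_mul dE).congr_deriv (by simp only [hGr]; push_cast; ring),
      ((((a2.const_mul 2).fun_mul a3).fun_mul dE).fun_add ((a1.const_mul 2).fun_mul (a2.fun_pow 3))).congr_deriv
        (by simp only [hGrr]; push_cast; ring),
      ((a5.fun_pow 2).fun_mul dEt).congr_deriv (by simp only [hGt]; push_cast; ring)⟩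
  have zt : z (t0 - 1 / A0) = 0 := by simp only [hz]; field_simp; ring
  obtain ⟨r, hr, t, ht, hle, p1, p2, p3⟩ := pmax
    (P := fun r t => z t * (η r * G r t)) (Pr := fun r t => z t * (η1 r * G r t + η r * Gr r t))
    (Prr := fun r t => z t * ((η2 r * G r t + η1 r * Gr r t) + (η1 r * Gr r t + η r * Grr r t)))
    (Pt := fun r t => A0 * (η r * G r t) + z t * (η r * Gt r t))
    (ra := r0 - 1) (rb := r0 + 1) (ta := t0 - 1 / A0) (tb := t0) (x := r0) (y := t0)
    (by
      have a1 : Continuous η := by fun_prop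
      have a3 : Continuous z := by fun_prop
      exact (a3.comp continuous_snd).continuousOn.mul ((a1.comp continuous_fst).continuousOn.mul
        ((cf.pow 2).mul (continuousOn_const.add (ce.pow 2)))))
    (fun r hr t ht => ((dη r).fun_mul (dG r (Ioo_subset_Icc_self hr) t ht).1).const_mul (z t))
    (fun r hr t ht => by
      obtain ⟨a1, a2, -⟩ := dG r (Ioo_subset_Icc_self hr) t ht
      exact (((dη1 r).fun_mul a1).fun_add ((dη r).fun_mul a2)).const_mul (z t))
    (fun r hr t ht => (dz t).fun_mul ((dG r (Ioo_subset_Icc_self hr) t ht).2.2.const_mul (η r)))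
    ⟨by linarith, by linarith⟩ ⟨by linarith, le_rfl⟩
    (fun t ht => by simp [hη]) (fun t ht => by simp [hη]) (fun r hr => by simp only [zt, zero_mul, le_refl])
    (by
      have : z t0 = 1 := by simp [hz]
      have h2 : η r0 = 1 := by simp [hη]
      simp only [this, h2, one_mul, hG, hE]
      have : 0 < f r0 t0 ^ 2 := by linarith
      positivity)
  have hrI := Ioo_subset_Icc_self hr
  have htI := Ioc_subset_Icc_self ht
  obtain ⟨-, -, -, -, -, q1, q2, q3, q4, q5, q6, q7, q8⟩ := hall r hrI t htI
  have hz0 : 0 < z t := by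
    rw [← zt]; simp only [hz]
    have := mul_lt_mul_of_pos_left ht.1 hA0
    linarith
  have hz1 : z t ≤ 1 := by
    simp only [hz]
    have := mul_le_mul_of_nonneg_left ht.2 hA0.le
    linarith
  have hs : (r - r0) ^ 2 < 1 := by
    rw [sq_lt_one_iff_abs_lt_one, abs_lt]; constructor <;> linarith [hr.1, hr.2]
  have hs0 := sq_nonneg (r - r0)
  have hη0 : 0 < η r := by simp only [hη]; have : 0 < 1 - (r - r0) ^ 2 := by linarith
                           positivity
  have hη1' : η r ≤ 1 := by simp only [hη]; exact pow_le_one₀ (by linarith) (by linarith)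
  have he2 : e r t ^ 2 ≤ C ^ 2 := sq_le_sq' (abs_le.1 q4).1 (abs_le.1 q4).2
  have hGle : G r t ≤ 17 * C ^ 2 * f r t ^ 2 := by
    simp only [hG, hE]
    rw [mul_comm]
    gcongr; linarith
  have key := bern_alg2 (C := C) (C1 := C1) (G := G r t) (Gr := Gr r t) (Grr := Grr r t) (Gt := Gt r t) (f := f r t)
    (A := A r t) (A0 := A0) (z := z t) (η := η r) (η1 := η1 r) (η2 := η2 r) hC1p ⟨hz0, hz1⟩ ⟨hη0, hη1'⟩
    (by
      have : η1 r ^ 2 = 16 * (r - r0) ^ 2 * η r := by simp only [hη1, hη]; ring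
      rw [this]
      have := mul_le_mul_of_nonneg_right hs.le hη0.le
      linarith)
    (by simp only [hη2]; exact abs_le.2 ⟨by linarith, by linarith⟩) hA0 q3
    (by simp only [hG, hE]; positivity) hGle
    (by
      have := mul_le_mul_of_nonneg_left (halg _ (f1 r t) _ _ _ _ _ q4 q5 q6 q7 q8) (hA0.le.trans q3)
      simp only [hGt, hGrr]
      rw [q1, q2]
      simp only [hE]
      linarith)
    ((mul_eq_zero.1 p1).resolve_left hz0.ne')
    (by
      have := nonpos_of_mul_nonpos_right p2 hz0
      linarith)
    (by linarith)
  have z0 : z t0 = 1 := by simp [hz]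
  have h0 : η r0 = 1 := by simp [hη]
  rw [z0, h0, one_mul, one_mul] at hle
  have l1 : 16 * C ^ 2 * f r0 t0 ^ 2 ≤ G r0 t0 := by
    simp only [hG, hE]; rw [mul_comm]; gcongr; linarith [sq_nonneg (e r0 t0)]
  have l2 : z t * (η r * G r t) ≤ 17 * C ^ 2 * M := by
    have := mul_le_mul_of_nonneg_left hGle (by positivity : 0 ≤ z t * η r)
    have := mul_le_mul_of_nonneg_left key (by positivity : 0 ≤ 17 * C ^ 2)
    rw [← hM] at this
    linarith
  have l3 := mul_lt_mul_of_pos_left hf0 (by positivity : 0 < 16 * C ^ 2)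
  have : 0 < C ^ 2 * M := by positivity
  linarith

section
variable {n : ℕ} {μ T : ℝ} {f : ℕ → ℝ → ℝ → ℝ} {A : ℝ → ℝ → ℝ}

lemma Bd.pos {g : ℝ → ℝ → ℝ} (h : Bd T g) : ∃ C : ℝ, 0 ≤ C ∧ ∀ᶠ p in LL T, |g p.1 p.2| ≤ C := by
  obtain ⟨C, hC⟩ := h
  exact ⟨|C|, abs_nonneg C, hC.mono fun p hp => hp.trans (le_abs_self C)⟩

lemma Lg.bdd_step (h : Lg n μ T f A) (k : ℕ) (ih : ∀ j ≤ k, Bd T (f j)) : Bd T (f (k + 1)) := by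
  have hT := h.hT
  obtain ⟨K, H, oK, oH, he⟩ := h.evol k
  obtain ⟨K', a, b, c, oK', oa, ob, oc, he'⟩ := h.step k oK oH he
  obtain ⟨C1, p1, h1⟩ := (ih k le_rfl).pos
  obtain ⟨C2, p2, h2⟩ := (oK.bdd hT ih).pos
  obtain ⟨C3, p3, h3⟩ := (oH.bdd hT ih).pos
  obtain ⟨C4, p4, h4⟩ := (oK'.bdd hT ih).pos
  obtain ⟨C5, p5, h5⟩ := (oa.bdd hT ih).pos
  obtain ⟨C6, p6, h6⟩ := (ob.bdd hT ih).pos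
  obtain ⟨C7, p7, h7⟩ := (oc.bdd hT ih).pos
  obtain ⟨c0, hc0, hA⟩ := h.Ab
  obtain ⟨R0, hR0, t1, ht1, hreg⟩ := (LL_iff hT).1
    ((h1.and (h2.and (h3.and h4))).and ((h5.and (h6.and h7)).and hA))
  dsimp only at hreg
  obtain ⟨M, hM⟩ := bern (C := 1 + C1 + C2 + C3 + C4 + C5 + C6 + C7) (by linarith)
  obtain ⟨R1, hS1, hR1⟩ := ((((tendsto_rpow_atTop h.hμ).comp (Sf_tendsto h.hn)).eventually_ge_atTop
    (2 / c0)).and (eventually_ge_atTop R0)).exists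
  refine ⟨M, (LL_iff hT).2 ⟨R1 + 1, by linarith, (t1 + T) / 2,
    ⟨by linarith [ht1.1], by linarith [ht1.2]⟩, fun r0 hr0 t0 ht0 => ?_⟩⟩
  have hθ : 0 < T - t0 := by linarith [ht0.2]
  have dom : ∀ r ∈ Icc (r0 - 1) (r0 + 1), ∀ t ∈ Icc (t0 - 1 / (1 / (T - t0))) t0,
      0 < r ∧ t ∈ Ioo 0 T ∧ R1 ≤ r ∧ t ∈ Ioo t1 T ∧ T - t ≤ 2 * (T - t0) := by
    intro r hr t ht
    rw [one_div_one_div] at ht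
    have := hr.1; have := ht.1; have := ht.2; have := ht0.1; have := ht0.2; have := ht1.1
    exact ⟨by linarith, ⟨by linarith, by linarith⟩, by linarith, ⟨by linarith, by linarith⟩, by linarith⟩
  refine hM (f k) (f (k + 1)) (f (k + 2)) (f (k + 3)) (Dt (f k)) (Dt (f (k + 1))) A K H K'
    (fun r t => a r t + b r t * f (k + 1) r t + c r t * (f (k + 1) r t * f (k + 1) r t))
    r0 t0 (1 / (T - t0)) (by positivity) ?_ ?_ ?_
  · refine (h.sm k).cont.mono fun q hq => ?_
    have := dom q.1 hq.1 q.2 hq.2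
    exact ⟨this.1, this.2.1⟩
  · refine (h.sm (k + 1)).cont.mono fun q hq => ?_
    have := dom q.1 hq.1 q.2 hq.2
    exact ⟨this.1, this.2.1⟩
  intro r hr t ht
  obtain ⟨d1, d2, d3, d4, d5⟩ := dom r hr t ht
  obtain ⟨⟨k1, k2, k3, k4⟩, ⟨k5, k6, k7⟩, k8⟩ := hreg r (by linarith) t d4
  refine ⟨h.dr k d1 d2, h.dr (k + 1) d1 d2, h.dr (k + 2) d1 d2, (h.sm k).hasDt d1 d2,
    (h.sm (k + 1)).hasDt d1 d2, he r d1 t d2, he' r d1 t d2, ?_, by linarith, by linarith, by linarith,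
    by linarith, ?_⟩
  · refine le_trans ?_ k8
    have hS : Sf n R1 ^ μ ≤ Sf n r ^ μ := Real.rpow_le_rpow (Sf_nonneg n (by linarith))
      (Sf_mono n (by linarith) d3) h.hμ.le
    have h2 : 2 ≤ c0 * Sf n r ^ μ := by
      have := mul_le_mul_of_nonneg_left (hS1.trans hS) hc0.le
      rwa [mul_div_cancel₀ _ hc0.ne'] at this
    have : 0 < T - t := by linarith [d2.2]
    calc 1 / (T - t0) = 2 / (2 * (T - t0)) := by field_simp
      _ ≤ 2 / (T - t) := by gcongr
      _ ≤ _ := by gcongr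
  · generalize f (k + 1) r t = y
    have e1 : |b r t * y| ≤ C6 * |y| := by rw [abs_mul]; gcongr
    have e2 : |c r t * (y * y)| ≤ C7 * y ^ 2 := by
      rw [abs_mul, ← sq, abs_of_nonneg (sq_nonneg y)]; gcongr
    have e3 : C6 * |y| ≤ C6 * (1 + y ^ 2) := by
      gcongr; rw [← sq_abs y]; linarith [sq_nonneg (|y| - 1), sq_nonneg |y|]
    have e4 : 0 ≤ (1 + C1 + C2 + C3 + C4) * (1 + y ^ 2) := by positivity
    have e5 : 0 ≤ C5 * y ^ 2 := by positivity
    refine (abs_add_three _ _ _).trans ?_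
    linarith

lemma Lg.bdd (h : Lg n μ T f A) (k : ℕ) : Bd T (f k) := by
  induction k using Nat.strong_induction_on with
  | _ k ih =>
    cases k with
    | zero => exact Bd.of_tendsto h.lim
    | succ k => exact h.bdd_step k fun j hj => ih j (by omega)

lemma landau (hT : 0 < T) {g g1 g2 : ℝ → ℝ → ℝ} {c : ℝ}
    (hg : Tendsto (fun p : ℝ × ℝ => g p.1 p.2) (LL T) (𝓝 c))
    (h1 : ∀ r > 0, ∀ t ∈ Ioo 0 T, HasDerivAt (fun ρ => g ρ t) (g1 r t) r)
    (h2 : ∀ r > 0, ∀ t ∈ Ioo 0 T, HasDerivAt (fun ρ => g1 ρ t) (g2 r t) r) (hb : Bd T g2) :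
    Tendsto (fun p : ℝ × ℝ => g1 p.1 p.2) (LL T) (𝓝 0) := by
  rw [Metric.tendsto_nhds] at hg ⊢
  intro ε hε
  obtain ⟨C', hC', hC2⟩ := hb.pos
  obtain ⟨C, hC, hCC⟩ : ∃ C, 0 < C ∧ C' ≤ C := ⟨C' + 1, by linarith, by linarith⟩
  obtain ⟨h, hh, hhC⟩ : ∃ h, 0 < h ∧ C * h = ε / 4 := ⟨ε / 4 / C, by positivity, by field_simp⟩
  obtain ⟨R, hR, t1, ht1, hreg⟩ := (LL_iff hT).1 ((hg (ε * h / 8) (by positivity)).and hC2)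
  dsimp only at hreg
  refine (LL_iff hT).2 ⟨R, hR, t1, ht1, fun r hr t ht => ?_⟩
  have htt : t ∈ Ioo 0 T := ⟨ht1.1.trans ht.1, ht.2⟩
  obtain ⟨x, hx, ex⟩ := exists_hasDerivAt_eq_slope (fun ρ => g ρ t) (fun ρ => g1 ρ t) (show r < r + h by linarith)
    (fun y hy => (h1 y (by linarith [hy.1]) t htt).continuousAt.continuousWithinAt)
    (fun y hy => h1 y (by linarith [hy.1]) t htt)
  obtain ⟨y, hy, ey⟩ := exists_hasDerivAt_eq_slope (fun ρ => g1 ρ t) (fun ρ => g2 ρ t) hx.1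
    (fun y hy => (h2 y (by linarith [hy.1]) t htt).continuousAt.continuousWithinAt)
    (fun y hy => h2 y (by linarith [hy.1]) t htt)
  have q1 := (hreg r hr t ht).1
  have q2 := (hreg (r + h) (by linarith) t ht).1
  have q3 := (hreg y (by linarith [hy.1]) t ht).2
  rw [Real.dist_eq] at q1 q2
  rw [Real.dist_eq, sub_zero]
  rw [eq_div_iff (by linarith)] at ex
  rw [eq_div_iff (by linarith [hx.1])] at ey
  have e1 : |g1 x t| ≤ ε / 4 := by
    have : |g1 x t| * h ≤ ε / 4 * h := by
      rw [← abs_of_pos hh, ← abs_mul, abs_of_pos hh]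
      rw [show g1 x t * h = g (r + h) t - c - (g r t - c) by linarith]
      refine (abs_sub _ _).trans ?_
      linarith
    exact le_of_mul_le_mul_right this hh
  have e2 : |g1 x t - g1 r t| ≤ ε / 4 := by
    rw [← ey, abs_mul, ← hhC]
    refine mul_le_mul (q3.trans hCC) ?_ (abs_nonneg _) hC.le
    rw [abs_of_pos (by linarith [hx.1])]; linarith [hx.2]
  have e3 : |g1 r t| ≤ |g1 x t| + |g1 x t - g1 r t| := by
    have := abs_sub (g1 x t) (g1 x t - g1 r t)
    rwa [sub_sub_cancel] at this
  dsimp only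
  linarith

lemma Lg.Q (h : Lg n μ T f A) {m : ℝ} {u : ℝ → ℝ → ℝ}
    (hu : ∀ r > 0, ∀ t ∈ Ioo 0 T, HasDerivAt (fun ρ => u ρ t) (f 0 r t / m * u r t) r) (k : ℕ) :
    ∃ Q, Od n f k Q ∧ Tendsto (fun p : ℝ × ℝ => Q p.1 p.2) (LL T) (𝓝 ((-(n:ℝ) / m) ^ k)) ∧
      ∀ r > 0, ∀ t ∈ Ioo 0 T, Dr^[k] u r t = u r t * Q r t := by
  induction k with
  | zero => exact ⟨_, .const 1, by rw [pow_zero]; exact tendsto_const_nhds, fun r _ t _ => by simp⟩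
  | succ k ih =>
    obtain ⟨Q, oQ, lQ, eQ⟩ := ih
    obtain ⟨Q1, oQ1, dQ1⟩ := oQ.deriv' h
    obtain ⟨Q2, oQ2, dQ2⟩ := oQ1.deriv' h
    have l1 := landau h.hT lQ dQ1 dQ2 (oQ2.bdd h.hT fun j _ => h.bdd j)
    refine ⟨_, oQ1.add (((Od.const (1 / m)).mul (.var 0 (Nat.zero_le _))).mul (oQ.mono k.le_succ)), ?_, ?_⟩
    · have := l1.add ((h.lim.const_mul (1 / m)).mul lQ)
      have e : (-(n:ℝ) / m) ^ (k+1) = 0 + 1 / m * -(n:ℝ) * (-(n:ℝ) / m) ^ k := by rw [pow_succ]; ring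
      rw [e]; exact this
    · intro r hr t ht
      rw [Function.iterate_succ_apply']
      have d : HasDerivAt (fun ρ => Dr^[k] u ρ t) _ r :=
        ((hu r hr t ht).mul (dQ1 r hr t ht)).congr_of_eventuallyEq (by
          filter_upwards [Ioi_mem_nhds hr] with ρ hρ
          exact eQ ρ hρ t ht)
      have e : Dr (Dr^[k] u) r t = _ := d.deriv
      rw [e]; ring
end

lemma iter_Dr (u : ℝ → ℝ → ℝ) (t : ℝ) (k : ℕ) : (fun ρ => Dr^[k] u ρ t) = iteratedDeriv k (fun ρ => u ρ t) := by
  induction k with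
  | zero => simp
  | succ k ih => rw [iteratedDeriv_succ, ← ih, Function.iterate_succ_apply']; rfl

/-- Lower bound for the spatial derivatives near the extinction time, for large radii. -/
theorem derivative_lower_bound
    (N : ℕ) (hN : 2 ≤ N) (m T : ℝ)
    (hm : m ∈ Set.Ioo (((N : ℝ) - 2) / ((N : ℝ) + 2)) 1) (hT : 0 < T)
    (u : ℝ → ℝ → ℝ) (hu : IsRadialEnergySolution N m T u) :
    ∀ k : ℕ, 1 ≤ k → ∃ tb ∈ Set.Ioo (0:ℝ) T, ∃ rb > (0:ℝ), ∃ C > (0:ℝ),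
      ∀ r ≥ rb, ∀ t ∈ Set.Ico tb T,
        C * (1 - t / T) ^ (1 / (1 - m)) * Real.exp (-((N : ℝ) - 1) * r / m) ≤
          |iteratedDeriv k (fun ρ => u ρ t) r| := by
  intro k _
  have hN' : (2:ℝ) ≤ N := by exact_mod_cast hN
  have hm0 : 0 < m := lt_of_le_of_lt (div_nonneg (by linarith) (by linarith)) hm.1
  obtain ⟨hL, c, hc, hlow⟩ := mkLg hN hm hT hu
  obtain ⟨Q, -, lQ, eQ⟩ := hL.Q (mk_pde hN hm0 hu).2.1 k
  have hn1 : (1:ℝ) ≤ ((N - 1 : ℕ):ℝ) := by exact_mod_cast hL.hn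
  have hq : 0 < |(-((N - 1 : ℕ):ℝ) / m) ^ k| :=
    abs_pos.2 (pow_ne_zero _ (div_ne_zero (by linarith) hm0.ne'))
  generalize (-((N - 1 : ℕ):ℝ) / m) ^ k = q at lQ hq
  have l2 := lQ.abs.eventually_const_le (show |q| / 2 < |q| by linarith)
  obtain ⟨R, hR, t1, ht1, hreg⟩ := (LL_iff hT).1 (hlow.and l2)
  dsimp only at hreg
  refine ⟨(t1 + T) / 2, ⟨by linarith [ht1.1], by linarith [ht1.2]⟩, R, by linarith, c * (|q| / 2), by positivity,
    fun r hr t ht => ?_⟩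
  have ht' : t ∈ Ioo t1 T := ⟨by linarith [ht.1, ht1.2], ht.2⟩
  obtain ⟨a1, a2⟩ := hreg r hr t ht'
  have ht0 : t ∈ Ioo 0 T := ⟨ht1.1.trans ht'.1, ht.2⟩
  have hr0 : 0 < r := by linarith
  have hup := hu.pos r hr0.le t ht0
  have e := congrFun (iter_Dr u t k) r
  rw [← e, eQ r hr0 t ht0, abs_mul, abs_of_pos hup]
  have := mul_le_mul a1 a2 (by positivity) hup.le
  linarith
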